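/- Let 1 ≤ m ≤ n, let E_i = (K_1^{(i)},…,K_{t_i}^{(i)}), 1 ≤ i ≤ p, be p tuples of convex bodies in ℝ^n, and let λ^1,…,λ^p be partitions with λ^i_1 ≤ t_i and Σ_{i=1}^p |λ^i| = n−m; write Θ for the tuple of arguments (s_{λ^1}(E_1),…,s_{λ^p}(E_p)) interpreted by multilinear expansion into mixed volumes. Then for any convex bodies B, A_1,…,A_m in ℝ^n and any 1 ≤ k ≤ m: V(B[m], Θ) · V(A_1,…,A_m, Θ) ≤ 2^{k(m−k)} · V(B[k], A_{k+1},…,A_m, Θ) · V(B[m−k], A_1,…,A_k, Θ). -/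

import Mathlib

open MeasureTheory
open scoped Pointwise

namespace ConvexPaper

abbrev En (n : ℕ) := EuclideanSpace ℝ (Fin n)

noncomputable def mixedVol (n : ℕ) (L : List (Set (En n))) : ℝ :=
  ((n.factorial : ℝ))⁻¹ *
    ∑ S ∈ (Finset.range n).powerset.filter (fun S => S.Nonempty),
      (-1 : ℝ) ^ (n - S.card) * (volume (∑ i ∈ S, L.getD i 0)).toReal

/-- Elementary symmetric polynomial with integer index (`σ_k = 0` for `k < 0`). -/
noncomputable def esymmZ (e : ℕ) (k : ℤ) : MvPolynomial (Fin e) ℝ :=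
  if 0 ≤ k then MvPolynomial.esymm (Fin e) ℝ k.toNat else 0

/-- The Schur polynomial `s_λ = det[σ_{λ_i − i + j}]_{i,j=1}^N` in `e` variables,
for `λ : Fin N → ℕ`. -/
noncomputable def schur (e N : ℕ) (lam : Fin N → ℕ) : MvPolynomial (Fin e) ℝ :=
  (Matrix.of fun i j : Fin N =>
    esymmZ e ((lam i : ℤ) - ((i : ℕ) : ℤ) + ((j : ℕ) : ℤ))).det

/-- The product `∏_i s_{λ^i}(E_i)` of Schur polynomials, each in its own block of
variables, as a polynomial in the variables `(i : Fin p) × Fin (t i)`. -/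
noncomputable def schurProd (p : ℕ) (t : Fin p → ℕ) (N : Fin p → ℕ)
    (lam : ∀ i, Fin (N i) → ℕ) :
    MvPolynomial ((i : Fin p) × Fin (t i)) ℝ :=
  ∏ i : Fin p, MvPolynomial.rename (fun j => ⟨i, j⟩) (schur (t i) (N i) (lam i))

/-- Multilinear expansion of a polynomial into mixed volumes: each monomial
`c_μ·x^μ` of `P` contributes `c_μ` times the mixed volume of the bodies `K i`
with multiplicities `μ i`, together with the list `rest` of remaining arguments. -/
noncomputable def polyMixedVol (n : ℕ) {ι : Type} [Fintype ι]
    (P : MvPolynomial ι ℝ) (K : ι → Set (En n)) (rest : List (Set (En n))) : ℝ :=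
  ∑ μ ∈ P.support, P.coeff μ *
    mixedVol n
      (((Finset.univ : Finset ι).toList.map fun i => List.replicate (μ i) (K i)).flatten
        ++ rest)

end ConvexPaper

namespace ConvexPaper

section LorSec
variable {𝔸 : Type*} [CommRing 𝔸] [Algebra ℝ 𝔸]

/-- Lorentzian (reverse Cauchy–Schwarz) property of the form `χ(a·g·h)` on `V`. -/
def Lor (V : Submodule ℝ 𝔸) (χ : 𝔸 →ₗ[ℝ] ℝ) (a : 𝔸) : Prop :=
  ∀ g ∈ V, ∀ h ∈ V, 0 < χ (a * g * g) → χ (a * g * g) * χ (a * h * h) ≤ χ (a * g * h) ^ 2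

variable {V : Submodule ℝ 𝔸} {χ : 𝔸 →ₗ[ℝ] ℝ}

theorem form_swap (χ : 𝔸 →ₗ[ℝ] ℝ) (a g h : 𝔸) : χ (a * g * h) = χ (a * h * g) := by
  rw [mul_right_comm]

theorem quad_expand (χ : 𝔸 →ₗ[ℝ] ℝ) (a g h : 𝔸) (s t : ℝ) :
    χ (a * (s • g + t • h) * (s • g + t • h)) =
      s ^ 2 * χ (a * g * g) + 2 * s * t * χ (a * g * h) + t ^ 2 * χ (a * h * h) := by
  have : a * (s • g + t • h) * (s • g + t • h) =
      (s ^ 2) • (a * g * g) + (2 * s * t) • (a * g * h) + (t ^ 2) • (a * h * h) := by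
    simp only [Algebra.smul_def, map_mul, map_pow, map_ofNat]
    ring
  rw [this]; simp

theorem bil_expand (χ : 𝔸 →ₗ[ℝ] ℝ) (a k g h : 𝔸) (s t : ℝ) :
    χ (a * k * (s • g + t • h)) = s * χ (a * k * g) + t * χ (a * k * h) := by
  simp [mul_add]

theorem Lor.of_hyperplane {a : 𝔸} (ℓ : 𝔸 →ₗ[ℝ] ℝ)
    (H : ∀ g ∈ V, ℓ g = 0 → χ (a * g * g) ≤ 0) : Lor V χ a := by
  intro g hg h hh hpos
  have hne : ℓ g ≠ 0 := fun h0 => absurd (H g hg h0) (not_le.mpr hpos)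
  have key := H ((ℓ g) • h + (-(ℓ h)) • g) (V.add_mem (V.smul_mem _ hh) (V.smul_mem _ hg))
    (by simp; ring)
  rw [quad_expand, form_swap χ a h g] at key
  set P := χ (a * g * g)
  set Q := χ (a * h * h)
  set R := χ (a * g * h)
  have h2 : 0 < ℓ g ^ 2 := by positivity
  have : ℓ g ^ 2 * (P * Q) ≤ ℓ g ^ 2 * R ^ 2 := by
    nlinarith [mul_le_mul_of_nonneg_left key hpos.le, sq_nonneg (ℓ g * R - ℓ h * P)]
  exact le_of_mul_le_mul_left this h2

theorem Lor.null {a c v g : 𝔸} (hL : Lor V χ a) (hc : c ∈ V) (hv : v ∈ V) (hg : g ∈ V)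
    (hcc : χ (a * c * c) = 0) (hcv : χ (a * c * v) ≠ 0) (hcg : χ (a * c * g) = 0) :
    χ (a * g * g) ≤ 0 := by
  by_contra hpos
  push Not at hpos
  -- take `v + t c`
  set P := χ (a * g * g)
  have key : ∀ t : ℝ, P * (χ (a * v * v) + 2 * t * χ (a * c * v)) ≤ χ (a * g * v) ^ 2 := by
    intro t
    have := hL g hg ((1 : ℝ) • v + t • c) (V.add_mem (V.smul_mem _ hv) (V.smul_mem _ hc)) hpos
    rw [quad_expand, bil_expand, hcc, form_swap χ a g c, hcg, form_swap χ a v c] at this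
    simpa using this
  have hne : 2 * P * χ (a * c * v) ≠ 0 := by
    have := hpos.ne'; positivity
  have := key ((χ (a * g * v) ^ 2 - P * χ (a * v * v) + 1) / (2 * P * χ (a * c * v)))
  have e : P * (χ (a * v * v) + 2 * ((χ (a * g * v) ^ 2 - P * χ (a * v * v) + 1) /
      (2 * P * χ (a * c * v))) * χ (a * c * v)) = χ (a * g * v) ^ 2 + 1 := by
    have := hpos.ne'
    field_simp
    ring
  linarith

theorem Lor.hyperplane {a c g : 𝔸} (hL : Lor V χ a) (hc : c ∈ V) (hg : g ∈ V)
    (hcc : 0 < χ (a * c * c)) (hcg : χ (a * c * g) = 0) : χ (a * g * g) ≤ 0 := by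
  have := hL c hc g hg hcc
  rw [hcg] at this
  by_contra hpos
  push Not at hpos
  nlinarith [mul_pos hcc hpos]

/-- Trickle-down for a sum of two elements. -/
theorem Lor.T2 {u v : 𝔸} (hu : u ∈ V) (hv : v ∈ V) (hLu : Lor V χ u) (hLv : Lor V χ v)
    (ho : 0 < χ ((u + v) * u * v)) (hp : 0 ≤ χ (u * (u + v) * (u + v)))
    (hq : 0 ≤ χ (v * (u + v) * (u + v))) : Lor V χ (u + v) := by
  set c := u + v with hcdef
  have hc : c ∈ V := V.add_mem hu hv
  set o := χ (c * u * v) with hodef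
  set p := χ (u * c * c) with hpdef
  set q := χ (v * c * c) with hqdef
  have hluv : χ (c * v * u) = o := by rw [form_swap]
  have hadd : ∀ g h, χ (c * g * h) = χ (u * g * h) + χ (v * g * h) := by
    intro g h; rw [← map_add]; congr 1; rw [hcdef]; ring
  have hadd' : ∀ g h, χ (g * c * h) = χ (g * u * h) + χ (g * v * h) := by
    intro g h; rw [← map_add]; congr 1; rw [hcdef]; ring
  have huu : χ (c * u * u) = p - o := by
    have : p = χ (c * u * u) + χ (c * u * v) := by
      rw [hpdef, ← map_add]; congr 1; rw [hcdef]; ring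
    rw [this, hodef]; ring
  have hvv : χ (c * v * v) = q - o := by
    have : q = χ (c * v * v) + χ (c * u * v) := by
      rw [hqdef, ← map_add]; congr 1; rw [hcdef]; ring
    rw [this, hodef]; ring
  have cu : ∀ g, χ (u * c * g) = χ (c * u * g) := fun g => by rw [mul_comm u c]
  have cv : ∀ g, χ (v * c * g) = χ (c * v * g) := fun g => by rw [mul_comm v c]
  -- bounds
  have bu : ∀ g ∈ V, χ (c * u * g) = 0 → χ (u * g * g) ≤ 0 := by
    intro g hg h0
    rcases hp.eq_or_lt with h | h
    · exact hLu.null hc hv hg h.symm (by rw [cu]; exact ho.ne') (by rw [cu]; exact h0)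
    · exact hLu.hyperplane hc hg h (by rw [cu]; exact h0)
  have bv : ∀ g ∈ V, χ (c * v * g) = 0 → χ (v * g * g) ≤ 0 := by
    intro g hg h0
    rcases hq.eq_or_lt with h | h
    · exact hLv.null hc hu hg h.symm (by rw [cv, hluv]; exact ho.ne') (by rw [cv]; exact h0)
    · exact hLv.hyperplane hc hg h (by rw [cv]; exact h0)
  have b0 : ∀ g ∈ V, χ (c * u * g) = 0 → χ (c * v * g) = 0 → χ (c * g * g) ≤ 0 := by
    intro g hg h1 h2
    rw [hadd]; linarith [bu g hg h1, bv g hg h2]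
  have hδ0 : 0 ≤ o * (p + q) - p * q := by
    rcases hp.eq_or_lt with h | h
    · rw [← h]; nlinarith
    rcases hq.eq_or_lt with h' | h'
    · rw [← h']; nlinarith
    have h1 := hLu c hc v hv h
    have h2 := hLv c hc u hu h'
    rw [cu v, ← hodef] at h1
    rw [cv u, hluv] at h2
    have h3 : o = χ (v * u * u) + χ (u * v * v) := by
      rw [hodef, hcdef, ← map_add]; congr 1; ring
    have : p * q * o ≤ o * (o * (p + q)) := by
      have e : p * q * o = q * (p * χ (u * v * v)) + p * (q * χ (v * u * u)) := by
        conv_lhs => rw [h3]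
        ring
      rw [e]
      have k1 := mul_le_mul_of_nonneg_left h1 hq
      have k2 := mul_le_mul_of_nonneg_left h2 hp
      linarith
    nlinarith
  refine Lor.of_hyperplane (χ ∘ₗ LinearMap.mulLeft ℝ (c * c)) ?_
  intro g hg h0
  have h0' : χ (c * c * g) = 0 := h0
  set κ := χ (c * u * g) with hκ
  have hκv : χ (c * v * g) = -κ := by
    have : χ (c * c * g) = χ (c * u * g) + χ (c * v * g) := hadd' c g
    linarith
  have hgu : χ (c * g * u) = κ := by rw [form_swap]
  have hgv : χ (c * g * v) = -κ := by rw [form_swap, hκv]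
  rcases hδ0.eq_or_lt with hδ | hδ
  · rcases hp.eq_or_lt with h | h
    · have hq0 : q = 0 := by
        have : o * q = 0 := by rw [← h] at hδ; linarith
        rcases mul_eq_zero.mp this with h | h
        · exact absurd h ho.ne'
        · exact h
      -- p = q = 0
      have m : (1 : ℝ) • g + (κ / o) • u ∈ V := V.add_mem (V.smul_mem _ hg) (V.smul_mem _ hu)
      have k := b0 _ m (by rw [bil_expand, ← hκ, huu, ← h]; field_simp; ring)
        (by rw [bil_expand, hκv, hluv]; field_simp; ring)
      rw [quad_expand, huu, hgu, ← h] at k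
      have e : (κ / o) ^ 2 * (0 - o) = - (κ ^ 2 / o) := by field_simp; ring
      have e' : 2 * 1 * (κ / o) * κ = 2 * (κ ^ 2 / o) := by field_simp
      rw [e, e'] at k
      have : 0 ≤ κ ^ 2 / o := by positivity
      linarith
    · have hq' : 0 < q := by
        rcases hq.eq_or_lt with h' | h'
        · rw [← h'] at hδ; nlinarith [mul_pos ho h]
        · exact h'
      have star : ∀ w ∈ V, p * q * χ (c * w * w) ≤
          q * χ (c * u * w) ^ 2 + p * χ (c * v * w) ^ 2 := by
        intro w hw
        have h1 := hLu c hc w hw h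
        have h2 := hLv c hc w hw hq'
        rw [cu w] at h1
        rw [cv w] at h2
        rw [hadd w w]
        nlinarith [mul_le_mul_of_nonneg_left h1 hq, mul_le_mul_of_nonneg_left h2 hp]
      have w0m : q • u + (-p) • v ∈ V := V.add_mem (V.smul_mem _ hu) (V.smul_mem _ hv)
      have w1 : χ (c * u * (q • u + (-p) • v)) = 0 := by
        rw [bil_expand, huu, ← hodef]; linarith
      have w2 : χ (c * v * (q • u + (-p) • v)) = 0 := by
        rw [bil_expand, hvv, hluv]; linarith
      have w3 : χ (c * g * (q • u + (-p) • v)) = (p + q) * κ := by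
        rw [bil_expand, hgu, hgv]; ring
      have w4 : χ (c * (q • u + (-p) • v) * (q • u + (-p) • v)) = 0 := by
        rw [quad_expand, huu, hvv, ← hodef]
        linear_combination (p + q) * hδ
      have hκ0 : κ = 0 := by
        by_contra hne
        have k2 : ∀ t : ℝ, p * q * (χ (c * g * g) + 2 * t * ((p + q) * κ)) ≤ (p + q) * κ ^ 2 := by
          intro t
          have := star ((1 : ℝ) • g + t • (q • u + (-p) • v))
            (V.add_mem (V.smul_mem _ hg) (V.smul_mem _ w0m))
          rw [quad_expand, w3, w4, bil_expand χ c u g, bil_expand χ c v g, w1, w2, ← hκ,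
            hκv] at this
          linarith
        have hne' : p * q * 2 * ((p + q) * κ) ≠ 0 := by
          have : p + q ≠ 0 := by positivity
          have := h.ne'
          have := hq'.ne'
          positivity
        have k3 := k2 (((p + q) * κ ^ 2 - p * q * χ (c * g * g) + 1) /
          (p * q * 2 * ((p + q) * κ)))
        have e : p * q * (χ (c * g * g) + 2 * (((p + q) * κ ^ 2 - p * q * χ (c * g * g) + 1) /
          (p * q * 2 * ((p + q) * κ))) * ((p + q) * κ)) = (p + q) * κ ^ 2 + 1 := by
          have : p + q ≠ 0 := by positivity
          have := h.ne'
          have := hq'.ne'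
          field_simp
          ring
        linarith
      exact b0 g hg (by rw [← hκ, hκ0]) (by rw [hκv, hκ0, neg_zero])
  · set δ := o * (p + q) - p * q with hδd
    have w0m : q • u + (-p) • v ∈ V := V.add_mem (V.smul_mem _ hu) (V.smul_mem _ hv)
    have w1 : χ (c * u * (q • u + (-p) • v)) = -δ := by
      rw [bil_expand, huu, ← hodef]; rw [hδd]; ring
    have w2 : χ (c * v * (q • u + (-p) • v)) = δ := by
      rw [bil_expand, hvv, hluv]; rw [hδd]; ring
    have w3 : χ (c * g * (q • u + (-p) • v)) = (p + q) * κ := by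
      rw [bil_expand, hgu, hgv]; ring
    have w4 : χ (c * (q • u + (-p) • v) * (q • u + (-p) • v)) = -δ * (p + q) := by
      rw [quad_expand, huu, hvv, ← hodef, hδd]; ring
    have k := b0 ((1 : ℝ) • g + (κ / δ) • (q • u + (-p) • v))
      (V.add_mem (V.smul_mem _ hg) (V.smul_mem _ w0m))
      (by rw [bil_expand, w1, ← hκ]; field_simp; ring)
      (by rw [bil_expand, w2, hκv]; field_simp; ring)
    rw [quad_expand, w3, w4] at k
    have e : (κ / δ) ^ 2 * (-δ * (p + q)) = - (κ ^ 2 / δ * (p + q)) := by field_simp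
    have e' : 2 * 1 * (κ / δ) * ((p + q) * κ) = 2 * (κ ^ 2 / δ * (p + q)) := by field_simp
    rw [e, e'] at k
    have : 0 ≤ κ ^ 2 / δ * (p + q) := by positivity
    linarith

end LorSec

section MatSec
open Matrix

theorem TN {J : Type*} [Fintype J] [DecidableEq J] (M : Matrix J J ℝ)
    (hsym : ∀ i j, M i j = M j i) (hoff : ∀ i j, i ≠ j → 0 ≤ M i j)
    (hp : ∀ i, 0 < ∑ j, M i j)
    (star : ∀ t : J → ℝ, ∑ i, ∑ j, M i j * t i * t j ≤
      ∑ i, (∑ j, M i j * t j) ^ 2 / (∑ j, M i j))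
    (conn : ∀ S : Set J, S.Nonempty → (∀ i ∈ S, ∀ j ∉ S, M i j = 0) → S = Set.univ)
    (x : J → ℝ) (hx : ∑ i, (∑ j, M i j) * x i = 0) :
    ∑ i, ∑ j, M i j * x i * x j ≤ 0 := by
  set p : J → ℝ := fun i => ∑ j, M i j with hpdef
  set s : J → ℝ := fun i => Real.sqrt (p i) with hs
  have hspos : ∀ i, 0 < s i := fun i => Real.sqrt_pos.mpr (hp i)
  have hss : ∀ i, s i * s i = p i := fun i => Real.mul_self_sqrt (hp i).le
  set A : Matrix J J ℝ := Matrix.of fun i j => M i j / (s i * s j) with hA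
  have hH : A.IsHermitian := by
    ext i j
    simp [hA, hsym i j, mul_comm]
  -- quadratic form bound
  have quad : ∀ t : J → ℝ, ∑ i, p i * t i ^ 2 - ∑ i, ∑ j, M i j * t i * t j =
      (∑ i, ∑ j, M i j * (t i - t j) ^ 2) / 2 := by
    intro t
    have e1 : ∑ i, ∑ j, M i j * t i ^ 2 = ∑ i, p i * t i ^ 2 := by
      simp [hpdef, Finset.sum_mul]
    have e2 : ∑ i, ∑ j, M i j * t j ^ 2 = ∑ i, p i * t i ^ 2 := by
      rw [Finset.sum_comm, ← e1]
      simp_rw [fun i j => hsym i j]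
    have e3 : ∑ i, ∑ j, M i j * (t i - t j) ^ 2 = ∑ i, ∑ j, M i j * t i ^ 2
        + ∑ i, ∑ j, M i j * t j ^ 2 - 2 * ∑ i, ∑ j, M i j * t i * t j := by
      simp only [Finset.mul_sum, ← Finset.sum_add_distrib, ← Finset.sum_sub_distrib]
      refine Finset.sum_congr rfl fun i _ => Finset.sum_congr rfl fun j _ => by ring
    rw [e3, e1, e2]; ring
  have hnn : ∀ (t : J → ℝ) i j, 0 ≤ M i j * (t i - t j) ^ 2 := by
    intro t i j
    by_cases h : i = j
    · simp [h]
    · exact mul_nonneg (hoff i j h) (sq_nonneg _)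
  set b := hH.eigenvectorBasis with hb
  set lam := hH.eigenvalues with hlam
  set y : EuclideanSpace ℝ J := WithLp.toLp 2 fun i => s i * x i with hy
  -- generalized eigenvectors
  have key : ∀ k, lam k * inner ℝ (b k) y ^ 2 ≤ 0 := by
    intro k
    set t : J → ℝ := fun i => b k i / s i with ht
    have hbt : ∀ i, b k i = s i * t i := fun i => by
      have := (hspos i).ne'
      simp only [ht]; field_simp
    have hev := hH.mulVec_eigenvectorBasis k
    have hMt : ∀ i, ∑ j, M i j * t j = lam k * (p i * t i) := by
      intro i
      have h1 := congrFun hev i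
      simp only [Matrix.mulVec, dotProduct, Pi.smul_apply, smul_eq_mul] at h1
      rw [← hb, ← hlam] at h1
      have h2 : ∑ j, M i j * t j = s i * ∑ j, A i j * (b k).ofLp j := by
        rw [Finset.mul_sum]
        refine Finset.sum_congr rfl fun j _ => ?_
        have := (hspos i).ne'
        have := (hspos j).ne'
        rw [hbt j]; simp only [hA, Matrix.of_apply]; field_simp
      rw [h2, h1, hbt i, ← hss i]; ring
    have hnorm : ∑ i, p i * t i ^ 2 = 1 := by
      have h1 : inner ℝ (b k) (b k) = (1 : ℝ) := by
        rw [real_inner_self_eq_norm_sq, b.norm_eq_one]; norm_num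
      rw [PiLp.inner_apply] at h1
      rw [← h1]
      refine Finset.sum_congr rfl fun i _ => ?_
      rw [hbt i, ← hss i, real_inner_self_eq_norm_sq, Real.norm_eq_abs, sq_abs]; ring
    have hq : ∑ i, ∑ j, M i j * t i * t j = lam k := by
      have : ∀ i, ∑ j, M i j * t i * t j = lam k * (p i * t i ^ 2) := by
        intro i
        have : ∑ j, M i j * t i * t j = t i * ∑ j, M i j * t j := by
          rw [Finset.mul_sum]; exact Finset.sum_congr rfl fun j _ => by ring
        rw [this, hMt]; ring
      simp_rw [this]
      rw [← Finset.mul_sum, hnorm, mul_one]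
    have h1 : lam k ≤ lam k ^ 2 := by
      have := star t
      rw [hq] at this
      refine this.trans (le_of_eq ?_)
      have : ∀ i, (∑ j, M i j * t j) ^ 2 / (∑ j, M i j) = lam k ^ 2 * (p i * t i ^ 2) := by
        intro i
        have h0 : (∑ j, M i j) ≠ 0 := (hp i).ne'
        rw [hMt]
        change _ / p i = _
        have : p i ≠ 0 := h0
        field_simp
      simp_rw [this]
      rw [← Finset.mul_sum, hnorm, mul_one]
    have hqt := quad t
    have h2 : lam k ≤ 1 := by
      have h3 : 0 ≤ ∑ i, ∑ j, M i j * (t i - t j) ^ 2 :=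
        Finset.sum_nonneg fun i _ => Finset.sum_nonneg fun j _ => hnn t i j
      rw [hq, hnorm] at hqt
      linarith
    by_cases hneg : lam k ≤ 0
    · exact mul_nonpos_of_nonpos_of_nonneg hneg (sq_nonneg _)
    push Not at hneg
    have h3 : lam k = 1 := by nlinarith
    have h4 : ∑ i, ∑ j, M i j * (t i - t j) ^ 2 = 0 := by
      rw [hq, hnorm, h3] at hqt; linarith
    have h5 : ∀ i j, M i j * (t i - t j) ^ 2 = 0 := by
      intro i j
      have := (Finset.sum_eq_zero_iff_of_nonneg
        (fun i _ => Finset.sum_nonneg fun j _ => hnn t i j)).mp h4 i (Finset.mem_univ _)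
      exact (Finset.sum_eq_zero_iff_of_nonneg (fun j _ => hnn t i j)).mp this j
        (Finset.mem_univ _)
    have hS := conn {i | t i = t k} ⟨k, rfl⟩ (by
      intro i hi j hj
      rcases mul_eq_zero.mp (h5 i j) with h | h
      · exact h
      · exfalso
        apply hj
        have : t i - t j = 0 := by simpa using h
        simp only [Set.mem_ofPred_eq] at hi ⊢
        linarith)
    have hconst : ∀ i, t i = t k := fun i => by
      have : i ∈ {i | t i = t k} := by rw [hS]; trivial
      exact this
    have : inner ℝ (b k) y = 0 := by
      rw [PiLp.inner_apply]
      have : ∀ i, inner ℝ ((b k).ofLp i) (y.ofLp i) = t k * (p i * x i) := by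
        intro i
        rw [hbt i, hconst i, ← hss i]; simp [hy]; ring
      simp_rw [this]
      rw [← Finset.mul_sum, hx, mul_zero]
    rw [this]; simp
  have hfin : ∑ i, ∑ j, M i j * x i * x j = ∑ k, lam k * inner ℝ (b k) y ^ 2 := by
    set Ay : EuclideanSpace ℝ J := WithLp.toLp 2 (A *ᵥ y.ofLp) with hAy
    have h1 := b.sum_inner_mul_inner y Ay
    have h2 : inner ℝ y Ay = ∑ i, ∑ j, M i j * x i * x j := by
      rw [PiLp.inner_apply]
      refine Finset.sum_congr rfl fun i _ => ?_
      simp only [hAy, hy, Matrix.mulVec, dotProduct, hA, Matrix.of_apply]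
      rw [real_inner_eq_re_inner]
      simp only [RCLike.inner_apply, conj_trivial, RCLike.re_to_real]
      rw [Finset.sum_mul]
      refine Finset.sum_congr rfl fun j _ => ?_
      have := (hspos i).ne'
      have := (hspos j).ne'
      field_simp
    rw [← h2, ← h1]
    refine Finset.sum_congr rfl fun k _ => ?_
    have h3 : inner ℝ (b k) Ay = lam k * inner ℝ (b k) y := by
      have hev := hH.mulVec_eigenvectorBasis k
      rw [← hb, ← hlam] at hev
      have e1 : inner ℝ (b k) Ay = (b k).ofLp ⬝ᵥ (A *ᵥ y.ofLp) := by
        rw [PiLp.inner_apply]; simp [hAy, dotProduct, mul_comm]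
      have e2 : inner ℝ (b k) y = (b k).ofLp ⬝ᵥ y.ofLp := by
        rw [PiLp.inner_apply]; simp [dotProduct, mul_comm]
      rw [e1, e2, Matrix.dotProduct_mulVec, ← Matrix.mulVec_transpose]
      have : Aᵀ = A := by
        ext i j
        simp [hA, hsym i j, mul_comm]
      rw [this, hev, smul_dotProduct, smul_eq_mul]
    rw [h3, real_inner_comm]; ring
  rw [hfin]
  exact Finset.sum_nonpos fun k _ => key k

/-- Polarization identity in low degrees. -/
theorem POL {R : Type*} [CommRing R] {ι : Type*} [DecidableEq ι] (σ : Finset ι) (b : ι → R) :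
    (∀ i < σ.card, ∑ τ ∈ σ.powerset, (-1 : R) ^ τ.card * (∑ j ∈ τ, b j) ^ i = 0) ∧
    ∑ τ ∈ σ.powerset, (-1 : R) ^ τ.card * (∑ j ∈ τ, b j) ^ σ.card =
      (-1) ^ σ.card * σ.card.factorial * ∏ j ∈ σ, b j := by
  induction σ using Finset.induction_on with
  | empty => simp
  | @insert a σ ha ih =>
    have step : ∀ i, ∑ τ ∈ (insert a σ).powerset, (-1 : R) ^ τ.card * (∑ j ∈ τ, b j) ^ i =
        - ∑ l ∈ Finset.range i, (i.choose l : R) * b a ^ (i - l) *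
          ∑ τ ∈ σ.powerset, (-1 : R) ^ τ.card * (∑ j ∈ τ, b j) ^ l := by
      intro i
      rw [Finset.sum_powerset_insert ha]
      have : ∀ τ ∈ σ.powerset, (-1 : R) ^ (insert a τ).card * (∑ j ∈ insert a τ, b j) ^ i =
          - ((-1) ^ τ.card * (∑ j ∈ τ, b j) ^ i) - (-1) ^ τ.card *
            ∑ l ∈ Finset.range i, (i.choose l : R) * b a ^ (i - l) * (∑ j ∈ τ, b j) ^ l := by
        intro τ hτ
        have hna : a ∉ τ := fun h => ha (Finset.mem_powerset.mp hτ h)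
        rw [Finset.card_insert_of_notMem hna, Finset.sum_insert hna, add_comm (b a), add_pow,
          Finset.sum_range_succ]
        simp only [Nat.sub_self, pow_zero, mul_one, Nat.choose_self, Nat.cast_one]
        rw [Finset.sum_congr rfl (g := fun l => (i.choose l : R) * b a ^ (i - l) *
          (∑ j ∈ τ, b j) ^ l) (fun l _ => by ring)]
        ring
      rw [Finset.sum_congr rfl this, Finset.sum_sub_distrib, Finset.sum_neg_distrib]
      simp only [Finset.mul_sum]
      rw [Finset.sum_comm]
      simp only [add_sub, add_neg_cancel, zero_sub]
      congr 1
      refine Finset.sum_congr rfl fun l _ => Finset.sum_congr rfl fun τ _ => by ring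
    rw [Finset.card_insert_of_notMem ha]
    constructor
    · intro i hi
      rw [step, Finset.sum_eq_zero, neg_zero]
      intro l hl
      rw [ih.1 l (by have := Finset.mem_range.mp hl; omega), mul_zero]
    · rw [step, Finset.sum_range_succ, Finset.sum_eq_zero, ih.2, Finset.prod_insert ha]
      · rw [Nat.factorial_succ]
        simp
        ring
      · intro l hl
        rw [ih.1 l (Finset.mem_range.mp hl), mul_zero]

end MatSec

end ConvexPaper

namespace ConvexPaper
section BMSec
open MeasureTheory Set

theorem bm1_compact {A B C : Set ℝ} (hA : IsCompact A) (hB : IsCompact B) (hAn : A.Nonempty)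
    (hBn : B.Nonempty) (h : ∀ x ∈ A, ∀ y ∈ B, (x + y) / 2 ∈ C) :
    volume A + volume B ≤ 2 * volume C := by
  set a := sSup A
  set b := sInf B
  have ha : a ∈ A := hA.sSup_mem hAn
  have hb : b ∈ B := hB.sInf_mem hBn
  have h1 : volume (((fun x => x + b) '' A) ∪ ((fun y => y + a) '' B)) ≤ 2 * volume C := by
    have : ((fun x => x + b) '' A) ∪ ((fun y => y + a) '' B) ⊆ (fun x => (2:ℝ)⁻¹ • x) ⁻¹' C := by
      rintro z (⟨x, hx, rfl⟩ | ⟨y, hy, rfl⟩)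
      · have := h x hx b hb
        simpa [div_eq_inv_mul] using this
      · have := h a ha y hy
        simpa [div_eq_inv_mul, add_comm] using this
    refine (measure_mono this).trans (le_of_eq ?_)
    rw [Measure.addHaar_preimage_smul _ (by norm_num)]
    simp
  refine le_trans (le_of_eq ?_) h1
  have hd : AEDisjoint volume ((fun x => x + b) '' A) ((fun y => y + a) '' B) := by
    have : ((fun x => x + b) '' A) ∩ ((fun y => y + a) '' B) ⊆ {a + b} := by
      rintro z ⟨⟨x, hx, rfl⟩, ⟨y, hy, hxy⟩⟩
      have h2 : x ≤ a := le_csSup hA.bddAbove hx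
      have h3 : b ≤ y := csInf_le hB.bddBelow hy
      simp only at hxy ⊢
      simp only [mem_singleton_iff]
      linarith
    exact measure_mono_null this (by simp)
  rw [measure_union₀' ((hA.image (by fun_prop)).measurableSet.nullMeasurableSet) hd]
  congr 1
  · simp [image_add_right, measure_preimage_add_right]
  · simp [image_add_right, measure_preimage_add_right]

theorem bm1 {A B C : Set ℝ} (hA : MeasurableSet A) (hB : MeasurableSet B) (hAn : A.Nonempty)
    (hBn : B.Nonempty) (h : ∀ x ∈ A, ∀ y ∈ B, (x + y) / 2 ∈ C) :
    volume A + volume B ≤ 2 * volume C := by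
  have key : ∀ K, IsCompact K → K ⊆ A → ∀ K', IsCompact K' → K' ⊆ B →
      volume K + volume K' ≤ 2 * volume C := by
    intro K hK hKA K' hK' hKB
    obtain ⟨x, hx⟩ := hAn
    obtain ⟨y, hy⟩ := hBn
    refine le_trans (add_le_add (measure_mono (subset_insert x K))
      (measure_mono (subset_insert y K'))) ?_
    refine bm1_compact (hK.insert x) (hK'.insert y) (insert_nonempty _ _) (insert_nonempty _ _) ?_
    intro u hu v hv
    exact h u (insert_subset hx hKA hu) v (insert_subset hy hKB hv)
  have k2 : ∀ K', IsCompact K' → K' ⊆ B → volume A + volume K' ≤ 2 * volume C := by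
    intro K' hK' hKB
    have : volume A ≤ 2 * volume C - volume K' := by
      rw [hA.measure_eq_iSup_isCompact]
      refine iSup₂_le fun K hKA => iSup_le fun hK => ?_
      exact ENNReal.le_sub_of_add_le_right hK'.measure_lt_top.ne (key K hK hKA K' hK' hKB)
    calc volume A + volume K' ≤ (2 * volume C - volume K') + volume K' := by gcongr
      _ = 2 * volume C := tsub_add_cancel_of_le (le_trans le_add_self (key ∅ isCompact_empty (empty_subset _) K' hK' hKB))
  by_cases hfin : volume A = ⊤
  · have := k2 ∅ isCompact_empty (empty_subset _)
    rw [hfin] at this ⊢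
    simpa using this
  have : volume B ≤ 2 * volume C - volume A := by
    rw [hB.measure_eq_iSup_isCompact]
    refine iSup₂_le fun K hKA => iSup_le fun hK => ?_
    refine ENNReal.le_sub_of_add_le_left hfin (k2 K hK hKA)
  calc volume A + volume B ≤ volume A + (2 * volume C - volume A) := by gcongr
    _ = 2 * volume C := add_tsub_cancel_of_le (le_trans le_self_add (k2 ∅ isCompact_empty (empty_subset _)))

theorem ennreal_amgm {a b c : ENNReal} (h : a + b ≤ 2 * c) : a * b ≤ c ^ 2 := by
  by_cases hc : c = ⊤
  · simp [hc]
  have h2 : a + b ≠ ⊤ := ne_top_of_le_ne_top (ENNReal.mul_ne_top (by simp) hc) h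
  have ha : a ≠ ⊤ := ne_top_of_le_ne_top h2 le_self_add
  have hb : b ≠ ⊤ := ne_top_of_le_ne_top h2 le_add_self
  lift a to NNReal using ha
  lift b to NNReal using hb
  lift c to NNReal using hc
  norm_cast at h ⊢
  rw [← NNReal.coe_le_coe] at h ⊢
  push_cast at h ⊢
  nlinarith [sq_nonneg ((a:ℝ) - b), a.coe_nonneg, b.coe_nonneg, c.coe_nonneg]

theorem pl1_core {f g h : ℝ → ℝ} (hf : Measurable f) (hg : Measurable g) (hh : Measurable h)
    (f0 : ∀ x, 0 ≤ f x) (g0 : ∀ x, 0 ≤ g x) (h0 : ∀ x, 0 ≤ h x)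
    (f1 : ∀ x, f x ≤ 1) (g1 : ∀ x, g x ≤ 1)
    (fs : ∀ t < 1, ∃ x, t < f x) (gs : ∀ t < 1, ∃ x, t < g x)
    (H : ∀ x y, f x * g y ≤ h ((x + y) / 2) ^ 2) :
    (∫⁻ x, ENNReal.ofReal (f x)) * (∫⁻ x, ENNReal.ofReal (g x)) ≤
      (∫⁻ x, ENNReal.ofReal (h x)) ^ 2 := by
  apply ennreal_amgm
  rw [lintegral_eq_lintegral_meas_lt _ (ae_of_all _ f0) hf.aemeasurable,
    lintegral_eq_lintegral_meas_lt _ (ae_of_all _ g0) hg.aemeasurable,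
    lintegral_eq_lintegral_meas_lt _ (ae_of_all _ h0) hh.aemeasurable]
  have hanti : ∀ k : ℝ → ℝ, Antitone fun t => volume {a | t < k a} := by
    intro k s t hst
    exact measure_mono fun a ha => lt_of_le_of_lt hst ha
  rw [← lintegral_add_left (hanti f).measurable, ← lintegral_const_mul _ (hanti h).measurable]
  refine lintegral_mono_ae ?_
  filter_upwards [ae_restrict_mem measurableSet_Ioi] with t ht
  have ht : 0 < t := ht
  by_cases h1 : t < 1
  · refine bm1 (measurableSet_lt measurable_const hf) (measurableSet_lt measurable_const hg)
      (fs t h1) (gs t h1) ?_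
    intro x hx y hy
    have hx : t < f x := hx
    have hy : t < g y := hy
    have := H x y
    change t < h ((x + y) / 2)
    have h3 : t * t < f x * g y := by nlinarith
    exact lt_of_pow_lt_pow_left₀ 2 (h0 _) (by nlinarith)
  · have e1 : {a | t < f a} = ∅ := by
      ext x; simp only [mem_ofPred_eq, mem_empty_iff_false, iff_false, not_lt]
      exact (f1 x).trans (not_lt.mp h1)
    have e2 : {a | t < g a} = ∅ := by
      ext x; simp only [mem_ofPred_eq, mem_empty_iff_false, iff_false, not_lt]
      exact (g1 x).trans (not_lt.mp h1)
    simp [e1, e2]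

theorem pl1_bdd {f g h : ℝ → ENNReal} (hf : Measurable f) (hg : Measurable g) (hh : Measurable h)
    (M : ENNReal) (hM : M ≠ ⊤) (fM : ∀ x, f x ≤ M) (gM : ∀ x, g x ≤ M)
    (H : ∀ x y, f x * g y ≤ h ((x + y) / 2) ^ 2) :
    (∫⁻ x, f x) * (∫⁻ x, g x) ≤ (∫⁻ x, h x) ^ 2 := by
  set a := ⨆ x, f x with ha
  set b := ⨆ x, g x with hb
  have hfa : ∀ x, f x ≤ a := fun x => le_iSup f x
  have hgb : ∀ x, g x ≤ b := fun x => le_iSup g x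
  have at' : a ≠ ⊤ := ne_top_of_le_ne_top hM (iSup_le fM)
  have bt' : b ≠ ⊤ := ne_top_of_le_ne_top hM (iSup_le gM)
  by_cases a0 : a = 0
  · have : ∀ x, f x = 0 := fun x => le_antisymm ((hfa x).trans a0.le) zero_le
    simp [this]
  by_cases b0 : b = 0
  · have : ∀ x, g x = 0 := fun x => le_antisymm ((hgb x).trans b0.le) zero_le
    simp [this]
  obtain ⟨c, hc, c0, ct⟩ : ∃ c : ENNReal, c ^ 2 = a * b ∧ c ≠ 0 ∧ c ≠ ⊤ := by
    have hab : a * b ≠ 0 := mul_ne_zero a0 b0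
    have hab' : a * b ≠ ⊤ := ENNReal.mul_ne_top at' bt'
    refine ⟨(a * b) ^ (1 / 2 : ℝ), ?_, ?_, ?_⟩
    · rw [← ENNReal.rpow_natCast, ← ENNReal.rpow_mul]; norm_num
    · exact (ENNReal.rpow_pos (pos_iff_ne_zero.mpr hab) hab').ne'
    · exact ENNReal.rpow_ne_top_of_nonneg (by norm_num) hab'
  have f1 : ∀ x, f x / a ≤ 1 := fun x => ENNReal.div_le_of_le_mul (by simpa using hfa x)
  have g1 : ∀ x, g x / b ≤ 1 := fun x => ENNReal.div_le_of_le_mul (by simpa using hgb x)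
  have h1 : ∀ x, min (h x / c) 1 ≤ 1 := fun x => min_le_right _ _
  have ft : ∀ x, f x / a ≠ ⊤ := fun x => ne_top_of_le_ne_top (by simp) (f1 x)
  have gt' : ∀ x, g x / b ≠ ⊤ := fun x => ne_top_of_le_ne_top (by simp) (g1 x)
  have ht : ∀ x, min (h x / c) 1 ≠ ⊤ := fun x => ne_top_of_le_ne_top (by simp) (h1 x)
  have key := pl1_core (f := fun x => (f x / a).toReal) (g := fun x => (g x / b).toReal)
    (h := fun x => (min (h x / c) 1).toReal) (by fun_prop) (by fun_prop)
    (((hh.div_const c).min measurable_const).ennreal_toReal)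
    (fun _ => ENNReal.toReal_nonneg) (fun _ => ENNReal.toReal_nonneg)
    (fun _ => ENNReal.toReal_nonneg)
    (fun x => ENNReal.toReal_le_of_le_ofReal (by norm_num) (by simpa using f1 x))
    (fun x => ENNReal.toReal_le_of_le_ofReal (by norm_num) (by simpa using g1 x)) ?_ ?_ ?_
  · simp only [ENNReal.ofReal_toReal, ft, gt', ht, ne_eq, not_false_eq_true] at key
    have e1 : ∫⁻ x, f x / a = (∫⁻ x, f x) * a⁻¹ := by
      simp_rw [div_eq_mul_inv]; exact lintegral_mul_const _ hf
    have e2 : ∫⁻ x, g x / b = (∫⁻ x, g x) * b⁻¹ := by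
      simp_rw [div_eq_mul_inv]; exact lintegral_mul_const _ hg
    have e3 : ∫⁻ x, min (h x / c) 1 ≤ (∫⁻ x, h x) * c⁻¹ := by
      rw [← lintegral_mul_const _ hh]
      exact lintegral_mono fun x => min_le_left _ _
    rw [e1, e2] at key
    have k2 := key.trans (pow_le_pow_left' e3 2)
    calc (∫⁻ x, f x) * (∫⁻ x, g x)
        = ((∫⁻ x, f x) * (∫⁻ x, g x)) * (a⁻¹ * a) * (b⁻¹ * b) := by
          rw [ENNReal.inv_mul_cancel a0 at', ENNReal.inv_mul_cancel b0 bt']; simp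
      _ = ((∫⁻ x, f x) * a⁻¹ * ((∫⁻ x, g x) * b⁻¹)) * c ^ 2 := by rw [hc]; ring
      _ ≤ ((∫⁻ x, h x) * c⁻¹) ^ 2 * c ^ 2 := by gcongr
      _ = (∫⁻ x, h x) ^ 2 := by
          rw [← mul_pow, mul_assoc, ENNReal.inv_mul_cancel c0 ct, mul_one]
  · intro t ht1
    by_contra hcon
    push Not at hcon
    have t0 : 0 ≤ t := le_trans ENNReal.toReal_nonneg (hcon 0)
    have : a ≤ ENNReal.ofReal t * a := by
      refine iSup_le fun x => ?_
      have := (ENNReal.le_ofReal_iff_toReal_le (ft x) t0).mpr (hcon x)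
      exact (ENNReal.div_le_iff a0 at').mp this
    have h2 : ENNReal.ofReal t * a < 1 * a :=
      ENNReal.mul_lt_mul_left a0 at' (by simpa using ht1)
    rw [one_mul] at h2
    exact absurd this (not_le.mpr h2)
  · intro t ht1
    by_contra hcon
    push Not at hcon
    have t0 : 0 ≤ t := le_trans ENNReal.toReal_nonneg (hcon 0)
    have : b ≤ ENNReal.ofReal t * b := by
      refine iSup_le fun x => ?_
      have := (ENNReal.le_ofReal_iff_toReal_le (gt' x) t0).mpr (hcon x)
      exact (ENNReal.div_le_iff b0 bt').mp this
    have h2 : ENNReal.ofReal t * b < 1 * b :=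
      ENNReal.mul_lt_mul_left b0 bt' (by simpa using ht1)
    rw [one_mul] at h2
    exact absurd this (not_le.mpr h2)
  · intro x y
    rw [← ENNReal.toReal_mul, ← ENNReal.toReal_pow]
    refine ENNReal.toReal_mono (ENNReal.pow_ne_top (ht _)) ?_
    rcases le_total (h ((x + y) / 2) / c) 1 with h3 | h3
    · rw [min_eq_left h3]
      calc f x / a * (g y / b) = f x * g y * (a⁻¹ * b⁻¹) := by
            simp only [div_eq_mul_inv]; ring
        _ ≤ h ((x + y) / 2) ^ 2 * (a⁻¹ * b⁻¹) := by gcongr; exact H x y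
        _ = (h ((x + y) / 2) / c) ^ 2 := by
            rw [div_eq_mul_inv (h _), mul_pow, ← ENNReal.inv_pow, hc,
              ENNReal.mul_inv (Or.inl a0) (Or.inl at')]
    · rw [min_eq_right h3, one_pow]
      exact mul_le_one' (f1 x) (g1 y)

theorem pl1 {f g h : ℝ → ENNReal} (hf : Measurable f) (hg : Measurable g) (hh : Measurable h)
    (H : ∀ x y, f x * g y ≤ h ((x + y) / 2) ^ 2) :
    (∫⁻ x, f x) * (∫⁻ x, g x) ≤ (∫⁻ x, h x) ^ 2 := by
  have tr : ∀ k : ℝ → ENNReal, Measurable k →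
      Filter.Tendsto (fun n : ℕ => ∫⁻ x, min (k x) n) Filter.atTop (nhds (∫⁻ x, k x)) := by
    intro k hk
    refine lintegral_tendsto_of_tendsto_of_monotone (fun n => (hk.min measurable_const).aemeasurable)
      (ae_of_all _ fun x n m hnm => min_le_min le_rfl (by exact_mod_cast hnm))
      (ae_of_all _ fun x => ?_)
    have : Filter.Tendsto (fun n : ℕ => min (k x) (n : ENNReal)) Filter.atTop
      (nhds (min (k x) ⊤)) := tendsto_const_nhds.min ENNReal.tendsto_nat_nhds_top
    simpa using this
  have key : ∀ n : ℕ, (∫⁻ x, min (f x) n) * (∫⁻ x, min (g x) n) ≤ (∫⁻ x, h x) ^ 2 := fun n =>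
    pl1_bdd (hf.min measurable_const) (hg.min measurable_const) hh n (by simp)
      (fun x => min_le_right _ _) (fun x => min_le_right _ _)
      (fun x y => (mul_le_mul' (min_le_left _ _) (min_le_left _ _)).trans (H x y))
  by_cases f0 : ∫⁻ x, f x = 0
  · simp [f0]
  by_cases g0 : ∫⁻ x, g x = 0
  · simp [g0]
  exact le_of_tendsto' (ENNReal.Tendsto.mul (tr f hf) (Or.inl f0) (tr g hg) (Or.inl g0)) key

theorem pln : ∀ (n : ℕ) {f g h : (Fin n → ℝ) → ENNReal}, Measurable f → Measurable g →
    Measurable h → (∀ x y, f x * g y ≤ h (fun i => (x i + y i) / 2) ^ 2) →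
    (∫⁻ x, f x) * (∫⁻ x, g x) ≤ (∫⁻ x, h x) ^ 2
  | 0, f, g, h, _, _, _, H => by
    rw [Measure.volume_pi_eq_dirac]
    simp only [lintegral_dirac]
    have := H default default
    convert this using 2 <;> congr <;> ext i <;> exact i.elim0
  | n + 1, f, g, h, hf, hg, hh, H => by
    have e : ∀ k : (Fin (n + 1) → ℝ) → ENNReal, Measurable k →
        ∫⁻ x, k x = ∫⁻ s : ℝ, ∫⁻ y : Fin n → ℝ, k (Fin.cons s y) := by
      intro k hk
      have mp := (volume_preserving_piFinSuccAbove (fun _ : Fin (n + 1) => ℝ) 0).symm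
      rw [← mp.lintegral_comp hk]
      rw [Measure.volume_eq_prod, lintegral_prod]
      · simp [MeasurableEquiv.piFinSuccAbove, Fin.insertNthEquiv, Fin.insertNth_zero]
      · exact (hk.comp (MeasurableEquiv.measurable _)).aemeasurable
    have m : ∀ k : (Fin (n + 1) → ℝ) → ENNReal, Measurable k →
        Measurable fun p : ℝ × (Fin n → ℝ) => k (Fin.cons p.1 p.2) := by
      intro k hk
      refine hk.comp ?_
      rw [measurable_pi_iff]
      intro i
      refine Fin.cases ?_ (fun j => ?_) i
      · simpa using measurable_fst
      · simp only [Fin.cons_succ]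
        exact (measurable_pi_apply j).comp measurable_snd
    rw [e f hf, e g hg, e h hh]
    refine pl1 (m f hf).lintegral_prod_right' (m g hg).lintegral_prod_right'
      (m h hh).lintegral_prod_right' ?_
    intro s t
    refine pln n ((m f hf).comp (measurable_const.prodMk measurable_id))
      ((m g hg).comp (measurable_const.prodMk measurable_id))
      ((m h hh).comp (measurable_const.prodMk measurable_id)) ?_
    intro x y
    have := H (Fin.cons s x) (Fin.cons t y)
    convert this using 3
    ext i
    refine Fin.cases ?_ (fun j => ?_) i <;> simp

/-- Multiplicative Brunn–Minkowski inequality. -/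
theorem brunn_minkowski {n : ℕ} {A B C : Set (En n)} (hA : MeasurableSet A)
    (hB : MeasurableSet B) (hC : MeasurableSet C)
    (H : ∀ x ∈ A, ∀ y ∈ B, (2⁻¹ : ℝ) • (x + y) ∈ C) :
    volume A * volume B ≤ volume C ^ 2 := by
  have mp := PiLp.volume_preserving_toLp (Fin n)
  rw [← mp.measure_preimage hA.nullMeasurableSet, ← mp.measure_preimage hB.nullMeasurableSet,
    ← mp.measure_preimage hC.nullMeasurableSet]
  have mA := mp.measurable hA
  have mB := mp.measurable hB
  have mC := mp.measurable hC
  rw [← lintegral_indicator_one mA, ← lintegral_indicator_one mB, ← lintegral_indicator_one mC]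
  refine pln n (measurable_one.indicator mA) (measurable_one.indicator mB)
    (measurable_one.indicator mC) ?_
  intro x y
  by_cases hx : WithLp.toLp 2 x ∈ A
  · by_cases hy : WithLp.toLp 2 y ∈ B
    · have := H _ hx _ hy
      have h3 : (fun i => (x i + y i) / 2) ∈ WithLp.toLp 2 ⁻¹' C := by
        have e : WithLp.toLp 2 (fun i => (x i + y i) / 2) =
            (2⁻¹ : ℝ) • (WithLp.toLp 2 x + WithLp.toLp 2 y) := by
          ext i; simp [div_eq_inv_mul]; ring
        rw [mem_preimage, e]; exact this
      rw [indicator_of_mem (s := WithLp.toLp 2 ⁻¹' C) h3]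
      rw [indicator_of_mem (s := WithLp.toLp 2 ⁻¹' A) hx,
        indicator_of_mem (s := WithLp.toLp 2 ⁻¹' B) hy]
      simp
    · rw [indicator_of_notMem (s := WithLp.toLp 2 ⁻¹' B) hy]; simp
  · rw [indicator_of_notMem (s := WithLp.toLp 2 ⁻¹' A) hx]; simp

end BMSec

end ConvexPaper

namespace ConvexPaper

section PolySec
open MeasureTheory Set

/-- Combinatorial data of a simple polytope: normals, vertex sets, vertex maps. -/
structure PolyData (n : ℕ) (ι : Type) [Fintype ι] [DecidableEq ι] where
  u : ι → En n
  𝓑 : Finset (Finset ι)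
  card_eq : ∀ τ ∈ 𝓑, τ.card = n
  vert : Finset ι → (ι → ℝ) →ₗ[ℝ] En n
  vert_spec : ∀ τ ∈ 𝓑, ∀ i ∈ τ, ∀ h, inner ℝ (u i) (vert τ h) = h i
  cov : ∀ w : En n, ∃ τ ∈ 𝓑, ∃ a : ι → ℝ, (∀ i, 0 ≤ a i) ∧ w = ∑ i ∈ τ, a i • u i

variable {n : ℕ} {ι : Type} [Fintype ι] [DecidableEq ι] (D : PolyData n ι)

/-- The polytope with support numbers `h`. -/
def PolyData.P (h : ι → ℝ) : Set (En n) := {x | ∀ i, inner ℝ (D.u i) x ≤ h i}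

/-- The open type cone. -/
def PolyData.Om : Set (ι → ℝ) :=
  {h | ∀ τ ∈ D.𝓑, ∀ i, i ∉ τ → inner ℝ (D.u i) (D.vert τ h) < h i}

variable {D}

theorem PolyData.Om_add {h k : ι → ℝ} (hh : h ∈ D.Om) (hk : k ∈ D.Om) : h + k ∈ D.Om := by
  intro τ hτ i hi
  rw [map_add, inner_add_right]
  exact add_lt_add (hh τ hτ i hi) (hk τ hτ i hi)

theorem PolyData.Om_smul {h : ι → ℝ} (hh : h ∈ D.Om) {c : ℝ} (hc : 0 < c) : c • h ∈ D.Om := by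
  intro τ hτ i hi
  rw [map_smul, inner_smul_right]
  exact mul_lt_mul_of_pos_left (hh τ hτ i hi) hc

theorem PolyData.Om_open : IsOpen D.Om := by
  have : D.Om = ⋂ τ ∈ D.𝓑, ⋂ i ∈ (Finset.univ.filter fun i => i ∉ τ),
      {h : ι → ℝ | inner ℝ (D.u i) (D.vert τ h) < h i} := by
    ext h; simp [PolyData.Om]
  rw [this]
  refine isOpen_biInter_finset fun τ _ => isOpen_biInter_finset fun i _ => ?_
  have hc : Continuous (D.vert τ) := LinearMap.continuous_of_finiteDimensional _
  exact isOpen_lt (continuous_const.inner hc) (continuous_apply i)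

theorem PolyData.Om_sum {s : Type*} [Fintype s] [Nonempty s] {h : s → ι → ℝ}
    (hh : ∀ g, h g ∈ D.Om) {x : s → ℝ} (hx : ∀ g, 0 < x g) : ∑ g, x g • h g ∈ D.Om := by
  have := Finset.sum_induction_nonempty (s := Finset.univ) (fun g => x g • h g)
    (fun k => k ∈ D.Om) (fun a b ha hb => D.Om_add ha hb) Finset.univ_nonempty
    (fun g _ => D.Om_smul (hh g) (hx g))
  exact this

theorem PolyData.vert_mem {h : ι → ℝ} (hh : h ∈ D.Om) {τ : Finset ι} (hτ : τ ∈ D.𝓑) :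
    D.vert τ h ∈ D.P h := by
  intro i
  by_cases hi : i ∈ τ
  · exact (D.vert_spec τ hτ i hi h).le
  · exact (hh τ hτ i hi).le

/-- Support function of `P h` is attained at a vertex. -/
theorem PolyData.exists_vert (w : En n) :
    ∃ τ ∈ D.𝓑, ∀ h, ∀ x ∈ D.P h, inner ℝ w x ≤ inner ℝ w (D.vert τ h) := by
  obtain ⟨τ, hτ, a, ha, rfl⟩ := D.cov w
  refine ⟨τ, hτ, fun h x hx => ?_⟩
  rw [sum_inner, sum_inner]
  refine Finset.sum_le_sum fun i hi => ?_
  rw [inner_smul_left, inner_smul_left, D.vert_spec τ hτ i hi h]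
  exact mul_le_mul_of_nonneg_left (hx i) (by simpa using ha i)

theorem PolyData.P_closed (h : ι → ℝ) : IsClosed (D.P h) := by
  have : D.P h = ⋂ i, {x | inner ℝ (D.u i) x ≤ h i} := by
    ext x; simp [PolyData.P]
  rw [this]
  exact isClosed_iInter fun i => isClosed_le (by fun_prop) continuous_const

theorem PolyData.P_convex (h : ι → ℝ) : Convex ℝ (D.P h) := by
  intro x hx y hy a b ha hb hab i
  rw [inner_add_right, inner_smul_right, inner_smul_right]
  calc a * inner ℝ (D.u i) x + b * inner ℝ (D.u i) y ≤ a * h i + b * h i :=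
        add_le_add (mul_le_mul_of_nonneg_left (hx i) ha) (mul_le_mul_of_nonneg_left (hy i) hb)
    _ = h i := by rw [← add_mul, hab, one_mul]

theorem PolyData.P_bounded (h : ι → ℝ) : Bornology.IsBounded (D.P h) := by
  -- bounded in every direction
  have hb : ∀ w : En n, ∃ M, ∀ x ∈ D.P h, inner ℝ w x ≤ M := by
    intro w
    obtain ⟨τ, _, H⟩ := D.exists_vert w
    exact ⟨_, fun x hx => H h x hx⟩
  choose M hM using hb
  rw [isBounded_iff_forall_norm_le]
  let e := EuclideanSpace.basisFun (Fin n) ℝ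
  refine ⟨∑ i, (|M (e i)| + |M (-(e i))|), fun x hx => ?_⟩
  calc ‖x‖ = ‖∑ i, inner ℝ (e i) x • e i‖ := by rw [e.sum_repr']
    _ ≤ ∑ i, ‖inner ℝ (e i) x • e i‖ := norm_sum_le _ _
    _ ≤ _ := by
      refine Finset.sum_le_sum fun i _ => ?_
      rw [norm_smul, e.norm_eq_one, mul_one, Real.norm_eq_abs, abs_le]
      have h1 := hM (e i) x hx
      have h2 := hM (-(e i)) x hx
      rw [inner_neg_left] at h2
      have := le_abs_self (M (e i))
      have := le_abs_self (M (-(e i)))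
      have := abs_nonneg (M (e i))
      have := abs_nonneg (M (-(e i)))
      constructor <;> linarith

theorem PolyData.P_compact (h : ι → ℝ) : IsCompact (D.P h) :=
  Metric.isCompact_of_isClosed_isBounded (D.P_closed h) (D.P_bounded h)

theorem PolyData.P_meas (h : ι → ℝ) : MeasurableSet (D.P h) := (D.P_closed h).measurableSet

theorem PolyData.P_fin (h : ι → ℝ) : volume (D.P h) ≠ ⊤ := (D.P_compact h).measure_lt_top.ne

/-- Not all vertices have the same height. -/
theorem PolyData.exists_lt {h : ι → ℝ} (hh : h ∈ D.Om) {z : En n} (hz : z ≠ 0) :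
    ∃ τ ∈ D.𝓑, ∃ τ' ∈ D.𝓑, inner ℝ z (D.vert τ' h) < inner ℝ z (D.vert τ h) := by
  obtain ⟨τ, hτ, a, ha, hz'⟩ := D.cov z
  obtain ⟨τ', hτ', H⟩ := D.exists_vert (-z)
  refine ⟨τ, hτ, τ', hτ', ?_⟩
  obtain ⟨ε, hε, hεm⟩ : ∃ ε : ℝ, 0 < ε ∧ D.vert τ h + (-ε) • D.vert τ 1 ∈ D.P h := by
    have hev : ∀ᶠ ε : ℝ in nhdsWithin 0 (Ioi 0), ∀ i ∈ (Finset.univ.filter fun i => i ∉ τ),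
        inner ℝ (D.u i) (D.vert τ h + (-ε) • D.vert τ 1) < h i := by
      rw [Filter.eventually_all_finset]
      intro i hi
      have hc : Continuous fun ε : ℝ => inner ℝ (D.u i) (D.vert τ h + (-ε) • D.vert τ 1) := by
        fun_prop
      have : ∀ᶠ ε in nhds (0:ℝ), inner ℝ (D.u i) (D.vert τ h + (-ε) • D.vert τ 1) < h i := by
        refine hc.continuousAt.eventually_lt continuousAt_const ?_
        simpa using hh τ hτ i (by simpa using hi)
      exact nhdsWithin_le_nhds this
    obtain ⟨ε, h1, h2⟩ := (hev.and self_mem_nhdsWithin).exists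
    refine ⟨ε, h2, fun i => ?_⟩
    by_cases hi : i ∈ τ
    · rw [inner_add_right, inner_smul_right, D.vert_spec τ hτ i hi, D.vert_spec τ hτ i hi]
      have : 0 < ε := h2
      simp; linarith
    · exact (h1 i (by simpa using hi)).le
  have h1 := H h _ hεm
  have h2 : 0 < inner ℝ z (D.vert τ 1) := by
    have : inner ℝ z (D.vert τ 1) = ∑ i ∈ τ, a i := by
      rw [hz', sum_inner]
      refine Finset.sum_congr rfl fun i hi => ?_
      rw [inner_smul_left, D.vert_spec τ hτ i hi]; simp
    rw [this]
    by_contra hcon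
    have h0 : ∑ i ∈ τ, a i = 0 := le_antisymm (not_lt.mp hcon) (Finset.sum_nonneg fun i _ => ha i)
    apply hz
    rw [hz']
    refine Finset.sum_eq_zero fun i hi => ?_
    rw [(Finset.sum_eq_zero_iff_of_nonneg fun i _ => ha i).mp h0 i hi, zero_smul]
  rw [inner_neg_left, inner_neg_left, inner_add_right, inner_smul_right] at h1
  nlinarith [mul_pos hε h2]

end PolySec

section LSE
open MeasureTheory Set
variable {n : ℕ} {T : Type*} [Fintype T] [Nonempty T] (v : T → En n)

noncomputable def lZ (y : En n) : ℝ := ∑ t, Real.exp (inner ℝ (v t) y)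
noncomputable def lw (y : En n) (t : T) : ℝ := Real.exp (inner ℝ (v t) y) / lZ v y
noncomputable def lgrad (y : En n) : En n := ∑ t, lw v y t • v t
noncomputable def lhess (y : En n) : En n →L[ℝ] En n :=
  ∑ t, lw v y t • (innerSL ℝ (v t)).smulRight (v t)
    - (innerSL ℝ (lgrad v y)).smulRight (lgrad v y)

theorem lZ_pos (y : En n) : 0 < lZ v y :=
  Finset.sum_pos (fun t _ => Real.exp_pos _) Finset.univ_nonempty

theorem lw_pos (y : En n) (t : T) : 0 < lw v y t := div_pos (Real.exp_pos _) (lZ_pos v y)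

theorem lw_sum (y : En n) : ∑ t, lw v y t = 1 := by
  unfold lw
  rw [← Finset.sum_div]; exact div_self (lZ_pos v y).ne'

theorem lZ_deriv (y : En n) : HasFDerivAt (lZ v) (lZ v y • innerSL ℝ (lgrad v y)) y := by
  have : HasFDerivAt (lZ v) (∑ t, Real.exp (inner ℝ (v t) y) • innerSL ℝ (v t)) y := by
    unfold lZ
    refine HasFDerivAt.fun_sum fun t _ => ?_
    exact (innerSL ℝ (v t)).hasFDerivAt.exp
  convert this using 1
  ext z
  simp only [smul_apply, innerSL_apply_apply, smul_eq_mul, lgrad, lw,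
    sum_inner, sum_apply, Finset.mul_sum, inner_smul_left]
  refine Finset.sum_congr rfl fun t _ => ?_
  have := (lZ_pos v y).ne'
  simp
  field_simp

theorem llog_deriv (y : En n) :
    HasFDerivAt (fun y => Real.log (lZ v y)) (innerSL ℝ (lgrad v y)) y := by
  have := (lZ_deriv v y).log (lZ_pos v y).ne'
  rwa [smul_smul, inv_mul_cancel₀ (lZ_pos v y).ne', one_smul] at this

theorem lw_deriv (y : En n) (t : T) : HasFDerivAt (fun y => lw v y t)
    (lw v y t • (innerSL ℝ (v t) - innerSL ℝ (lgrad v y))) y := by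
  have e : ∀ y, lw v y t = Real.exp (inner ℝ (v t) y - Real.log (lZ v y)) := fun y => by
    rw [Real.exp_sub, Real.exp_log (lZ_pos v y), lw]
  simp_rw [e]
  exact ((innerSL ℝ (v t)).hasFDerivAt.sub (llog_deriv v y)).exp

theorem lgrad_deriv (y : En n) : HasFDerivAt (lgrad v) (lhess v y) y := by
  have : HasFDerivAt (lgrad v) (∑ t, (lw v y t •
      (innerSL ℝ (v t) - innerSL ℝ (lgrad v y))).smulRight (v t)) y := by
    unfold lgrad
    exact HasFDerivAt.fun_sum fun t _ => (lw_deriv v y t).smul_const (v t)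
  have e : lhess v y = ∑ t, (lw v y t •
      (innerSL ℝ (v t) - innerSL ℝ (lgrad v y))).smulRight (v t) := ?_
  · rw [e]; exact this
  ext1 z
  simp only [lhess, sub_apply, sum_apply,
    smul_apply, ContinuousLinearMap.smulRight_apply, innerSL_apply_apply,
    smul_eq_mul, mul_sub, sub_smul, Finset.sum_sub_distrib]
  congr 1
  · exact Finset.sum_congr rfl fun t _ => by rw [smul_smul]
  · conv_lhs => rw [lgrad, Finset.smul_sum]
    refine Finset.sum_congr rfl fun t _ => ?_
    rw [smul_smul, mul_comm]
    rfl

theorem lhess_inner (y z : En n) : inner ℝ (lhess v y z) z =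
    ∑ t, lw v y t * (inner ℝ (v t) z - inner ℝ (lgrad v y) z) ^ 2 := by
  have e : inner ℝ (lgrad v y) z = ∑ t, lw v y t * inner ℝ (v t) z := by
    rw [lgrad, sum_inner]; simp [inner_smul_left]
  set m := inner ℝ (lgrad v y) z with hm
  have e1 : inner ℝ (lhess v y z) z = ∑ t, lw v y t * (inner ℝ (v t) z) ^ 2 - m ^ 2 := by
    simp only [lhess, sub_apply, sum_apply,
      smul_apply, ContinuousLinearMap.smulRight_apply, innerSL_apply_apply,
      inner_sub_left, sum_inner, inner_smul_left]
    simp [← hm, pow_two]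
  rw [e1]
  have e2 : ∑ t, lw v y t * (inner ℝ (v t) z - m) ^ 2 = ∑ t, lw v y t * (inner ℝ (v t) z) ^ 2
      - 2 * m * ∑ t, lw v y t * inner ℝ (v t) z + m ^ 2 * ∑ t, lw v y t := by
    rw [Finset.mul_sum, Finset.mul_sum, ← Finset.sum_sub_distrib, ← Finset.sum_add_distrib]
    exact Finset.sum_congr rfl fun t _ => by ring
  rw [e2, lw_sum, ← e]; ring

theorem lhess_symm (y z z' : En n) : inner ℝ (lhess v y z) z' = inner ℝ z (lhess v y z') := by
  simp only [lhess, sub_apply, sum_apply,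
      smul_apply, ContinuousLinearMap.smulRight_apply, innerSL_apply_apply,
      inner_sub_left, sum_inner, inner_smul_left, inner_sub_right, inner_sum, inner_smul_right]
  congr 1
  · refine Finset.sum_congr rfl fun t _ => ?_
    rw [real_inner_comm z]; simp only [conj_trivial]; ring
  · rw [real_inner_comm z]; simp; ring

theorem lw_cont (t : T) : Continuous fun y => lw v y t :=
  continuous_iff_continuousAt.mpr fun y => (lw_deriv v y t).continuousAt

theorem lgrad_cont : Continuous (lgrad v) :=
  continuous_iff_continuousAt.mpr fun y => (lgrad_deriv v y).continuousAt

theorem lhess_cont (z : En n) : Continuous fun y => lhess v y z := by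
  simp only [lhess, sub_apply, sum_apply,
      smul_apply, ContinuousLinearMap.smulRight_apply, innerSL_apply_apply]
  have := lgrad_cont v
  have := lw_cont v
  fun_prop

theorem llog_ge (y : En n) (t : T) : inner ℝ (v t) y ≤ Real.log (lZ v y) := by
  rw [Real.le_log_iff_exp_le (lZ_pos v y)]
  exact Finset.single_le_sum (f := fun t => Real.exp (inner ℝ (v t) y))
    (fun t _ => (Real.exp_pos _).le) (Finset.mem_univ t)

end LSE

end ConvexPaper

namespace ConvexPaper

section VolPoly
open MeasureTheory Set Filter Topology

variable {n : ℕ} {ι : Type} [Fintype ι] [DecidableEq ι] {D : PolyData n ι}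

theorem PolyData.B_nonempty (D : PolyData n ι) : Nonempty D.𝓑 := by
  obtain ⟨τ, hτ, -⟩ := D.cov 0
  exact ⟨⟨τ, hτ⟩⟩

variable {s : Type*} [Fintype s] [Nonempty s]

def PolyData.vv (D : PolyData n ι) (h : ι → ℝ) (τ : D.𝓑) : En n := D.vert τ h

noncomputable def PolyData.TT (D : PolyData n ι) (h : s → ι → ℝ) (x : s → ℝ) (y : En n) : En n :=
  ∑ g, x g • lgrad (D.vv (h g)) y

noncomputable def PolyData.HH (D : PolyData n ι) (h : s → ι → ℝ) (x : s → ℝ) (y : En n) :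
    En n →L[ℝ] En n :=
  ∑ g, x g • lhess (D.vv (h g)) y

theorem PolyData.TT_deriv (h : s → ι → ℝ) (x : s → ℝ) (y : En n) :
    HasFDerivAt (D.TT h x) (D.HH h x y) y := by
  haveI := D.B_nonempty
  unfold PolyData.TT PolyData.HH
  exact HasFDerivAt.fun_sum fun g _ => (lgrad_deriv _ y).const_smul (x g)

theorem PolyData.TT_mem {h : s → ι → ℝ} (hh : ∀ g, h g ∈ D.Om) {x : s → ℝ} (hx : ∀ g, 0 < x g)
    (y : En n) : D.TT h x y ∈ D.P (∑ g, x g • h g) := by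
  haveI := D.B_nonempty
  intro i
  rw [PolyData.TT, inner_sum, Finset.sum_apply]
  refine Finset.sum_le_sum fun g _ => ?_
  rw [inner_smul_right, Pi.smul_apply, smul_eq_mul]
  refine mul_le_mul_of_nonneg_left ?_ (hx g).le
  rw [lgrad, inner_sum]
  calc _ ≤ ∑ t, lw (D.vv (h g)) y t * h g i := by
        refine Finset.sum_le_sum fun t _ => ?_
        rw [inner_smul_right]
        exact mul_le_mul_of_nonneg_left (D.vert_mem (hh g) t.2 i) (lw_pos _ _ _).le
    _ = h g i := by rw [← Finset.sum_mul, lw_sum, one_mul]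

theorem PolyData.lhess_pos {h : ι → ℝ} (hh : h ∈ D.Om) (y : En n) {z : En n} (hz : z ≠ 0) :
    0 < inner ℝ (lhess (D.vv h) y z) z := by
  haveI := D.B_nonempty
  rw [lhess_inner]
  obtain ⟨τ, hτ, τ', hτ', hlt⟩ := D.exists_lt hh hz
  have hnn : ∀ t ∈ (Finset.univ : Finset D.𝓑), 0 ≤ lw (D.vv h) y t *
      (inner ℝ (D.vv h t) z - inner ℝ (lgrad (D.vv h) y) z) ^ 2 :=
    fun t _ => mul_nonneg (lw_pos _ _ _).le (sq_nonneg _)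
  refine (Finset.sum_nonneg hnn).lt_of_ne' fun h0 => ?_
  rw [Finset.sum_eq_zero_iff_of_nonneg hnn] at h0
  have key : ∀ t : D.𝓑, inner ℝ (D.vv h t) z = inner ℝ (lgrad (D.vv h) y) z := fun t => by
    have := h0 t (Finset.mem_univ t)
    rcases mul_eq_zero.1 this with h1 | h1
    · exact absurd h1 (lw_pos _ _ _).ne'
    · exact sub_eq_zero.1 (pow_eq_zero_iff two_ne_zero |>.1 h1)
  have e1 := key ⟨τ, hτ⟩
  have e2 := key ⟨τ', hτ'⟩
  simp only [PolyData.vv] at e1 e2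
  rw [real_inner_comm] at e1 e2
  linarith

theorem PolyData.HH_pos {h : s → ι → ℝ} (hh : ∀ g, h g ∈ D.Om) {x : s → ℝ} (hx : ∀ g, 0 < x g)
    (y : En n) {z : En n} (hz : z ≠ 0) : 0 < inner ℝ (D.HH h x y z) z := by
  rw [PolyData.HH, sum_apply, sum_inner]
  refine Finset.sum_pos (fun g _ => ?_) Finset.univ_nonempty
  rw [smul_apply, inner_smul_left]
  exact mul_pos (by simpa using hx g) (D.lhess_pos (hh g) y hz)

theorem PolyData.HH_symm (h : s → ι → ℝ) (x : s → ℝ) (y z z' : En n) :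
    inner ℝ (D.HH h x y z) z' = inner ℝ z (D.HH h x y z') := by
  haveI := D.B_nonempty
  rw [PolyData.HH, sum_apply, sum_inner, sum_apply, inner_sum]
  refine Finset.sum_congr rfl fun g _ => ?_
  rw [smul_apply, inner_smul_left, smul_apply, inner_smul_right, lhess_symm]
  rfl

theorem PolyData.TT_inj {h : s → ι → ℝ} (hh : ∀ g, h g ∈ D.Om) {x : s → ℝ} (hx : ∀ g, 0 < x g) :
    Function.Injective (D.TT h x) := by
  intro y y' hyy
  by_contra hne
  set z := y - y' with hzdef
  have hz : z ≠ 0 := sub_ne_zero.2 hne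
  have hder : ∀ r : ℝ, HasDerivAt (fun r : ℝ => inner ℝ (D.TT h x (y' + r • z)) z)
      (inner ℝ (D.HH h x (y' + r • z) z) z) r := fun r => by
    have h1 : HasDerivAt (fun r : ℝ => y' + r • z) z r := by
      simpa using ((hasDerivAt_id r).smul_const z).const_add y'
    have h2 := (D.TT_deriv h x (y' + r • z)).comp_hasDerivAt r h1
    simpa using h2.inner ℝ (hasDerivAt_const r z)
  have hmono : StrictMono (fun r : ℝ => inner ℝ (D.TT h x (y' + r • z)) z) :=
    strictMono_of_deriv_pos fun r => by
      rw [(hder r).deriv]; exact D.HH_pos hh hx _ hz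
  have := hmono (zero_lt_one (α := ℝ))
  simp [hzdef, hyy] at this

theorem PolyData.TT_surj {h : s → ι → ℝ} {x : s → ℝ} (hx : ∀ g, 0 < x g) :
    interior (D.P (∑ g, x g • h g)) ⊆ range (D.TT h x) := by
  haveI := D.B_nonempty
  intro p hp
  obtain ⟨r, hr, hball⟩ := Metric.nhds_basis_closedBall.mem_iff.1 (mem_interior_iff_mem_nhds.1 hp)
  let f : En n → ℝ := fun y => (∑ g, x g * Real.log (lZ (D.vv (h g)) y)) - inner ℝ p y
  have hder : ∀ y, HasFDerivAt f (innerSL ℝ (D.TT h x y - p)) y := fun y => by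
    have h1 : HasFDerivAt (fun y => ∑ g, x g * Real.log (lZ (D.vv (h g)) y))
        (∑ g, x g • innerSL ℝ (lgrad (D.vv (h g)) y)) y :=
      HasFDerivAt.fun_sum fun g _ => (llog_deriv _ y).const_mul (x g)
    have h2 := h1.sub (innerSL ℝ p).hasFDerivAt
    have e : innerSL ℝ (D.TT h x y - p)
        = ∑ g, x g • innerSL ℝ (lgrad (D.vv (h g)) y) - innerSL ℝ p := by
      rw [map_sub, PolyData.TT, map_sum]
      simp
    rw [e]; exact h2
  have hge : ∀ y, r * ‖y‖ ≤ f y := fun y => by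
    obtain ⟨τ, hτ, hmax⟩ := D.exists_vert y
    have hq : p + (r / ‖y‖) • y ∈ D.P (∑ g, x g • h g) := hball (by
      rw [Metric.mem_closedBall, dist_eq_norm, add_sub_cancel_left, norm_smul, norm_div,
        norm_norm, Real.norm_of_nonneg hr.le]
      rcases eq_or_ne ‖y‖ 0 with h0 | h0
      · simp [h0, hr.le]
      · rw [div_mul_cancel₀ _ h0])
    have h1 := hmax _ _ hq
    rw [inner_add_right, inner_smul_right, real_inner_self_eq_norm_sq] at h1
    have h2 : r / ‖y‖ * ‖y‖ ^ 2 = r * ‖y‖ := by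
      rcases eq_or_ne ‖y‖ 0 with h0 | h0
      · simp [h0]
      · field_simp
    have h3 : inner ℝ y (D.vert τ (∑ g, x g • h g)) ≤ ∑ g, x g * Real.log (lZ (D.vv (h g)) y) := by
      rw [map_sum, inner_sum]
      refine Finset.sum_le_sum fun g _ => ?_
      rw [map_smul, inner_smul_right, real_inner_comm]
      exact mul_le_mul_of_nonneg_left (llog_ge (D.vv (h g)) y ⟨τ, hτ⟩) (hx g).le
    have h4 : inner ℝ y p = inner ℝ p y := real_inner_comm _ _
    simp only [f]
    linarith
  have hcont : Continuous f := continuous_iff_continuousAt.2 fun y => (hder y).continuousAt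
  have hlim : Tendsto f (cocompact (En n)) atTop :=
    tendsto_atTop_mono hge (Tendsto.const_mul_atTop hr (tendsto_norm_cocompact_atTop))
  obtain ⟨y, hy⟩ := hcont.exists_forall_le hlim
  refine ⟨y, ?_⟩
  have h0 := IsLocalMin.hasFDerivAt_eq_zero (Filter.Eventually.of_forall hy) (hder y)
  have h1 : inner ℝ (D.TT h x y - p) (D.TT h x y - p) = 0 := by
    have := congrArg (fun φ => φ (D.TT h x y - p)) h0
    exact this
  exact sub_eq_zero.1 (inner_self_eq_zero.1 h1)

theorem PolyData.HH_det_nonneg {h : s → ι → ℝ} (hh : ∀ g, h g ∈ D.Om) {x : s → ℝ}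
    (hx : ∀ g, 0 < x g) (y : En n) : 0 ≤ (D.HH h x y).det := by
  have hpos : (D.HH h x y : En n →ₗ[ℝ] En n).IsPositive := by
    refine ⟨fun z z' => D.HH_symm h x y z z', fun z => ?_⟩
    rcases eq_or_ne z 0 with rfl | hz
    · simp
    · simpa using (D.HH_pos hh hx y hz).le
  have := (LinearMap.posSemidef_toMatrix_iff (EuclideanSpace.basisFun (Fin n) ℝ)).2 hpos
  have h2 := this.det_nonneg
  rwa [LinearMap.det_toMatrix] at h2

theorem PolyData.vol_eq {h : s → ι → ℝ} (hh : ∀ g, h g ∈ D.Om) {x : s → ℝ}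
    (hx : ∀ g, 0 < x g) :
    volume (D.P (∑ g, x g • h g)) = ∫⁻ y, ENNReal.ofReal (D.HH h x y).det := by
  have h1 := lintegral_abs_det_fderiv_eq_addHaar_image (volume : Measure (En n)) MeasurableSet.univ
    (fun y _ => (D.TT_deriv h x y).hasFDerivWithinAt) (D.TT_inj hh hx).injOn
  simp only [abs_of_nonneg (D.HH_det_nonneg hh hx _), Measure.restrict_univ, image_univ] at h1
  rw [h1]
  apply le_antisymm
  · have hfr := (D.P_convex (∑ g, x g • h g)).addHaar_frontier (volume : Measure (En n))
    calc volume (D.P (∑ g, x g • h g)) ≤ volume (interior (D.P (∑ g, x g • h g)) ∪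
          frontier (D.P (∑ g, x g • h g))) := measure_mono (by
            rw [← closure_eq_interior_union_frontier]; exact subset_closure)
      _ ≤ volume (interior (D.P (∑ g, x g • h g))) + 0 := by
          rw [← hfr]; exact measure_union_le _ _
      _ ≤ _ := by rw [add_zero]; exact measure_mono (D.TT_surj hx)
  · exact measure_mono (range_subset_iff.2 (D.TT_mem hh hx))

noncomputable def PolyData.cf (D : PolyData n ι) (h : s → ι → ℝ) (f : Fin n → s) (y : En n) : ℝ :=
  Matrix.det (Matrix.of fun i j : Fin n =>
    (lhess (D.vv (h (f i))) y (EuclideanSpace.basisFun (Fin n) ℝ j)) i)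

theorem PolyData.cf_cont (h : s → ι → ℝ) (f : Fin n → s) : Continuous (D.cf h f) := by
  haveI := D.B_nonempty
  unfold PolyData.cf
  refine Continuous.matrix_det ?_
  refine continuous_matrix fun i j => ?_
  have := lhess_cont (D.vv (h (f i))) (EuclideanSpace.basisFun (Fin n) ℝ j)
  simp only [Matrix.of_apply]
  fun_prop

theorem PolyData.HH_det (h : s → ι → ℝ) (x : s → ℝ) (y : En n) :
    (D.HH h x y).det = ∑ f : Fin n → s, (∏ i, x (f i)) * D.cf h f y := by
  classical
  have h1 : (D.HH h x y).det = Matrix.det (Matrix.of fun i j : Fin n =>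
      (D.HH h x y (EuclideanSpace.basisFun (Fin n) ℝ j)) i) := by
    rw [ContinuousLinearMap.det, ← LinearMap.det_toMatrix (EuclideanSpace.basisFun (Fin n) ℝ).toBasis]
    congr 1
    ext i j
    simp [LinearMap.toMatrix_apply]
  have h2 : (Matrix.of fun i j : Fin n =>
      (D.HH h x y (EuclideanSpace.basisFun (Fin n) ℝ j)) i) = (fun i => ∑ g, x g • 
        (fun j => (lhess (D.vv (h g)) y (EuclideanSpace.basisFun (Fin n) ℝ j)) i)) := by
    ext i j
    simp [PolyData.HH]
  rw [h1, h2]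
  change Matrix.detRowAlternating.toMultilinearMap _ = _
  rw [MultilinearMap.map_sum]
  refine Finset.sum_congr rfl fun f _ => ?_
  rw [MultilinearMap.map_smul_univ]
  rfl

theorem PolyData.vol_poly {h : s → ι → ℝ} (hh : ∀ g, h g ∈ D.Om) :
    ∃ a : (Fin n → s) → ℝ, ∀ x : s → ℝ, (∀ g, 0 < x g) →
      (volume (D.P (∑ g, x g • h g))).toReal = ∑ f, a f * ∏ i, x (f i) := by
  classical
  let X := {x : s → ℝ // ∀ g, 0 < x g}
  let φ : (Fin n → s) → (X → ℝ) := fun f x => ∏ i, x.1 (f i)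
  let W : Submodule ℝ (X → ℝ) := Submodule.span ℝ (range φ)
  let V : X → ℝ := fun x => (volume (D.P (∑ g, x.1 g • h g))).toReal
  have hV : V ∈ W := by
    haveI : FiniteDimensional ℝ W := FiniteDimensional.span_of_finite ℝ (finite_range φ)
    have hcl : IsClosed (W : Set (X → ℝ)) := W.closed_of_finiteDimensional
    let a : ℕ → (Fin n → s) → ℝ := fun R f => ∫ y in Metric.closedBall (0 : En n) R, D.cf h f y
    refine hcl.mem_of_tendsto (b := atTop) (f := fun R : ℕ => ∑ f, a R f • φ f) ?_
      (Eventually.of_forall fun R => W.sum_mem fun f _ => W.smul_mem _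
        (Submodule.subset_span (mem_range_self f)))
    rw [tendsto_pi_nhds]
    intro x
    have hdc : Continuous fun y => (D.HH h x.1 y).det := by
      simp_rw [D.HH_det]
      exact continuous_finsetSum _ fun f _ => continuous_const.mul (D.cf_cont h f)
    have hfin : ∫⁻ y, ENNReal.ofReal (D.HH h x.1 y).det ≠ ⊤ := by
      rw [← D.vol_eq hh x.2]; exact D.P_fin _
    have hintg : Integrable (fun y => (D.HH h x.1 y).det) := by
      refine ⟨hdc.aestronglyMeasurable, ?_⟩
      rw [hasFiniteIntegral_iff_ofReal (Eventually.of_forall fun y => D.HH_det_nonneg hh x.2 y)]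
      exact lt_top_iff_ne_top.2 hfin
    have hVx : V x = ∫ y, (D.HH h x.1 y).det := by
      rw [integral_eq_lintegral_of_nonneg_ae
        (Eventually.of_forall fun y => D.HH_det_nonneg hh x.2 y) hdc.aestronglyMeasurable,
        ← D.vol_eq hh x.2]
    have hl := tendsto_setIntegral_of_monotone (μ := (volume : Measure (En n)))
      (s := fun R : ℕ => Metric.closedBall (0 : En n) R)
      (f := fun y => (D.HH h x.1 y).det) (fun R => Metric.isClosed_closedBall.measurableSet)
      (fun a b hab => Metric.closedBall_subset_closedBall (by exact_mod_cast hab))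
      hintg.integrableOn
    rw [Metric.iUnion_closedBall_nat, Measure.restrict_univ, ← hVx] at hl
    refine hl.congr fun R => ?_
    simp_rw [D.HH_det]
    rw [integral_finsetSum]
    · rw [Finset.sum_apply]
      refine Finset.sum_congr rfl fun f _ => ?_
      rw [integral_const_mul, mul_comm]
      rfl
    · intro f _
      exact ((D.cf_cont h f).continuousOn.integrableOn_compact
        (isCompact_closedBall _ _)).const_mul _
  obtain ⟨a, ha⟩ := (Submodule.mem_span_range_iff_exists_fun ℝ).1 hV
  refine ⟨a, fun x hx => ?_⟩
  have := congrFun ha ⟨x, hx⟩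
  rw [Finset.sum_apply] at this
  exact this.symm

end VolPoly

end ConvexPaper

namespace ConvexPaper
section Psi
open MeasureTheory Set Filter Topology

/-- The linear form with coefficients `h`. -/
noncomputable def lf {ι : Type*} [Fintype ι] (h : ι → ℝ) : MvPolynomial ι ℝ :=
  ∑ i, MvPolynomial.C (h i) * MvPolynomial.X i

theorem lf_add {ι : Type*} [Fintype ι] (h k : ι → ℝ) : lf (h + k) = lf h + lf k := by
  simp [lf, add_mul, Finset.sum_add_distrib]

theorem lf_smul {ι : Type*} [Fintype ι] (c : ℝ) (h : ι → ℝ) :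
    lf (c • h) = MvPolynomial.C c * lf h := by
  simp [lf, Finset.mul_sum, mul_assoc]

theorem lf_smul' {ι : Type*} [Fintype ι] (c : ℝ) (h : ι → ℝ) :
    lf (c • h) = c • lf h := by
  rw [lf_smul, MvPolynomial.smul_eq_C_mul]

theorem lf_single {ι : Type*} [Fintype ι] [DecidableEq ι] (i : ι) :
    lf (Pi.single i (1 : ℝ)) = MvPolynomial.X i := by
  rw [lf, Finset.sum_eq_single i]
  · simp
  · intro j _ hj; simp [hj]
  · simp

/-- Linear version of `lf`. -/
noncomputable def lfL (ι : Type*) [Fintype ι] : (ι → ℝ) →ₗ[ℝ] MvPolynomial ι ℝ where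
  toFun := lf
  map_add' := lf_add
  map_smul' := lf_smul'

theorem lf_sum {ι : Type*} [Fintype ι] {T : Type*} (A : Finset T) (h : T → ι → ℝ) :
    lf (∑ t ∈ A, h t) = ∑ t ∈ A, lf (h t) := map_sum (lfL ι) h A

theorem psi_exists {ι : Type*} [Fintype ι] [DecidableEq ι] {s : Type*}
    (x : s → (ι → ℝ) →ₗ[ℝ] ℝ) : ∀ (n : ℕ) (f : Fin n → s),
    ∃ ψ : MvPolynomial ι ℝ →ₗ[ℝ] MvPolynomial ι ℝ, ∀ h (k : ℕ),
      ψ (lf h ^ (k + n)) =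
        MvPolynomial.C (((k + n).factorial : ℝ) / k.factorial * ∏ i, x (f i) h) * lf h ^ k := by
  intro n
  induction n with
  | zero => 
    intro f
    refine ⟨LinearMap.id, fun h k => ?_⟩
    have : (k.factorial : ℝ) ≠ 0 := by positivity
    simp [div_self this]
  | succ n ih =>
    intro f
    obtain ⟨ψ, hψ⟩ := ih (fun i => f i.succ)
    let Dv : Derivation ℝ (MvPolynomial ι ℝ) (MvPolynomial ι ℝ) :=
      MvPolynomial.mkDerivation ℝ fun i => MvPolynomial.C (x (f 0) (Pi.single i 1))
    have hD : ∀ h, Dv (lf h) = MvPolynomial.C (x (f 0) h) := fun h => by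
      have e : h = ∑ i, h i • Pi.single i (1 : ℝ) := by
        ext j; simp [Finset.sum_apply, Pi.single_apply]
      conv_rhs => rw [e]
      rw [lf, map_sum, map_sum, map_sum]
      refine Finset.sum_congr rfl fun i _ => ?_
      simp [Dv, Derivation.leibniz, MvPolynomial.mkDerivation_X]
    refine ⟨(Dv : MvPolynomial ι ℝ →ₗ[ℝ] MvPolynomial ι ℝ) ∘ₗ ψ, fun h k => ?_⟩
    have e : k + (n + 1) = (k + 1) + n := by ring
    rw [e, LinearMap.comp_apply, hψ, ← MvPolynomial.smul_eq_C_mul]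
    rw [map_smul]
    change _ • Dv (lf h ^ (k + 1)) = _
    rw [Derivation.leibniz_pow, hD, Nat.add_sub_cancel, Fin.prod_univ_succ, Nat.factorial_succ k]
    simp only [smul_eq_mul, nsmul_eq_mul, MvPolynomial.smul_eq_C_mul]
    have h2 : (k.factorial : ℝ) ≠ 0 := by positivity
    have h3 : (k + 1 : ℝ) ≠ 0 := by positivity
    have e3 : ((k + 1 : ℕ) : MvPolynomial ι ℝ) = MvPolynomial.C ((k + 1 : ℕ) : ℝ) := by simp
    rw [e3, mul_comm (lf h ^ k), ← mul_assoc, ← mul_assoc, ← MvPolynomial.C_mul,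
      ← MvPolynomial.C_mul]
    congr 2
    push_cast
    field_simp

theorem psi_exists' {ι : Type*} [Fintype ι] [DecidableEq ι] {s : Type*} [Fintype s]
    (x : s → (ι → ℝ) →ₗ[ℝ] ℝ) (n : ℕ) (a : (Fin n → s) → ℝ) :
    ∃ ψ : MvPolynomial ι ℝ →ₗ[ℝ] ℝ, ∀ h,
      ψ (lf h ^ n) = n.factorial * ∑ f, a f * ∏ i, x (f i) h := by
  choose Ψ hΨ using psi_exists x n
  refine ⟨∑ f, a f • (MvPolynomial.lcoeff ℝ (0 : ι →₀ ℕ)) ∘ₗ Ψ f, fun h => ?_⟩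
  rw [LinearMap.sum_apply, Finset.mul_sum]
  refine Finset.sum_congr rfl fun f _ => ?_
  have := hΨ f h 0
  rw [zero_add] at this
  rw [LinearMap.smul_apply, LinearMap.comp_apply, this]
  rw [pow_zero, mul_one]
  change a f * MvPolynomial.coeff 0 (MvPolynomial.C _) = _
  rw [MvPolynomial.coeff_zero_C]
  simp
  ring

variable {n : ℕ} {ι : Type} [Fintype ι] [DecidableEq ι] {D : PolyData n ι}

theorem PolyData.exists_basis [Nonempty ι] (hne : D.Om.Nonempty) :
    ∃ (b : ι → ι → ℝ) (x : ι → (ι → ℝ) →ₗ[ℝ] ℝ), (∀ g, b g ∈ D.Om) ∧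
      (∀ h, ∑ g, x g h • b g = h) ∧ ∃ h0 ∈ D.Om, ∀ g, x g h0 = 1 := by
  obtain ⟨c, hc⟩ := hne
  have hev : ∀ᶠ δ in 𝓝[>] (0 : ℝ), ∀ i, c + δ • Pi.single i (1 : ℝ) ∈ D.Om := by
    rw [eventually_all]
    intro i
    refine nhdsWithin_le_nhds ?_
    have hcont : Continuous fun δ : ℝ => c + δ • (Pi.single i (1 : ℝ) : ι → ℝ) := by fun_prop
    exact (hcont.tendsto 0).eventually (by simpa using D.Om_open.mem_nhds hc)
  have hev2 : ∀ᶠ δ in 𝓝[>] (0 : ℝ), δ + ∑ i, c i ≠ 0 := by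
    rcases eq_or_ne (∑ i, c i) 0 with h0 | h0
    · filter_upwards [self_mem_nhdsWithin] with δ hδ
      rw [h0, add_zero]; exact (ne_of_gt hδ)
    · refine nhdsWithin_le_nhds ?_
      have hcont : Continuous fun δ : ℝ => δ + ∑ i, c i := by fun_prop
      exact (hcont.tendsto 0).eventually_ne (by simpa using h0)
  obtain ⟨δ, ⟨hb, hS⟩, hδ⟩ := ((hev.and hev2).and self_mem_nhdsWithin).exists
  have hδ0 : δ ≠ 0 := ne_of_gt hδ
  set w := δ + ∑ i, c i with hw
  let x : ι → (ι → ℝ) →ₗ[ℝ] ℝ := fun i =>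
    δ⁻¹ • (LinearMap.proj i - (c i * w⁻¹) • ∑ j, LinearMap.proj j)
  have hx : ∀ i h, x i h = δ⁻¹ * (h i - c i * w⁻¹ * ∑ j, h j) := fun i h => by
    simp [x, LinearMap.sum_apply]
  have hxs : ∀ h, ∑ g, x g h = w⁻¹ * ∑ j, h j := fun h => by
    simp_rw [hx]
    rw [← Finset.mul_sum, Finset.sum_sub_distrib, ← Finset.sum_mul, ← Finset.sum_mul]
    have : ∑ i, c i = w - δ := by rw [hw]; ring
    rw [this]; field_simp; ring
  refine ⟨fun i => c + δ • Pi.single i 1, x, hb, fun h => ?_, ?_⟩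
  · ext j
    have e1 : (∑ g, x g h • (c + δ • Pi.single g (1 : ℝ)) : ι → ℝ) j
        = (∑ g, x g h) * c j + δ * x j h := by
      simp [Finset.sum_apply, mul_add, Finset.sum_add_distrib, Finset.sum_mul, Pi.single_apply]
      ring
    rw [e1, hxs, hx]
    field_simp; ring
  · have hb' := D.Om_sum (x := fun _ => (1 : ℝ)) hb (fun _ => one_pos)
    refine ⟨_, hb', fun g => ?_⟩
    have e1 : (∑ i, (1 : ℝ) • (c + δ • Pi.single i (1 : ℝ)) : ι → ℝ)
        = fun j => Fintype.card ι * c j + δ := by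
      ext j
      simp [Finset.sum_add_distrib, Finset.sum_apply, Pi.single_apply]
    rw [e1, hx]
    have e2 : ∑ j, (Fintype.card ι * c j + δ) = Fintype.card ι * w := by
      rw [Finset.sum_add_distrib, ← Finset.mul_sum]; simp [hw]; ring
    rw [e2]; field_simp; ring

theorem PolyData.exists_psi [Nonempty ι] (hne : D.Om.Nonempty) :
    ∃ ψ : MvPolynomial ι ℝ →ₗ[ℝ] ℝ, ∀ h ∈ D.Om,
      ψ (lf h ^ n) = n.factorial * (volume (D.P h)).toReal := by
  obtain ⟨b, x, hb, hbx, h0, hh0, hx0⟩ := D.exists_basis hne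
  obtain ⟨a, ha⟩ := D.vol_poly hb
  obtain ⟨ψ, hψ⟩ := psi_exists' x n a
  refine ⟨ψ, fun h hh => ?_⟩
  rw [hψ]
  congr 1
  have hev : ∀ᶠ ε in 𝓝[>] (0 : ℝ), h - ε • h0 ∈ D.Om := by
    refine nhdsWithin_le_nhds ?_
    have hcont : Continuous fun ε : ℝ => h - ε • h0 := by fun_prop
    exact (hcont.tendsto 0).eventually (by simpa using D.Om_open.mem_nhds hh)
  obtain ⟨ε, hε, hε0⟩ := (hev.and self_mem_nhdsWithin).exists
  set h' := h - ε • h0 with hh'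
  obtain ⟨a2, ha2⟩ := D.vol_poly (s := Bool) (h := fun b => bif b then h' else h0)
    (fun b => by cases b <;> simp [hh0, hε])
  let q : Polynomial ℝ := ∑ f : Fin n → Bool,
    Polynomial.C (a2 f) * ∏ i, (bif f i then Polynomial.X else Polynomial.C ε)
  let r : Polynomial ℝ := ∑ f : Fin n → ι,
    Polynomial.C (a f) * ∏ i, (Polynomial.C ε + Polynomial.C (x (f i) h') * Polynomial.X)
  have hq : ∀ t : ℝ, 0 < t → (volume (D.P (ε • h0 + t • h'))).toReal = q.eval t := fun t ht => by
    have := ha2 (fun b => bif b then t else ε) (fun b => by cases b <;> simp [ht, hε0])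
    simp only [Fintype.sum_bool, cond_true, cond_false] at this
    rw [add_comm, this, Polynomial.eval_finsetSum]
    refine Finset.sum_congr rfl fun f _ => ?_
    rw [Polynomial.eval_mul, Polynomial.eval_C, Polynomial.eval_prod]
    congr 1
    refine Finset.prod_congr rfl fun i _ => ?_
    cases f i <;> simp
  have hr0 : ∀ t : ℝ, r.eval t = ∑ f, a f * ∏ i, x (f i) (ε • h0 + t • h') := fun t => by
    rw [Polynomial.eval_finsetSum]
    refine Finset.sum_congr rfl fun f _ => ?_
    rw [Polynomial.eval_mul, Polynomial.eval_C, Polynomial.eval_prod]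
    congr 1
    refine Finset.prod_congr rfl fun i _ => ?_
    rw [map_add, map_smul, map_smul, hx0]
    simp
    ring
  have hev2 : ∀ᶠ t in 𝓝[>] (0 : ℝ), q.eval t = r.eval t := by
    have : ∀ᶠ t in 𝓝[>] (0 : ℝ), ∀ g, 0 < x g (ε • h0 + t • h') := by
      rw [eventually_all]
      intro g
      refine nhdsWithin_le_nhds ?_
      simp only [map_add, map_smul, hx0, smul_eq_mul, mul_one]
      have hcont : Continuous fun t : ℝ => ε + t * x g h' := by fun_prop
      exact (hcont.tendsto 0).eventually (lt_mem_nhds (by simpa using hε0))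
    filter_upwards [this, self_mem_nhdsWithin] with t ht ht0
    rw [← hq t ht0, hr0]
    rw [← ha _ ht, hbx]
  have hqr : q = r := by
    refine Polynomial.eq_of_infinite_eval_eq q r ?_
    obtain ⟨δ, hδ, hsub⟩ := mem_nhdsGT_iff_exists_Ioo_subset.1 hev2
    exact (Ioo_infinite hδ).mono hsub
  have h1 := hq 1 one_pos
  rw [hqr, hr0] at h1
  have e : ε • h0 + (1 : ℝ) • h' = h := by rw [hh']; simp
  rw [e] at h1
  exact h1.symm

end Psi
end ConvexPaper

namespace ConvexPaper
section Bin
open Filter Topology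
variable {𝔸 : Type*} [CommRing 𝔸] [Algebra ℝ 𝔸]

theorem bin_pol {κ : Type*} [DecidableEq κ] (ψ : 𝔸 →ₗ[ℝ] ℝ) (H : 𝔸) (b : κ → 𝔸) (σ : Finset κ)
    (N : ℕ) (t : ℝ) :
    ∑ τ ∈ σ.powerset, (-1 : ℝ) ^ τ.card * ψ ((H + t • ∑ j ∈ τ, b j) ^ N) =
      ∑ i ∈ Finset.range (N + 1), t ^ i * (N.choose i *
        ψ (H ^ (N - i) * ∑ τ ∈ σ.powerset, (-1 : 𝔸) ^ τ.card * (∑ j ∈ τ, b j) ^ i)) := by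
  have h1 : ∀ τ ∈ σ.powerset, (-1 : ℝ) ^ τ.card * ψ ((H + t • ∑ j ∈ τ, b j) ^ N) =
      ∑ i ∈ Finset.range (N + 1), t ^ i * (N.choose i *
        ψ (H ^ (N - i) * ((-1 : 𝔸) ^ τ.card * (∑ j ∈ τ, b j) ^ i))) := fun τ _ => by
    rw [add_comm H, add_pow, map_sum, Finset.mul_sum]
    refine Finset.sum_congr rfl fun i _ => ?_
    have e : (t • ∑ j ∈ τ, b j) ^ i * H ^ (N - i) * (N.choose i : 𝔸)
        = (t ^ i * N.choose i) • (H ^ (N - i) * (∑ j ∈ τ, b j) ^ i) := by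
      rw [smul_pow, mul_smul]
      have : (N.choose i : ℝ) • (H ^ (N - i) * (∑ j ∈ τ, b j) ^ i)
         = (N.choose i : 𝔸) * (H ^ (N - i) * (∑ j ∈ τ, b j) ^ i) := by
        rw [Algebra.smul_def]; simp
      rw [this, smul_mul_assoc, smul_mul_assoc]
      congr 1; ring
    rw [e, map_smul, smul_eq_mul]
    have e2 : H ^ (N - i) * ((-1 : 𝔸) ^ τ.card * (∑ j ∈ τ, b j) ^ i)
        = ((-1 : ℝ) ^ τ.card) • (H ^ (N - i) * (∑ j ∈ τ, b j) ^ i) := by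
      rw [Algebra.smul_def]; simp; ring
    rw [e2, map_smul, smul_eq_mul]; ring
  rw [Finset.sum_congr rfl h1, Finset.sum_comm]
  refine Finset.sum_congr rfl fun i _ => ?_
  rw [← Finset.mul_sum, ← Finset.mul_sum, ← map_sum, Finset.mul_sum]

/-- Leading term of the alternating sum. -/
theorem bin_tendsto {κ : Type*} [DecidableEq κ] (ψ : 𝔸 →ₗ[ℝ] ℝ) (H : 𝔸) (b : κ → 𝔸)
    (σ : Finset κ) {N : ℕ} (hN : σ.card ≤ N) :
    Tendsto (fun t : ℝ => (∑ τ ∈ σ.powerset, (-1 : ℝ) ^ τ.card * ψ ((H + t • ∑ j ∈ τ, b j) ^ N))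
        / t ^ σ.card) (𝓝[≠] 0)
      (𝓝 ((-1) ^ σ.card * (N.factorial / (N - σ.card).factorial) *
        ψ ((∏ j ∈ σ, b j) * H ^ (N - σ.card)))) := by
  set k := σ.card with hk
  let c : ℕ → ℝ := fun i => N.choose i *
        ψ (H ^ (N - i) * ∑ τ ∈ σ.powerset, (-1 : 𝔸) ^ τ.card * (∑ j ∈ τ, b j) ^ i)
  have hc0 : ∀ i < k, c i = 0 := fun i hi => by
    simp only [c]; rw [(POL σ b).1 i hi]; simp
  have hck : c k = (-1) ^ k * (N.factorial / (N - k).factorial) *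
        ψ ((∏ j ∈ σ, b j) * H ^ (N - k)) := by
    simp only [c]; rw [hk, (POL σ b).2, ← hk]
    have e : H ^ (N - k) * ((-1) ^ k * (k.factorial : 𝔸) * ∏ j ∈ σ, b j)
        = ((-1 : ℝ) ^ k * k.factorial) • ((∏ j ∈ σ, b j) * H ^ (N - k)) := by
      rw [Algebra.smul_def]; simp; ring
    rw [e, map_smul, smul_eq_mul, Nat.cast_choose ℝ hN]
    have : (k.factorial : ℝ) ≠ 0 := by positivity
    field_simp
  have hcont : Tendsto (fun t : ℝ => ∑ i ∈ Finset.range (N - k + 1), t ^ i * c (k + i)) (𝓝[≠] 0)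
      (𝓝 (∑ i ∈ Finset.range (N - k + 1), 0 ^ i * c (k + i))) := by
    refine tendsto_nhdsWithin_of_tendsto_nhds ?_
    have : Continuous (fun t : ℝ => ∑ i ∈ Finset.range (N - k + 1), t ^ i * c (k + i)) := by fun_prop
    exact this.tendsto 0
  have e0 : ∑ i ∈ Finset.range (N - k + 1), (0 : ℝ) ^ i * c (k + i) = c k := by
    rw [Finset.sum_range_succ']; simp
  rw [e0, hck] at hcont
  refine hcont.congr' ?_
  filter_upwards [self_mem_nhdsWithin] with t ht
  have ht : t ≠ 0 := ht
  rw [bin_pol, eq_div_iff (pow_ne_zero _ ht)]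
  have e1 : N + 1 = k + (N - k + 1) := by omega
  rw [e1, Finset.sum_range_add _ k, Finset.sum_eq_zero (s := Finset.range k), zero_add, Finset.sum_mul]
  · refine Finset.sum_congr rfl fun i _ => ?_
    simp only [c]; rw [pow_add]; ring
  · intro i hi
    have := hc0 i (Finset.mem_range.1 hi)
    simp only [c] at this
    rw [this, mul_zero]

end Bin

section Facts
open MeasureTheory Set Filter Topology
variable {n : ℕ} {ι : Type} [Fintype ι] [DecidableEq ι] {D : PolyData n ι}

/-- Indicator vector of a finset. -/
def ind (τ : Finset ι) : ι → ℝ := fun i => if i ∈ τ then 1 else 0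

theorem lf_ind (τ : Finset ι) : lf (ind τ) = ∑ j ∈ τ, MvPolynomial.X j := by
  simp [lf, ind, Finset.sum_ite_mem]

/-- Slab near the faces in `σ`. -/
def PolyData.slab (D : PolyData n ι) (h : ι → ℝ) (σ : Finset ι) (ε : ℝ) : Set (En n) :=
  {x | x ∈ D.P h ∧ ∀ j ∈ σ, h j - ε < inner ℝ (D.u j) x}

theorem PolyData.slab_meas (h : ι → ℝ) (σ : Finset ι) (ε : ℝ) : MeasurableSet (D.slab h σ ε) := by
  have : D.slab h σ ε = D.P h ∩ ⋂ j ∈ σ, {x | h j - ε < inner ℝ (D.u j) x} := by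
    ext x; simp [PolyData.slab]
  rw [this]
  refine (D.P_meas h).inter (Finset.measurableSet_biInter _ fun j _ => ?_)
  exact (isOpen_lt continuous_const (by fun_prop)).measurableSet

theorem PolyData.slab_fin (h : ι → ℝ) (σ : Finset ι) (ε : ℝ) : volume (D.slab h σ ε) ≠ ⊤ :=
  measure_ne_top_of_subset (fun _ hx => hx.1) (D.P_fin h)

theorem PolyData.slab_vol (σ : Finset ι) {ε : ℝ} (hε : 0 < ε) : ∀ h : ι → ℝ,
    (volume (D.slab h σ ε)).toReal = ∑ τ ∈ σ.powerset, (-1 : ℝ) ^ τ.card *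
      (volume (D.P (h - ε • ind τ))).toReal := by
  induction σ using Finset.induction_on with
  | empty =>
    intro h
    have : (h - ε • ind (∅ : Finset ι)) = h := by ext i; simp [ind]
    simp [PolyData.slab, this]
  | @insert j σ hj ih =>
    intro h
    have hsub : D.slab (h - ε • ind {j}) σ ε ⊆ D.slab h σ ε := by
      rintro x ⟨h1, h2⟩
      refine ⟨fun i => (h1 i).trans ?_, fun i hi => ?_⟩
      · simp only [Pi.sub_apply, Pi.smul_apply, ind, smul_eq_mul]; split_ifs <;> linarith
      · have := h2 i hi
        have hij : i ≠ j := fun e => hj (e ▸ hi)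
        simpa [ind, hij] using this
    have heq : D.slab h (insert j σ) ε = D.slab h σ ε \ D.slab (h - ε • ind {j}) σ ε := by
      ext x
      constructor
      · rintro ⟨h1, h2⟩
        refine ⟨⟨h1, fun i hi => h2 i (Finset.mem_insert_of_mem hi)⟩, fun h3 => ?_⟩
        have h4 := h3.1 j
        have h5 := h2 j (Finset.mem_insert_self _ _)
        simp [ind] at h4
        linarith
      · rintro ⟨⟨h1, h2⟩, h3⟩
        refine ⟨h1, fun i hi => ?_⟩
        rcases Finset.mem_insert.1 hi with rfl | hi
        · by_contra hcon
          push Not at hcon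
          refine h3 ⟨fun l => ?_, fun l hl => ?_⟩
          · by_cases hl : l = i
            · subst hl; simpa [ind] using hcon
            · simpa [ind, hl] using h1 l
          · have hli : l ≠ i := fun e => hj (e ▸ hl)
            simpa [ind, hli] using h2 l hl
        · exact h2 i hi
    rw [heq, measure_sdiff hsub (D.slab_meas _ _ _).nullMeasurableSet (D.slab_fin _ _ _),
      ENNReal.toReal_sub_of_le (measure_mono hsub) (D.slab_fin _ _ _), ih, ih,
      Finset.sum_powerset_insert hj, sub_eq_add_neg, ← Finset.sum_neg_distrib]
    congr 1
    refine Finset.sum_congr rfl fun τ hτ => ?_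
    have hjτ : j ∉ τ := fun hh => hj (Finset.mem_powerset.1 hτ hh)
    rw [Finset.card_insert_of_notMem hjτ, pow_succ]
    have : h - ε • ind {j} - ε • ind τ = h - ε • ind (insert j τ) := by
      ext i
      simp only [Pi.sub_apply, Pi.smul_apply, ind, smul_eq_mul, Finset.mem_singleton,
        Finset.mem_insert]
      by_cases hij : i = j
      · subst hij; simp [hjτ]
      · simp [hij]
    rw [this]; ring

theorem PolyData.slab_tendsto {ψ : MvPolynomial ι ℝ →ₗ[ℝ] ℝ} (hψ : ∀ h ∈ D.Om,
      ψ (lf h ^ n) = n.factorial * (volume (D.P h)).toReal) {h : ι → ℝ} (hh : h ∈ D.Om)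
    {σ : Finset ι} (hσ : σ.card ≤ n) :
    Tendsto (fun ε : ℝ => (volume (D.slab h σ ε)).toReal / ε ^ σ.card) (𝓝[>] 0)
      (𝓝 (ψ ((∏ j ∈ σ, MvPolynomial.X j) * lf h ^ (n - σ.card)) / (n - σ.card).factorial)) := by
  have h1 := bin_tendsto ψ (lf h) (fun j => MvPolynomial.X j) σ hσ
  have hneg : Tendsto (fun ε : ℝ => -ε) (𝓝[>] 0) (𝓝[≠] 0) := by
    refine tendsto_nhdsWithin_iff.2 ⟨?_, ?_⟩
    · exact tendsto_nhdsWithin_of_tendsto_nhds (by simpa using (continuous_neg.tendsto (0 : ℝ)))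
    · filter_upwards [self_mem_nhdsWithin] with ε hε
      exact neg_ne_zero.2 (ne_of_gt hε)
  have h2 := (h1.comp hneg).const_mul ((-1) ^ σ.card / (n.factorial : ℝ))
  have hOm : ∀ᶠ ε in 𝓝[>] (0 : ℝ), ∀ τ ∈ σ.powerset, h - ε • ind τ ∈ D.Om := by
    rw [Finset.eventually_all]
    intro τ _
    refine nhdsWithin_le_nhds ?_
    have hcont : Continuous fun ε : ℝ => h - ε • ind τ := by fun_prop
    exact (hcont.tendsto 0).eventually (by simpa using D.Om_open.mem_nhds hh)
  have hnf : (n.factorial : ℝ) ≠ 0 := by positivity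
  have hm1 : ((-1 : ℝ) ^ σ.card) * (-1) ^ σ.card = 1 := by rw [← mul_pow]; simp
  have e : (-1) ^ σ.card / (n.factorial : ℝ) * ((-1) ^ σ.card *
      (n.factorial / (n - σ.card).factorial) *
      ψ ((∏ j ∈ σ, MvPolynomial.X j) * lf h ^ (n - σ.card))) =
      ψ ((∏ j ∈ σ, MvPolynomial.X j) * lf h ^ (n - σ.card)) / (n - σ.card).factorial := by
    have : ((n - σ.card).factorial : ℝ) ≠ 0 := by positivity
    field_simp
    linear_combination (ψ ((∏ j ∈ σ, MvPolynomial.X j) * lf h ^ (n - σ.card))) * hm1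
  rw [e] at h2
  refine h2.congr' ?_
  filter_upwards [hOm, self_mem_nhdsWithin] with ε hε hε0
  have hε0 : 0 < ε := hε0
  rw [D.slab_vol σ hε0]
  have e2 : ∀ τ ∈ σ.powerset, (-1 : ℝ) ^ τ.card * (volume (D.P (h - ε • ind τ))).toReal =
      (n.factorial : ℝ)⁻¹ * ((-1 : ℝ) ^ τ.card *
        ψ ((lf h + (-ε) • ∑ j ∈ τ, MvPolynomial.X j) ^ n)) := fun τ hτ => by
    have : lf h + (-ε) • ∑ j ∈ τ, MvPolynomial.X j = lf (h - ε • ind τ) := by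
      rw [sub_eq_add_neg, ← neg_smul, lf_add, lf_smul', lf_ind]
    rw [this, hψ _ (hε τ hτ)]
    field_simp
  rw [Finset.sum_congr rfl e2, ← Finset.mul_sum, Function.comp_apply, neg_pow ε σ.card]
  have := pow_ne_zero σ.card hε0.ne'
  field_simp

end Facts
end ConvexPaper

namespace ConvexPaper
section Facts2
open MeasureTheory Set Filter Topology
open scoped Pointwise
variable {n : ℕ} {ι : Type} [Fintype ι] [DecidableEq ι] {D : PolyData n ι}

theorem lf_hom (h : ι → ℝ) : (lf h).IsHomogeneous 1 := by
  refine MvPolynomial.IsHomogeneous.sum _ _ _ fun i _ => ?_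
  simpa using (MvPolynomial.isHomogeneous_C ι (h i)).mul (MvPolynomial.isHomogeneous_X ℝ i)

theorem xprod_hom (σ : Finset ι) :
    (∏ j ∈ σ, MvPolynomial.X j : MvPolynomial ι ℝ).IsHomogeneous σ.card := by
  have := MvPolynomial.IsHomogeneous.prod σ (fun j => (MvPolynomial.X j : MvPolynomial ι ℝ))
    (fun _ => 1) (fun j _ => MvPolynomial.isHomogeneous_X ℝ j)
  simpa using this

theorem PolyData.polarize {φ : MvPolynomial ι ℝ →ₗ[ℝ] ℝ} {m : ℕ} (hne : D.Om.Nonempty)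
    (H : ∀ h ∈ D.Om, φ (lf h ^ m) = 0) {a : MvPolynomial ι ℝ} (ha : a.IsHomogeneous m) :
    φ a = 0 := by
  obtain ⟨h, hh⟩ := hne
  have key : ∀ b : Fin m → ι → ℝ, φ (∏ j, lf (b j)) = 0 := fun b => by
    have h1 := bin_tendsto φ (lf h) (fun j => lf (b j)) Finset.univ (N := m) (by simp)
    have hz : ∀ᶠ t in 𝓝[≠] (0 : ℝ), ∀ τ ∈ (Finset.univ : Finset (Fin m)).powerset,
        h + t • ∑ j ∈ τ, b j ∈ D.Om := by
      rw [Finset.eventually_all]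
      intro τ _
      refine nhdsWithin_le_nhds ?_
      have hcont : Continuous fun t : ℝ => h + t • ∑ j ∈ τ, b j := by fun_prop
      exact (hcont.tendsto 0).eventually (by simpa using D.Om_open.mem_nhds hh)
    have h2 := tendsto_nhds_unique_of_eventuallyEq h1 (tendsto_const_nhds (x := (0 : ℝ))) (by
      filter_upwards [hz] with t ht
      rw [Finset.sum_eq_zero, zero_div]
      intro τ hτ
      rw [← lf_sum, ← lf_smul', ← lf_add, H _ (ht τ hτ), mul_zero])
    have hm : (m.factorial : ℝ) ≠ 0 := by positivity
    simpa [hm] using h2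
  have hmon : ∀ d : ι →₀ ℕ, d.degree = m → φ (MvPolynomial.monomial d 1) = 0 := fun d hd => by
    have e : ∃ f : Fin m → ι, MvPolynomial.monomial d (1 : ℝ) = ∏ j, MvPolynomial.X (f j) := by
      have hc : (Finsupp.toMultiset d).toList.length = m := by
        rw [Multiset.length_toList, Finsupp.card_toMultiset, ← hd, Finsupp.degree_eq_sum,
          Finsupp.sum_fintype _ _ (fun _ => rfl)]
        rfl
      refine ⟨fun j => (Finsupp.toMultiset d).toList.get (Fin.cast hc.symm j), ?_⟩
      have h3 : ∏ j : Fin m, (MvPolynomial.X ((Finsupp.toMultiset d).toList.get (Fin.cast hc.symm j))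
          : MvPolynomial ι ℝ) = ((Finsupp.toMultiset d).toList.map MvPolynomial.X).prod := by
        rw [← Fin.prod_univ_fun_getElem]
        exact Fintype.prod_equiv (finCongr hc.symm) _ _ (fun j => by simp)
      rw [h3, ← Multiset.prod_coe, ← Multiset.map_coe, Multiset.coe_toList, Finsupp.toMultiset_map]
      rw [MvPolynomial.monomial_eq, Finsupp.prod_toMultiset, Finsupp.prod_mapDomain_index
        (fun _ => pow_zero _) (fun _ _ _ => pow_add _ _ _)]
      simp
    obtain ⟨f, hf⟩ := e
    rw [hf]
    have := key (fun j => Pi.single (f j) 1)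
    simpa only [lf_single] using this
  rw [a.as_sum, map_sum]
  refine Finset.sum_eq_zero fun d hd => ?_
  have hd' : d.degree = m := by
    have := ha (MvPolynomial.mem_support_iff.1 hd)
    rw [Finsupp.degree_eq_weight_one]; exact this
  have e : MvPolynomial.monomial d (a.coeff d) = a.coeff d • MvPolynomial.monomial d (1 : ℝ) := by
    rw [MvPolynomial.smul_monomial, smul_eq_mul, mul_one]
  rw [e, map_smul, hmon d hd', smul_zero]

theorem PolyData.active {h : ι → ℝ} (hh : h ∈ D.Om) {x : En n} (hx : x ∈ D.P h) {σ : Finset ι}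
    (hσ : ∀ i ∈ σ, inner ℝ (D.u i) x = h i) : ∃ τ ∈ D.𝓑, σ ⊆ τ := by
  obtain ⟨τ, hτ, hv⟩ := D.exists_vert (∑ i ∈ σ, D.u i)
  refine ⟨τ, hτ, fun i hi => ?_⟩
  by_contra hiτ
  have h1 := hv h x hx
  rw [sum_inner, sum_inner, Finset.sum_congr rfl hσ] at h1
  have h2 : ∑ i ∈ σ, inner ℝ (D.u i) (D.vert τ h) < ∑ i ∈ σ, h i :=
    Finset.sum_lt_sum (fun j _ => D.vert_mem hh hτ j) ⟨i, hi, hh τ hτ i hiτ⟩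
  linarith

variable {ψ : MvPolynomial ι ℝ →ₗ[ℝ] ℝ}

theorem PolyData.E2 (hne : D.Om.Nonempty) (hψ : ∀ h ∈ D.Om,
      ψ (lf h ^ n) = n.factorial * (volume (D.P h)).toReal)
    {σ : Finset ι} (hσ : ¬ ∃ τ ∈ D.𝓑, σ ⊆ τ) {a : MvPolynomial ι ℝ} {m : ℕ}
    (ha : a.IsHomogeneous m) (hm : σ.card + m = n) :
    ψ ((∏ j ∈ σ, MvPolynomial.X j) * a) = 0 := by
  refine D.polarize (φ := ψ ∘ₗ LinearMap.mulLeft ℝ (∏ j ∈ σ, MvPolynomial.X j)) hne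
    (fun h hh => ?_) ha
  have hlim := D.slab_tendsto hψ hh (σ := σ) (by omega)
  obtain ⟨τ0⟩ := D.B_nonempty
  obtain ⟨x0, hx0, hmin⟩ := (D.P_compact h).exists_isMinOn ⟨_, D.vert_mem hh τ0.2⟩
    (f := fun x => ∑ j ∈ σ, (h j - inner ℝ (D.u j) x)) (by fun_prop)
  have hpos : 0 < ∑ j ∈ σ, (h j - inner ℝ (D.u j) x0) := by
    have hnn : ∀ j ∈ σ, 0 ≤ h j - inner ℝ (D.u j) x0 := fun j _ => sub_nonneg.2 (hx0 j)
    refine (Finset.sum_nonneg hnn).lt_of_ne' fun h0 => hσ ?_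
    rw [Finset.sum_eq_zero_iff_of_nonneg hnn] at h0
    exact D.active hh hx0 fun i hi => by linarith [h0 i hi]
  have hz : ∀ᶠ ε in 𝓝[>] (0 : ℝ), (volume (D.slab h σ ε)).toReal / ε ^ σ.card = 0 := by
    have : ∀ᶠ ε in 𝓝[>] (0 : ℝ), σ.card * ε < ∑ j ∈ σ, (h j - inner ℝ (D.u j) x0) := by
      refine nhdsWithin_le_nhds ?_
      have hcont : Continuous fun ε : ℝ => σ.card * ε := by fun_prop
      exact (hcont.tendsto 0).eventually (gt_mem_nhds (by simpa using hpos))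
    filter_upwards [this] with ε hε
    have : D.slab h σ ε = ∅ := by
      rw [eq_empty_iff_forall_notMem]
      rintro x ⟨hx, hx2⟩
      have h1 := hmin hx
      have h2 : ∑ j ∈ σ, (h j - inner ℝ (D.u j) x) ≤ ∑ j ∈ σ, ε :=
        Finset.sum_le_sum fun j hj => by linarith [hx2 j hj]
      simp only [Finset.sum_const, nsmul_eq_mul] at h2
      simp only [mem_ofPred_eq] at h1
      linarith
    simp [this]
  have h0 := tendsto_nhds_unique_of_eventuallyEq hlim (tendsto_const_nhds (x := (0 : ℝ))) hz
  have hf : ((n - σ.card).factorial : ℝ) ≠ 0 := by positivity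
  have hm' : n - σ.card = m := by omega
  rw [div_eq_zero_iff, or_iff_left hf, hm'] at h0
  exact h0

/-- The linear form of a translation. -/
noncomputable def PolyData.tr (D : PolyData n ι) (v : En n) : MvPolynomial ι ℝ :=
  lf fun i => inner ℝ (D.u i) v

theorem PolyData.E3 (hne : D.Om.Nonempty) (hψ : ∀ h ∈ D.Om,
      ψ (lf h ^ n) = n.factorial * (volume (D.P h)).toReal)
    (v : En n) {a : MvPolynomial ι ℝ} {m : ℕ} (ha : a.IsHomogeneous m) (hm : m + 1 = n) :
    ψ (a * D.tr v) = 0 := by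
  refine D.polarize (φ := ψ ∘ₗ LinearMap.mulRight ℝ (D.tr v)) hne (fun h hh => ?_) ha
  have h1 := bin_tendsto ψ (lf h) (fun _ : Unit => D.tr v) Finset.univ (N := n) (by simp; omega)
  have hz : ∀ᶠ t in 𝓝[≠] (0 : ℝ), h + t • (fun i => inner ℝ (D.u i) v) ∈ D.Om := by
    refine nhdsWithin_le_nhds ?_
    have hcont : Continuous fun t : ℝ => h + t • (fun i => inner ℝ (D.u i) v) := by fun_prop
    exact (hcont.tendsto 0).eventually (by simpa using D.Om_open.mem_nhds hh)
  have hp : (Finset.univ : Finset Unit).powerset = {∅, {()}} := by decide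
  have h2 := tendsto_nhds_unique_of_eventuallyEq h1 (tendsto_const_nhds (x := (0 : ℝ))) (by
    filter_upwards [hz] with t ht
    have e : volume (D.P (h + t • (fun i => inner ℝ (D.u i) v))) = volume (D.P h) := by
      have : D.P h = (fun x => t • v + x) ⁻¹' (D.P (h + t • (fun i => inner ℝ (D.u i) v))) := by
        ext x
        simp only [PolyData.P, inner_add_right, inner_smul_right, mem_preimage, mem_ofPred_eq,
          Pi.add_apply, Pi.smul_apply, smul_eq_mul]
        exact forall_congr' fun i => by constructor <;> intro _ <;> linarith
      rw [this, measure_preimage_add]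
    rw [hp, Finset.sum_pair (by decide)]
    simp only [Finset.sum_empty, Finset.sum_singleton, smul_zero, add_zero, Finset.card_empty,
      Finset.card_singleton, PolyData.tr]
    rw [← lf_smul', ← lf_add, hψ _ ht, hψ _ hh, e]
    simp)
  have hnf : (n.factorial : ℝ) ≠ 0 := by positivity
  have hnf' : ((n - 1).factorial : ℝ) ≠ 0 := by positivity
  have hm' : n - 1 = m := by omega
  simp [hnf, hnf'] at h2
  rw [hm'] at h2
  rw [LinearMap.comp_apply, LinearMap.mulRight_apply, mul_comm]
  exact h2

theorem PolyData.E5 (hψ : ∀ h ∈ D.Om,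
      ψ (lf h ^ n) = n.factorial * (volume (D.P h)).toReal) (hne : D.Om.Nonempty)
    {τ : Finset ι} (hτ : τ ∈ D.𝓑) : 0 < ψ (∏ j ∈ τ, MvPolynomial.X j) := by
  obtain ⟨h, hh⟩ := hne
  have hlim := D.slab_tendsto hψ hh (σ := τ) (D.card_eq τ hτ).le
  rw [D.card_eq τ hτ] at hlim
  simp only [Nat.sub_self, pow_zero, mul_one, Nat.factorial_zero, Nat.cast_one, div_one] at hlim
  let O : Set (En n) := {y | ∀ j ∈ τ, inner ℝ (D.u j) y ∈ Ioo (-1 : ℝ) 0}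
  have hO : IsOpen O := by
    have : O = ⋂ j ∈ τ, (fun y => inner ℝ (D.u j) y) ⁻¹' (Ioo (-1 : ℝ) 0) := by
      ext y; simp [O]
    rw [this]
    exact isOpen_biInter_finset fun j _ => isOpen_Ioo.preimage (by fun_prop)
  let y0 : En n := D.vert τ (fun _ => -1 / 2)
  have hy0 : y0 ∈ O := fun j hj => by
    simp only [y0]
    rw [D.vert_spec τ hτ j hj]; constructor <;> norm_num
  let Q : Set (En n) := O ∩ Metric.ball y0 1
  have hQo : IsOpen Q := hO.inter Metric.isOpen_ball
  have hQ0 : y0 ∈ Q := ⟨hy0, by simp⟩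
  have hQpos : 0 < volume Q := hQo.measure_pos volume ⟨_, hQ0⟩
  have hQfin : volume Q ≠ ⊤ := measure_ne_top_of_subset inter_subset_right
    Metric.isBounded_ball.measure_lt_top.ne
  have hQr : 0 < (volume Q).toReal := ENNReal.toReal_pos hQpos.ne' hQfin
  refine hQr.trans_le (ge_of_tendsto hlim ?_)
  have hev : ∀ᶠ ε in 𝓝[>] (0 : ℝ), ∀ i ∈ Finset.univ.filter (fun i => i ∉ τ),
      inner ℝ (D.u i) (D.vert τ h) + ε * (‖D.u i‖ * (‖y0‖ + 1)) < h i := by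
    rw [Finset.eventually_all]
    intro i hi
    refine nhdsWithin_le_nhds ?_
    have hcont : Continuous fun ε : ℝ =>
      inner ℝ (D.u i) (D.vert τ h) + ε * (‖D.u i‖ * (‖y0‖ + 1)) := by fun_prop
    exact (hcont.tendsto 0).eventually (gt_mem_nhds (by simpa using hh τ hτ i (by simpa using hi)))
  filter_upwards [hev, self_mem_nhdsWithin] with ε hε hε0
  have hε0 : 0 < ε := hε0
  rw [le_div_iff₀ (pow_pos hε0 _)]
  have hsub : (fun y => D.vert τ h + ε • y) '' Q ⊆ D.slab h τ ε := by
    rintro _ ⟨y, hy, rfl⟩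
    have hyn : ‖y‖ ≤ ‖y0‖ + 1 := by
      have := hy.2
      rw [Metric.mem_ball, dist_eq_norm] at this
      calc ‖y‖ = ‖y0 + (y - y0)‖ := by congr 1; abel
        _ ≤ ‖y0‖ + ‖y - y0‖ := norm_add_le _ _
        _ ≤ _ := by linarith
    refine ⟨fun i => ?_, fun j hj => ?_⟩
    · rw [inner_add_right, inner_smul_right]
      by_cases hi : i ∈ τ
      · rw [D.vert_spec τ hτ i hi]
        have := (hy.1 i hi).2
        nlinarith
      · have h1 := hε i (by simpa using hi)
        have h2 : inner ℝ (D.u i) y ≤ ‖D.u i‖ * (‖y0‖ + 1) :=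
          (real_inner_le_norm _ _).trans (mul_le_mul_of_nonneg_left hyn (norm_nonneg _))
        have := mul_le_mul_of_nonneg_left h2 hε0.le
        linarith
    · rw [inner_add_right, inner_smul_right, D.vert_spec τ hτ j hj]
      have := (hy.1 j hj).1
      nlinarith
  have hv : volume ((fun y => D.vert τ h + ε • y) '' Q) = ENNReal.ofReal (ε ^ n) * volume Q := by
    have e : (fun y => D.vert τ h + ε • y) '' Q = (fun y => D.vert τ h + y) '' (ε • Q) := by
      rw [← image_smul, image_image]
    rw [e, image_add_left, measure_preimage_add, Measure.addHaar_smul]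
    simp [abs_of_pos hε0]
  have := ENNReal.toReal_mono (D.slab_fin h τ ε) (measure_mono hsub)
  rw [hv, ENNReal.toReal_mul, ENNReal.toReal_ofReal (by positivity)] at this
  linarith

end Facts2
end ConvexPaper

namespace ConvexPaper
section Trickle
open MeasureTheory Set Filter Topology
variable {n : ℕ} {ι : Type} [Fintype ι] [DecidableEq ι] {D : PolyData n ι}

/-- Monomial of a finset. -/
noncomputable def xp (σ : Finset ι) : MvPolynomial ι ℝ := ∏ j ∈ σ, MvPolynomial.X j

/-- The space of linear forms. -/
noncomputable def Vl (ι : Type) [Fintype ι] : Submodule ℝ (MvPolynomial ι ℝ) :=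
  LinearMap.range (lfL ι)

theorem mem_Vl {a : MvPolynomial ι ℝ} : a ∈ Vl ι ↔ ∃ h, lf h = a := Iff.rfl

variable {ψ : MvPolynomial ι ℝ →ₗ[ℝ] ℝ}

theorem PolyData.logconc (hψ : ∀ h ∈ D.Om,
      ψ (lf h ^ n) = n.factorial * (volume (D.P h)).toReal) {σ : Finset ι} (hσ : σ.card ≤ n)
    {h h' : ι → ℝ} (hh : h ∈ D.Om) (hh' : h' ∈ D.Om) :
    ψ (xp σ * lf h ^ (n - σ.card)) * ψ (xp σ * lf h' ^ (n - σ.card)) ≤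
      ψ (xp σ * lf ((2⁻¹ : ℝ) • (h + h')) ^ (n - σ.card)) ^ 2 := by
  have hm := D.Om_smul (D.Om_add hh hh') (c := (2⁻¹ : ℝ)) (by norm_num)
  have l1 := D.slab_tendsto hψ hh hσ
  have l2 := D.slab_tendsto hψ hh' hσ
  have l3 := D.slab_tendsto hψ hm hσ
  have hle := le_of_tendsto_of_tendsto (l1.mul l2) (l3.pow 2) (by
    filter_upwards [self_mem_nhdsWithin] with ε hε
    have hε : 0 < ε := hε
    have hb := brunn_minkowski (D.slab_meas h σ ε) (D.slab_meas h' σ ε)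
      (D.slab_meas ((2⁻¹ : ℝ) • (h + h')) σ ε) (fun x hx y hy => by
        refine ⟨fun i => ?_, fun j hj => ?_⟩
        · have h1 := hx.1 i
          have h2 := hy.1 i
          rw [inner_smul_right, inner_add_right]
          simp only [Pi.smul_apply, Pi.add_apply, smul_eq_mul]
          linarith
        · have h1 := hx.2 j hj
          have h2 := hy.2 j hj
          rw [inner_smul_right, inner_add_right]
          simp only [Pi.smul_apply, Pi.add_apply, smul_eq_mul]
          linarith)
    have hb2 := ENNReal.toReal_mono (ENNReal.pow_ne_top (D.slab_fin _ _ _)) hb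
    rw [ENNReal.toReal_mul, ENNReal.toReal_pow] at hb2
    have hp := pow_pos hε σ.card
    rw [div_mul_div_comm, div_pow, ← pow_two]
    gcongr)
  have hf : (0 : ℝ) < (n - σ.card).factorial := by positivity
  rw [div_mul_div_comm, div_pow, ← pow_two, div_le_div_iff_of_pos_right (by positivity)] at hle
  exact hle

theorem PolyData.E4 (hψ : ∀ h ∈ D.Om,
      ψ (lf h ^ n) = n.factorial * (volume (D.P h)).toReal) {σ : Finset ι} {m : ℕ}
    (hσ : σ.card + (m + 2) = n) {h : ι → ℝ} (hh : h ∈ D.Om)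
    (hpos : 0 < ψ (xp σ * lf h ^ (m + 2))) :
    Lor (Vl ι) ψ (xp σ * lf h ^ m) := by
  refine Lor.of_hyperplane (ψ ∘ₗ LinearMap.mulLeft ℝ (xp σ * lf h ^ (m + 1))) ?_
  rintro g ⟨w, rfl⟩ h0
  change ψ (xp σ * lf h ^ (m + 1) * lf w) = 0 at h0
  change ψ (xp σ * lf h ^ m * lf w * lf w) ≤ 0
  by_contra hC
  push Not at hC
  set A := ψ (xp σ * lf h ^ (m + 2)) with hA
  let c : ℕ → ℝ := fun i => ((m + 2).choose i : ℝ) * ψ (xp σ * (lf h ^ (m + 2 - i) * lf w ^ i))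
  have hf : ∀ t : ℝ, ψ (xp σ * lf (h + t • w) ^ (m + 2)) =
      A + t ^ 2 * ∑ i ∈ Finset.range (m + 1), t ^ i * c (i + 2) := fun t => by
    rw [lf_add, lf_smul', add_comm (lf h), add_pow, Finset.mul_sum, map_sum]
    have : ∀ i ∈ Finset.range (m + 2 + 1), ψ (xp σ * ((t • lf w) ^ i * lf h ^ (m + 2 - i) *
        ((m + 2).choose i : MvPolynomial ι ℝ))) = t ^ i * c i := fun i _ => by
      have e : xp σ * ((t • lf w) ^ i * lf h ^ (m + 2 - i) *
        ((m + 2).choose i : MvPolynomial ι ℝ)) = (t ^ i * (m + 2).choose i) •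
          (xp σ * (lf h ^ (m + 2 - i) * lf w ^ i)) := by
        rw [smul_pow]
        simp only [MvPolynomial.smul_eq_C_mul, MvPolynomial.C_mul, map_natCast]
        ring
      rw [e, map_smul, smul_eq_mul, mul_assoc]
    rw [Finset.sum_congr rfl this, Finset.sum_range_succ', Finset.sum_range_succ']
    have c0 : c 0 = A := by simp [c, hA]
    have c1 : c 1 = 0 := by
      simp only [c]
      rw [show m + 2 - 1 = m + 1 by omega, pow_one, ← mul_assoc, h0, mul_zero]
    rw [c0, c1, Finset.mul_sum]
    simp only [pow_zero, one_mul, zero_add, mul_zero, add_zero]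
    rw [add_comm]
    congr 1
    exact Finset.sum_congr rfl fun i _ => by ring
  have hg : Continuous fun t : ℝ => ∑ i ∈ Finset.range (m + 1), t ^ i * c (i + 2) := by fun_prop
  have hg0 : 0 < ∑ i ∈ Finset.range (m + 1), (0 : ℝ) ^ i * c (i + 2) := by
    rw [Finset.sum_range_succ']
    have : 0 < c 2 := by
      simp only [c]
      refine mul_pos (by exact_mod_cast Nat.choose_pos (by omega)) ?_
      convert hC using 2
      rw [show m + 2 - 2 = m by omega]; ring
    simpa using this
  have hev1 : ∀ᶠ t in 𝓝 (0 : ℝ), 0 < ∑ i ∈ Finset.range (m + 1), t ^ i * c (i + 2) :=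
    (hg.tendsto 0).eventually (lt_mem_nhds hg0)
  have hev2 : ∀ᶠ t in 𝓝 (0 : ℝ), 0 < ∑ i ∈ Finset.range (m + 1), (-t) ^ i * c (i + 2) := by
    have := (hg.comp continuous_neg).tendsto 0
    simp only [Function.comp_apply, neg_zero] at this
    exact this.eventually (lt_mem_nhds hg0)
  have hev3 : ∀ᶠ t in 𝓝 (0 : ℝ), h + t • w ∈ D.Om := by
    have hcont : Continuous fun t : ℝ => h + t • w := by fun_prop
    exact (hcont.tendsto 0).eventually (by simpa using D.Om_open.mem_nhds hh)
  have hev4 : ∀ᶠ t in 𝓝 (0 : ℝ), h + (-t) • w ∈ D.Om := by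
    have hcont : Continuous fun t : ℝ => h + (-t) • w := by fun_prop
    exact (hcont.tendsto 0).eventually (by simpa using D.Om_open.mem_nhds hh)
  have hall := (((hev1.and hev2).and hev3).and hev4).filter_mono
    (nhdsWithin_le_nhds (s := Ioi (0 : ℝ)))
  obtain ⟨t, ⟨⟨⟨⟨h1, h2⟩, h3⟩, h4⟩, h5⟩⟩ := (hall.and self_mem_nhdsWithin).exists
  have h5 : 0 < t := h5
  have hlc := D.logconc hψ (σ := σ) (by omega) h3 h4
  rw [show n - σ.card = m + 2 by omega] at hlc
  have e : (2⁻¹ : ℝ) • (h + t • w + (h + (-t) • w)) = h := by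
    ext i; simp; ring
  rw [e, hf, hf, ← hA] at hlc
  have ht2 : 0 < t ^ 2 := by positivity
  have p1 := mul_pos ht2 h1
  have ht3 : 0 < (-t) ^ 2 := by rw [neg_sq]; exact ht2
  have p2 := mul_pos ht3 h2
  nlinarith [mul_pos p1 p2, mul_pos hpos p1, mul_pos hpos p2]

end Trickle
end ConvexPaper

namespace ConvexPaper
section Trickle2
open MeasureTheory Set Filter Topology
variable {n : ℕ} {ι : Type} [Fintype ι] [DecidableEq ι] {D : PolyData n ι}

def PolyData.face (D : PolyData n ι) (σ : Finset ι) : Prop := ∃ τ ∈ D.𝓑, σ ⊆ τ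

open Classical in
/-- Link of a face. -/
noncomputable def PolyData.lk (D : PolyData n ι) (σ : Finset ι) : Finset ι :=
  Finset.univ.filter fun j => j ∉ σ ∧ D.face (insert j σ)

theorem PolyData.mem_lk {σ : Finset ι} {j : ι} :
    j ∈ D.lk σ ↔ j ∉ σ ∧ D.face (insert j σ) := by
  classical
  simp [PolyData.lk]

theorem PolyData.reduce {σ : Finset ι} (hσ : D.face σ) (w : ι → ℝ) :
    ∃ w' : ι → ℝ, (∀ i ∈ σ, w' i = 0) ∧ ∃ v, lf w = lf w' + D.tr v := by
  obtain ⟨τ, hτ, hs⟩ := hσ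
  refine ⟨w - fun i => inner ℝ (D.u i) (D.vert τ w), fun i hi => ?_, D.vert τ w, ?_⟩
  · simp [D.vert_spec τ hτ i (hs hi)]
  · rw [PolyData.tr, ← lf_add, sub_add_cancel]

theorem PolyData.reduce_pos {σ : Finset ι} (hσ : D.face σ) {h : ι → ℝ} (hh : h ∈ D.Om) :
    ∃ w' : ι → ℝ, (∀ i ∈ σ, w' i = 0) ∧ (∀ i, i ∉ σ → 0 < w' i) ∧ ∃ v, lf h = lf w' + D.tr v := by
  obtain ⟨τ, hτ, hs⟩ := hσ
  have hev : ∀ᶠ t in 𝓝[>] (0 : ℝ), ∀ i ∈ Finset.univ.filter (fun i => i ∉ τ),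
      inner ℝ (D.u i) (D.vert τ (h - t • ind (τ \ σ))) < h i := by
    rw [Finset.eventually_all]
    intro i hi
    refine nhdsWithin_le_nhds ?_
    have hc : Continuous (D.vert τ) := LinearMap.continuous_of_finiteDimensional _
    have hcont : Continuous fun t : ℝ => inner ℝ (D.u i) (D.vert τ (h - t • ind (τ \ σ))) :=
      continuous_const.inner (hc.comp (by fun_prop))
    exact (hcont.tendsto 0).eventually (gt_mem_nhds (by simpa using hh τ hτ i (by simpa using hi)))
  obtain ⟨t, ht, ht0⟩ := (hev.and self_mem_nhdsWithin).exists
  have ht0 : 0 < t := ht0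
  set v := D.vert τ (h - t • ind (τ \ σ)) with hv
  refine ⟨h - fun i => inner ℝ (D.u i) v, fun i hi => ?_, fun i hi => ?_, v, ?_⟩
  · have := D.vert_spec τ hτ i (hs hi) (h - t • ind (τ \ σ))
    rw [Pi.sub_apply, this]; simp [ind, hi]
  · by_cases hiτ : i ∈ τ
    · have := D.vert_spec τ hτ i hiτ (h - t • ind (τ \ σ))
      rw [Pi.sub_apply, this]; simp [ind, hi, hiτ, ht0]
    · have := ht i (by simpa using hiτ)
      simpa using this
  · rw [PolyData.tr, ← lf_add, sub_add_cancel]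

variable {ψ : MvPolynomial ι ℝ →ₗ[ℝ] ℝ}

theorem xp_insert {σ : Finset ι} {j : ι} (hj : j ∉ σ) :
    xp (insert j σ) = xp σ * MvPolynomial.X j := by
  rw [xp, Finset.prod_insert hj, mul_comm]; rfl

/-- Product of a list of linear forms. -/
noncomputable def lp (L : List (ι → ℝ)) : MvPolynomial ι ℝ := (L.map lf).prod

theorem lp_hom (L : List (ι → ℝ)) : (lp L).IsHomogeneous L.length := by
  induction L with
  | nil => simpa [lp] using MvPolynomial.isHomogeneous_one ι ℝ
  | cons c L ih =>
    have := (lf_hom c).mul ih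
    rw [List.length_cons, add_comm]
    simpa [lp] using this

theorem lp_cons (c : ι → ℝ) (L : List (ι → ℝ)) : lp (c :: L) = lf c * lp L := by simp [lp]

theorem PolyData.expand (hne : D.Om.Nonempty) (hψ : ∀ h ∈ D.Om,
      ψ (lf h ^ n) = n.factorial * (volume (D.P h)).toReal) {σ : Finset ι}
    {w w' : ι → ℝ} {v : En n} (h0 : ∀ i ∈ σ, w' i = 0) (hw : lf w = lf w' + D.tr v)
    {Q : MvPolynomial ι ℝ} {d : ℕ} (hQ : Q.IsHomogeneous d) (hd : σ.card + d + 1 = n) :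
    ψ (xp σ * lf w * Q) = ∑ j : D.lk σ, w' j * ψ (xp σ * MvPolynomial.X j.1 * Q) := by
  have e1 : xp σ * lf w * Q = xp σ * lf w' * Q + (xp σ * Q) * D.tr v := by rw [hw]; ring
  have e3 : ψ (xp σ * Q * D.tr v) = 0 := D.E3 hne hψ v ((xprod_hom σ).mul hQ) hd
  rw [e1, map_add, e3, add_zero, lf, Finset.mul_sum,
    Finset.sum_mul, map_sum, Finset.sum_coe_sort (D.lk σ)
      (fun j => w' j * ψ (xp σ * MvPolynomial.X j * Q))]
  have e2 : ∀ j, ψ (xp σ * (MvPolynomial.C (w' j) * MvPolynomial.X j) * Q) =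
      w' j * ψ (xp σ * MvPolynomial.X j * Q) := fun j => by
    rw [← smul_eq_mul (w' j), ← map_smul, MvPolynomial.smul_eq_C_mul]
    congr 1; ring
  simp_rw [e2]
  symm
  refine Finset.sum_subset (Finset.subset_univ _) fun j _ hj => ?_
  by_cases hjs : j ∈ σ
  · rw [h0 j hjs, zero_mul]
  · rw [← xp_insert hjs]
    have hf : ¬ D.face (insert j σ) := fun hf => hj (D.mem_lk.2 ⟨hjs, hf⟩)
    rw [xp, D.E2 hne hψ hf hQ (by rw [Finset.card_insert_of_notMem hjs]; omega), mul_zero]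

theorem PolyData.lk_nonempty {σ : Finset ι} (hσ : D.face σ) (hc : σ.card < n) :
    Nonempty (D.lk σ) := by
  obtain ⟨τ, hτ, hs⟩ := hσ
  have : ∃ j ∈ τ, j ∉ σ := by
    by_contra hcon
    push Not at hcon
    have := Finset.card_le_card (show τ ⊆ σ from fun j hj => hcon j hj)
    rw [D.card_eq τ hτ] at this; omega
  obtain ⟨j, hj, hjs⟩ := this
  exact ⟨⟨j, D.mem_lk.2 ⟨hjs, τ, hτ, Finset.insert_subset hj hs⟩⟩⟩

theorem PolyData.pos (hne : D.Om.Nonempty) (hψ : ∀ h ∈ D.Om,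
      ψ (lf h ^ n) = n.factorial * (volume (D.P h)).toReal) (L : List (ι → ℝ)) :
    (∀ h ∈ L, h ∈ D.Om) → ∀ σ : Finset ι, D.face σ → σ.card + L.length = n →
    0 < ψ (xp σ * lp L) := by
  induction L with
  | nil =>
    intro _ σ ⟨τ, hτ, hs⟩ hc
    have : σ = τ := Finset.eq_of_subset_of_card_le hs (by
      rw [D.card_eq τ hτ]; simpa using hc.ge)
    subst this
    simpa [lp, xp] using D.E5 hψ hne hτ
  | cons c L ih =>
    intro hL σ hσ hc
    obtain ⟨w', h0, hp, v, hw⟩ := D.reduce_pos hσ (hL c (by simp))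
    rw [lp_cons, ← mul_assoc, D.expand hne hψ h0 hw (lp_hom L) (by simp at hc; omega)]
    haveI := D.lk_nonempty hσ (by simp at hc; omega)
    refine Finset.sum_pos (fun j _ => ?_) Finset.univ_nonempty
    obtain ⟨h1, h2⟩ := D.mem_lk.1 j.2
    refine mul_pos (hp _ h1) ?_
    rw [← xp_insert h1]
    exact ih (fun h hh => hL h (List.mem_cons_of_mem _ hh)) _ h2 (by
      rw [Finset.card_insert_of_notMem h1]; simp at hc; omega)

theorem lf_restrict (J : Finset ι) (t : J → ℝ) :
    ∃ w : ι → ℝ, (∀ j : J, w j = t j) ∧ ∀ i, i ∉ J → w i = 0 := by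
  refine ⟨fun i => if h : i ∈ J then t ⟨i, h⟩ else 0, fun j => by simp, fun i hi => by simp [hi]⟩

theorem PolyData.trickle (hne : D.Om.Nonempty) (hψ : ∀ h ∈ D.Om,
      ψ (lf h ^ n) = n.factorial * (volume (D.P h)).toReal) (L : List (ι → ℝ)) :
    (∀ h ∈ L, h ∈ D.Om) → ∀ σ : Finset ι, D.face σ → σ.card + L.length + 2 = n →
    Lor (Vl ι) ψ (xp σ * lp L) := by
  induction L with
  | nil =>
    intro _ σ hσ hc
    obtain ⟨h, hh⟩ := hne
    have h1 := D.pos ⟨h, hh⟩ hψ [h, h] (by simp [hh]) σ hσ (by simpa using hc)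
    have h2 := D.E4 hψ (m := 0) (σ := σ) (by simp at hc; omega) hh (by
      simpa [lp, pow_two] using h1)
    simpa [lp] using h2
  | cons c L ih =>
    intro hL σ hσ hc
    have hc' : σ.card + L.length + 3 = n := by simp at hc; omega
    have hcO := hL c (by simp)
    have hLO : ∀ h ∈ L, h ∈ D.Om := fun h hh => hL h (List.mem_cons_of_mem _ hh)
    obtain ⟨α, hα0, hαp, vα, hα⟩ := D.reduce_pos hσ hcO
    have hαJ : ∀ j : D.lk σ, 0 < α j := fun j => hαp _ (D.mem_lk.1 j.2).1
    have hX : ∀ j : ι, (MvPolynomial.X j : MvPolynomial ι ℝ).IsHomogeneous 1 :=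
      MvPolynomial.isHomogeneous_X ℝ
    set R := lp L with hR
    have hRh : R.IsHomogeneous L.length := lp_hom L
    -- the basic form
    let F : D.lk σ → D.lk σ → ℝ := fun i j =>
      ψ (xp σ * (lf c * R) * MvPolynomial.X i.1 * MvPolynomial.X j.1)
    let M : Matrix (D.lk σ) (D.lk σ) ℝ := Matrix.of fun i j => α i * α j * F i j
    have hlin1 : ∀ (w w' : ι → ℝ) (v : En n), (∀ i ∈ σ, w' i = 0) → lf w = lf w' + D.tr v →
        ∀ i : D.lk σ, ψ (xp σ * (lf c * R) * MvPolynomial.X i.1 * lf w) = ∑ j : D.lk σ, w' j * F i j := by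
      intro w w' v h0 hw i
      have e : xp σ * (lf c * R) * MvPolynomial.X i.1 * lf w =
          xp σ * lf w * (lf c * R * MvPolynomial.X i.1) := by ring
      rw [e, D.expand hne hψ h0 hw (((lf_hom c).mul hRh).mul (hX i.1)) (by omega)]
      refine Finset.sum_congr rfl fun j _ => ?_
      congr 2; ring
    have hlin2 : ∀ (w w' : ι → ℝ) (v : En n), (∀ i ∈ σ, w' i = 0) → lf w = lf w' + D.tr v →
        ∀ g : ι → ℝ, ψ (xp σ * (lf c * R) * lf w * lf g) =
          ∑ i : D.lk σ, w' i * ψ (xp σ * (lf c * R) * MvPolynomial.X i.1 * lf g) := by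
      intro w w' v h0 hw g
      have e : xp σ * (lf c * R) * lf w * lf g =
          xp σ * lf w * (lf c * R * lf g) := by ring
      rw [e, D.expand hne hψ h0 hw (((lf_hom c).mul hRh).mul (lf_hom g)) (by omega)]
      refine Finset.sum_congr rfl fun j _ => ?_
      congr 2; ring
    have hrow : ∀ i : D.lk σ, ∑ j, M i j =
        α i * ψ (xp σ * (lf c * R) * MvPolynomial.X i.1 * lf c) := fun i => by
      rw [hlin1 c α vα hα0 hα i, Finset.mul_sum]
      exact Finset.sum_congr rfl fun j _ => by simp only [M, Matrix.of_apply]; ring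
    have hPi : ∀ i : D.lk σ, 0 < ψ (xp (insert i.1 σ) * R * lf c * lf c) := fun i => by
      obtain ⟨h1, h2⟩ := D.mem_lk.1 i.2
      have := D.pos hne hψ (c :: c :: L) (by
        intro h hh
        rcases List.mem_cons.1 hh with rfl | hh
        · exact hcO
        · exact hL h hh) _ h2 (by
          rw [Finset.card_insert_of_notMem h1]; simp only [List.length_cons]; omega)
      rw [lp_cons, lp_cons] at this
      have e : xp (insert i.1 σ) * R * lf c * lf c = xp (insert i.1 σ) * (lf c * (lf c * lp L)) := by
        rw [hR]; ring
      rw [e]; exact this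
    have hrowpos : ∀ i, 0 < ∑ j, M i j := fun i => by
      rw [hrow]
      refine mul_pos (hαJ i) ?_
      have := hPi i
      rw [xp_insert (D.mem_lk.1 i.2).1] at this
      have e : xp σ * (lf c * R) * MvPolynomial.X i.1 * lf c =
        xp σ * MvPolynomial.X i.1 * R * lf c * lf c := by ring
      rw [e]; exact this
    -- sign and vanishing of F
    have hFpair : ∀ i j : D.lk σ, i ≠ j → ∀ Q : MvPolynomial ι ℝ,
        xp σ * Q * MvPolynomial.X i.1 * MvPolynomial.X j.1 = xp (insert j.1 (insert i.1 σ)) * Q := by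
      intro i j hij Q
      have hj : j.1 ∉ insert i.1 σ := by
        rw [Finset.mem_insert, not_or]
        exact ⟨fun e => hij (Subtype.ext e.symm), (D.mem_lk.1 j.2).1⟩
      rw [xp_insert hj, xp_insert (D.mem_lk.1 i.2).1]; ring
    have hcard : ∀ i j : D.lk σ, i ≠ j → (insert j.1 (insert i.1 σ)).card = σ.card + 2 := by
      intro i j hij
      have hj : j.1 ∉ insert i.1 σ := by
        rw [Finset.mem_insert, not_or]
        exact ⟨fun e => hij (Subtype.ext e.symm), (D.mem_lk.1 j.2).1⟩
      rw [Finset.card_insert_of_notMem hj, Finset.card_insert_of_notMem (D.mem_lk.1 i.2).1]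
    have hF0 : ∀ i j : D.lk σ, i ≠ j → ¬ D.face (insert j.1 (insert i.1 σ)) → ∀ Q : MvPolynomial ι ℝ,
        Q.IsHomogeneous (L.length + 1) →
        ψ (xp σ * Q * MvPolynomial.X i.1 * MvPolynomial.X j.1) = 0 := by
      intro i j hij hf Q hQ
      rw [hFpair i j hij]
      exact D.E2 hne hψ hf hQ (by rw [hcard i j hij]; omega)
    have hFp : ∀ i j : D.lk σ, i ≠ j → D.face (insert j.1 (insert i.1 σ)) → 0 < F i j := by
      intro i j hij hf
      simp only [F]
      rw [hFpair i j hij, ← lp_cons]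
      exact D.pos hne hψ (c :: L) hL _ hf (by rw [hcard i j hij]; simp; omega)
    have hcR : (lf c * R).IsHomogeneous (L.length + 1) := by
      rw [add_comm]; exact (lf_hom c).mul hRh
    refine Lor.of_hyperplane (ψ ∘ₗ LinearMap.mulLeft ℝ (xp σ * (lf c * R) * lf c)) ?_
    rintro g ⟨w, rfl⟩ hg
    change ψ (xp σ * (lf c * R) * lf c * lf w) = 0 at hg
    change ψ (xp σ * lp (c :: L) * lf w * lf w) ≤ 0
    rw [lp_cons, ← hR]
    obtain ⟨w', hw0, v, hw⟩ := D.reduce hσ w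
    have key := TN M (fun i j => ?_) (fun i j hij => ?_) hrowpos (fun t => ?_) (fun S hS hSM => ?_)
      (fun j => w' j / α j) ?_
    · rw [hlin2 w w' v hw0 hw]
      refine le_of_eq_of_le ?_ key
      refine Finset.sum_congr rfl fun i _ => ?_
      rw [hlin1 w w' v hw0 hw i, Finset.mul_sum]
      refine Finset.sum_congr rfl fun j _ => ?_
      simp only [M, Matrix.of_apply]
      have := (hαJ i).ne'; have := (hαJ j).ne'
      field_simp
    · simp only [M, F, Matrix.of_apply]
      rw [mul_comm (α i) (α j)]
      congr 2; ring
    · simp only [M, Matrix.of_apply]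
      refine mul_nonneg (mul_pos (hαJ i) (hαJ j)).le ?_
      by_cases hf : D.face (insert j.1 (insert i.1 σ))
      · exact (hFp i j hij hf).le
      · exact (hF0 i j hij hf _ hcR).ge
    · -- the star condition
      obtain ⟨b, hb1, hb2⟩ := lf_restrict (D.lk σ) (fun j => α j * t j)
      have hb0 : ∀ i ∈ σ, b i = 0 := fun i hi => hb2 i fun h => (D.mem_lk.1 h).1 hi
      have hbt : lf b = lf b + D.tr (0 : En n) := by simp [PolyData.tr, lf]
      have hrowt : ∀ i, ∑ j, M i j * t j =
          α i * ψ (xp (insert i.1 σ) * R * lf c * lf b) := fun i => by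
        have := hlin1 b b 0 hb0 hbt i
        have e : xp (insert i.1 σ) * R * lf c * lf b
          = xp σ * (lf c * R) * MvPolynomial.X i.1 * lf b := by
          rw [xp_insert (D.mem_lk.1 i.2).1]; ring
        rw [e, this, Finset.mul_sum]
        refine Finset.sum_congr rfl fun j _ => ?_
        simp only [M, Matrix.of_apply]
        rw [hb1]; ring
      have hquad : ∑ i, ∑ j, M i j * t i * t j =
          ∑ i : D.lk σ, α i * ψ (xp (insert i.1 σ) * R * lf b * lf b) := by
        have e1 : ∑ i, ∑ j, M i j * t i * t j = ψ (xp σ * (lf c * R) * lf b * lf b) := by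
          rw [hlin2 b b 0 hb0 hbt]
          refine Finset.sum_congr rfl fun i _ => ?_
          have e : xp σ * (lf c * R) * MvPolynomial.X i.1 * lf b =
            xp (insert i.1 σ) * R * lf c * lf b := by
            rw [xp_insert (D.mem_lk.1 i.2).1]; ring
          rw [hb1, e, mul_comm (α i), mul_assoc, ← hrowt, Finset.mul_sum]
          exact Finset.sum_congr rfl fun j _ => by ring
        have e2 : xp σ * (lf c * R) * lf b * lf b = xp σ * lf c * (R * lf b * lf b) := by ring
        rw [e1, e2, D.expand hne hψ hα0 hα ((hRh.mul (lf_hom b)).mul (lf_hom b)) (by omega)]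
        refine Finset.sum_congr rfl fun i _ => ?_
        rw [xp_insert (D.mem_lk.1 i.2).1]
        congr 2; ring
      rw [hquad]
      refine Finset.sum_le_sum fun i _ => ?_
      rw [hrowt, hrow]
      have e3 : xp σ * (lf c * R) * MvPolynomial.X i.1 * lf c =
        xp (insert i.1 σ) * R * lf c * lf c := by
        rw [xp_insert (D.mem_lk.1 i.2).1]; ring
      rw [e3, le_div_iff₀ (mul_pos (hαJ i) (hPi i))]
      obtain ⟨h1, h2⟩ := D.mem_lk.1 i.2
      have hLor := ih hLO _ h2 (by rw [Finset.card_insert_of_notMem h1]; omega)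
      have := hLor (lf c) ⟨c, rfl⟩ (lf b) ⟨b, rfl⟩ (hPi i)
      have hs := mul_le_mul_of_nonneg_left this (sq_nonneg (α i))
      linarith
    · -- connectivity
      by_contra hne'
      obtain ⟨i0, hi0⟩ := hS
      obtain ⟨j0, hj0⟩ := (ne_univ_iff_exists_notMem S).1 hne'
      classical
      have hrep : ∀ k : ℕ, lp (List.replicate k c) = lf c ^ k := fun k => by simp [lp]
      have hE4 := D.E4 hψ (m := L.length + 1) (σ := σ) (by omega) hcO (by
        rw [← hrep]
        exact D.pos hne hψ _ (fun h hh => by rw [List.eq_of_mem_replicate hh]; exact hcO) σ hσ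
          (by simp; omega))
      obtain ⟨b1, hb1, hb1'⟩ := lf_restrict (D.lk σ) (fun j => if j ∈ S then α j else 0)
      obtain ⟨b2, hb2, hb2'⟩ := lf_restrict (D.lk σ) (fun j => if j ∈ S then 0 else α j)
      have hb10 : ∀ i ∈ σ, b1 i = 0 := fun i hi => hb1' i fun h => (D.mem_lk.1 h).1 hi
      have hb20 : ∀ i ∈ σ, b2 i = 0 := fun i hi => hb2' i fun h => (D.mem_lk.1 h).1 hi
      have hbt : ∀ b : ι → ℝ, lf b = lf b + D.tr (0 : En n) := fun b => by simp [PolyData.tr, lf]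
      have hQ : (lf c ^ (L.length + 1)).IsHomogeneous (L.length + 1) := by
        simpa using (lf_hom c).pow (L.length + 1)
      have hbil : ∀ b b' : ι → ℝ, (∀ i ∈ σ, b i = 0) → (∀ i ∈ σ, b' i = 0) →
          ψ (xp σ * lf c ^ (L.length + 1) * lf b * lf b') =
          ∑ i : D.lk σ, ∑ j : D.lk σ, b i * b' j *
            ψ (xp σ * lf c ^ (L.length + 1) * MvPolynomial.X i.1 * MvPolynomial.X j.1) := by
        intro b b' h h'
        have e : xp σ * lf c ^ (L.length + 1) * lf b * lf b' =
          xp σ * lf b * (lf c ^ (L.length + 1) * lf b') := by ring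
        rw [e, D.expand hne hψ h (hbt b) (hQ.mul (lf_hom b')) (by omega)]
        refine Finset.sum_congr rfl fun i _ => ?_
        have e : xp σ * MvPolynomial.X i.1 * (lf c ^ (L.length + 1) * lf b') =
          xp σ * lf b' * (lf c ^ (L.length + 1) * MvPolynomial.X i.1) := by ring
        rw [e, D.expand hne hψ h' (hbt b') (hQ.mul (hX i.1)) (by omega), Finset.mul_sum]
        refine Finset.sum_congr rfl fun j _ => ?_
        have e' : xp σ * MvPolynomial.X j.1 * (lf c ^ (L.length + 1) * MvPolynomial.X i.1) =
          xp σ * lf c ^ (L.length + 1) * MvPolynomial.X i.1 * MvPolynomial.X j.1 := by ring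
        rw [e']; ring
      have h12 : ψ (xp σ * lf c ^ (L.length + 1) * lf b1 * lf b2) = 0 := by
        rw [hbil b1 b2 hb10 hb20]
        refine Finset.sum_eq_zero fun i _ => Finset.sum_eq_zero fun j _ => ?_
        rw [hb1, hb2]
        by_cases hi : i ∈ S
        · by_cases hj : j ∈ S
          · simp [hj]
          · have hij : i ≠ j := fun e => hj (e ▸ hi)
            have hnf : ¬ D.face (insert j.1 (insert i.1 σ)) := fun hf => by
              have h1 := hSM i hi j hj
              simp only [M, Matrix.of_apply] at h1
              have h2 := mul_pos (mul_pos (hαJ i) (hαJ j)) (hFp i j hij hf)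
              linarith
            rw [hF0 i j hij hnf _ hQ, mul_zero]
        · simp [hi]
      have hsum : ∀ b b' : ι → ℝ, (∀ i ∈ σ, b i = 0) → (∀ i ∈ σ, b' i = 0) →
          (∀ j : D.lk σ, b j + b' j = α j) →
          ψ (xp σ * lf c ^ (L.length + 1) * lf b * lf b') = 0 → (∀ j : D.lk σ, 0 ≤ b j) →
          (∃ j : D.lk σ, 0 < b j) →
          0 < ψ (xp σ * lf c ^ (L.length + 1) * lf b * lf b) := by
        intro b b' h h' hbb hz hnn ⟨j, hj⟩
        have e : ψ (xp σ * lf c ^ (L.length + 1) * lf b * lf b) =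
            ψ (xp σ * lf c ^ (L.length + 1) * lf b * lf c) := by
          have e1 : ψ (xp σ * lf c ^ (L.length + 1) * lf b * lf c) =
              ψ (xp σ * lf c ^ (L.length + 1) * lf b * lf (b + b')) := by
            have f1 : ∀ g, xp σ * lf c ^ (L.length + 1) * lf b * lf g =
              xp σ * lf g * (lf c ^ (L.length + 1) * lf b) := fun g => by ring
            rw [f1, f1, D.expand hne hψ hα0 hα (hQ.mul (lf_hom b)) (by omega),
              D.expand hne hψ (w' := b + b') (v := 0) (fun i hi => by simp [h i hi, h' i hi])
                (hbt _) (hQ.mul (lf_hom b)) (by omega)]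
            exact Finset.sum_congr rfl fun j _ => by rw [Pi.add_apply, hbb]
          rw [e1, lf_add, mul_add, map_add, hz, add_zero]
        have e2 : xp σ * lf c ^ (L.length + 1) * lf b * lf c = xp σ * lf b * lf c ^ (L.length + 2) := by
          ring
        have hQ2 : (lf c ^ (L.length + 2)).IsHomogeneous (L.length + 2) := by
          simpa using (lf_hom c).pow (L.length + 2)
        have hp : ∀ j : D.lk σ, 0 < ψ (xp σ * MvPolynomial.X j.1 * lf c ^ (L.length + 2)) := fun j => by
          rw [← xp_insert (D.mem_lk.1 j.2).1, ← hrep]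
          exact D.pos hne hψ _ (fun h hh => by rw [List.eq_of_mem_replicate hh]; exact hcO) _
            (D.mem_lk.1 j.2).2
            (by rw [Finset.card_insert_of_notMem (D.mem_lk.1 j.2).1]; simp; omega)
        rw [e, e2, D.expand hne hψ h (hbt b) hQ2 (by omega)]
        exact Finset.sum_pos' (fun j _ => mul_nonneg (hnn j) (hp j).le)
          ⟨j, Finset.mem_univ _, mul_pos hj (hp j)⟩
      have p1 := hsum b1 b2 hb10 hb20 (fun j => by rw [hb1, hb2]; split_ifs <;> simp) h12
        (fun j => by rw [hb1]; split_ifs <;> simp [(hαJ j).le])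
        ⟨i0, by rw [hb1]; simp [hi0, hαJ i0]⟩
      have p2 := hsum b2 b1 hb20 hb10 (fun j => by rw [hb1, hb2]; split_ifs <;> simp)
        (by rw [← h12]; congr 1; ring)
        (fun j => by rw [hb2]; split_ifs <;> simp [(hαJ j).le])
        ⟨j0, by rw [hb2]; simp [hj0, hαJ j0]⟩
      have := hE4 (lf b1) ⟨b1, rfl⟩ (lf b2) ⟨b2, rfl⟩ p1
      rw [h12] at this
      nlinarith [mul_pos p1 p2]
    · have e : xp σ * (lf c * R) * lf c * lf w = xp σ * (lf c * R) * lf w * lf c := by ring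
      rw [e, hlin2 w w' v hw0 hw c] at hg
      rw [← hg]
      refine Finset.sum_congr rfl fun i _ => ?_
      rw [hrow]
      have := (hαJ i).ne'
      field_simp

end Trickle2
end ConvexPaper

namespace ConvexPaper
section PolarSec
open MeasureTheory Set Filter Topology
open scoped Pointwise

theorem sep_point {n : ℕ} {s : Set (En n)} (hs : Convex ℝ s) (hc : IsClosed s) {x : En n}
    (hx : x ∉ s) : ∃ (w : En n) (r : ℝ), (∀ a ∈ s, inner ℝ w a < r) ∧ r < inner ℝ w x := by
  obtain ⟨f, r, h1, h2⟩ := geometric_hahn_banach_closed_point hs hc hx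
  refine ⟨(InnerProductSpace.toDual ℝ (En n)).symm f, r, fun a ha => ?_, ?_⟩
  · rw [InnerProductSpace.toDual_symm_apply]; exact h1 a ha
  · rw [InnerProductSpace.toDual_symm_apply]; exact h2

/-- Facet normals of a polytope containing the origin in its interior. -/
theorem polar_fin {n : ℕ} (F : Finset (En n))
    (h0 : (0 : En n) ∈ interior (convexHull ℝ (F : Set (En n)))) :
    ∃ U : Finset (En n), (∀ u ∈ U, u ≠ 0) ∧
      (∀ w : En n, ∃ a : En n → ℝ, (∀ u, 0 ≤ a u) ∧ w = ∑ u ∈ U, a u • u) ∧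
      ∀ x : En n, (∀ u ∈ U, ∃ p ∈ convexHull ℝ (F : Set (En n)), inner ℝ u x ≤ inner ℝ u p) →
        x ∈ convexHull ℝ (F : Set (En n)) := by
  classical
  set Q := convexHull ℝ (F : Set (En n)) with hQ
  have h0Q : (0 : En n) ∈ Q := interior_subset h0
  have hQcomp : IsCompact Q := F.finite_toSet.isCompact_convexHull ℝ
  set W : Set (En n) := {w | ∀ p ∈ F, inner ℝ w p ≤ 1} with hW
  have hWQ : ∀ w ∈ W, ∀ p ∈ Q, inner ℝ w p ≤ 1 := by
    intro w hw p hp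
    have hcv : Convex ℝ {p : En n | inner ℝ w p ≤ 1} := by
      intro x hx y hy a b ha hb hab
      simp only [Set.mem_ofPred_eq] at *
      rw [inner_add_right, inner_smul_right, inner_smul_right]
      nlinarith
    exact convexHull_min (fun p hp => hw p hp) hcv hp
  have hWclosed : IsClosed W := by
    have : W = ⋂ p ∈ F, {w : En n | inner ℝ w p ≤ 1} := by ext w; simp [hW]
    rw [this]
    exact isClosed_biInter fun p _ => isClosed_le (by fun_prop) continuous_const
  have hWconv : Convex ℝ W := by
    intro x hx y hy a b ha hb hab p hp
    rw [inner_add_left, inner_smul_left, inner_smul_left]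
    have := hx p hp; have := hy p hp
    simp only [conj_trivial]
    nlinarith
  have hWbdd : Bornology.IsBounded W := by
    obtain ⟨r, hr, hball⟩ := Metric.isOpen_iff.1 isOpen_interior 0 h0
    rw [isBounded_iff_forall_norm_le]
    refine ⟨2 / r, fun w hw => ?_⟩
    by_cases hw0 : w = 0
    · rw [hw0, norm_zero]; positivity
    have hn : 0 < ‖w‖ := norm_pos_iff.2 hw0
    have hm : (r / (2 * ‖w‖)) • w ∈ Q := by
      apply interior_subset (hball _)
      rw [mem_ball_zero_iff, norm_smul, Real.norm_of_nonneg (by positivity)]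
      have : r / (2 * ‖w‖) * ‖w‖ = r / 2 := by field_simp
      rw [this]; linarith
    have := hWQ w hw _ hm
    rw [inner_smul_right, real_inner_self_eq_norm_sq] at this
    have e : r / (2 * ‖w‖) * ‖w‖ ^ 2 = r / 2 * ‖w‖ := by field_simp
    rw [e] at this
    rw [le_div_iff₀ hr]; linarith
  have hWcomp : IsCompact W := Metric.isCompact_of_isClosed_isBounded hWclosed hWbdd
  -- finitely many extreme points
  have hfin : (W.extremePoints ℝ).Finite := by
    let act : En n → Finset (En n) := fun w => F.filter fun p => inner ℝ w p = 1
    have hinj : Set.InjOn act (W.extremePoints ℝ) := by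
      intro w hw w' hw' he
      have hev : ∀ᶠ t in 𝓝[>] (0 : ℝ), ∀ p ∈ F.filter (fun p => inner ℝ w p < 1),
          inner ℝ (w + t • (w' - w)) p ≤ 1 ∧ inner ℝ (w - t • (w' - w)) p ≤ 1 := by
        rw [Finset.eventually_all]
        intro p hp
        have hp' : inner ℝ w p < 1 := (Finset.mem_filter.1 hp).2
        have c1 : Continuous fun t : ℝ => inner ℝ (w + t • (w' - w)) p := by fun_prop
        have c2 : Continuous fun t : ℝ => inner ℝ (w - t • (w' - w)) p := by fun_prop
        have e1 := (c1.tendsto 0).eventually (gt_mem_nhds (by simpa using hp' : inner ℝ (w + (0:ℝ) • (w' - w)) p < 1))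
        have e2 := (c2.tendsto 0).eventually (gt_mem_nhds (by simpa using hp' : inner ℝ (w - (0:ℝ) • (w' - w)) p < 1))
        exact ((e1.and e2).filter_mono nhdsWithin_le_nhds).mono fun t ht => ⟨ht.1.le, ht.2.le⟩
      obtain ⟨t, ht, ht0⟩ := (hev.and self_mem_nhdsWithin).exists
      have ht0 : 0 < t := ht0
      have hact : ∀ p ∈ F, inner ℝ w p = 1 → inner ℝ w' p = 1 := by
        intro p hp h1
        have : p ∈ act w := Finset.mem_filter.2 ⟨hp, h1⟩
        rw [he] at this
        exact (Finset.mem_filter.1 this).2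
      have hmem : w + t • (w' - w) ∈ W ∧ w - t • (w' - w) ∈ W := by
        have hlt : ∀ p ∈ F, inner ℝ w p = 1 ∨ inner ℝ w p < 1 := fun p hp =>
          (hw.1 p hp).eq_or_lt
        constructor
        · intro p hp
          rcases hlt p hp with h | h
          · simp [inner_add_left, inner_sub_left, inner_smul_left, h, hact p hp h]
          · exact (ht p (Finset.mem_filter.2 ⟨hp, h⟩)).1
        · intro p hp
          rcases hlt p hp with h | h
          · simp [inner_sub_left, inner_smul_left, h, hact p hp h]
          · exact (ht p (Finset.mem_filter.2 ⟨hp, h⟩)).2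
      have := hw.2 hmem.1 hmem.2 ⟨1 / 2, 1 / 2, by norm_num, by norm_num, by norm_num, by
        module⟩
      have h2 : t • (w' - w) = 0 := by simpa using this
      rcases smul_eq_zero.1 h2 with h | h
      · exact absurd h ht0.ne'
      · exact (sub_eq_zero.1 h).symm
    refine Set.Finite.of_finite_image ?_ hinj
    exact (F.powerset.finite_toSet).subset (by
      rintro _ ⟨w, _, rfl⟩
      exact Finset.mem_coe.2 (Finset.mem_powerset.2 (Finset.filter_subset _ _)))
  have hWeq : convexHull ℝ (W.extremePoints ℝ) = W := by
    have := closure_convexHull_extremePoints hWcomp hWconv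
    rwa [(hfin.isClosed_convexHull ℝ).closure_eq] at this
  have hrep : ∀ w ∈ W, ∃ a : En n → ℝ, (∀ u, 0 ≤ a u) ∧
      (∑ u ∈ hfin.toFinset.erase 0, a u ≤ 1) ∧ w = ∑ u ∈ hfin.toFinset.erase 0, a u • u := by
    intro w hw
    rw [← hWeq, ← hfin.coe_toFinset, Finset.mem_convexHull'] at hw
    obtain ⟨a, ha, ha1, hw⟩ := hw
    refine ⟨fun u => if u ∈ hfin.toFinset then a u else 0, fun u => ?_, ?_, ?_⟩
    · beta_reduce
      split_ifs with h
      · exact ha u h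
      · exact le_rfl
    · rw [← ha1]
      refine (Finset.sum_le_sum_of_subset_of_nonneg (Finset.erase_subset _ _) ?_).trans_eq ?_
      · intro u hu _
        simp only [hu, if_true]; exact ha u hu
      · exact Finset.sum_congr rfl fun u hu => by simp only [hu, if_true]
    · rw [← hw]
      symm
      refine (Finset.sum_subset (Finset.erase_subset 0 _) ?_).trans ?_
      · intro u hu hu'
        have : u = 0 := by
          by_contra h; exact hu' (Finset.mem_erase.2 ⟨h, hu⟩)
        rw [this, smul_zero]
      · exact Finset.sum_congr rfl fun u hu => by simp only [hu, if_true]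
  refine ⟨hfin.toFinset.erase 0, fun u hu => (Finset.mem_erase.1 hu).1, fun w => ?_, fun x hx => ?_⟩
  · -- positive spanning
    obtain ⟨M, hM⟩ := hQcomp.bddAbove_image (f := fun p => inner ℝ w p) (by fun_prop)
    have hMp : 0 < |M| + 1 := by positivity
    obtain ⟨a, ha, _, he⟩ := hrep ((|M| + 1)⁻¹ • w) (by
      intro p hp
      rw [inner_smul_left]
      have := hM ⟨p, subset_convexHull ℝ _ hp, rfl⟩
      simp only [conj_trivial] at *
      rw [inv_mul_le_iff₀ hMp]
      have := le_abs_self M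
      linarith)
    refine ⟨fun u => (|M| + 1) * a u, fun u => mul_nonneg hMp.le (ha u), ?_⟩
    have : w = (|M| + 1) • (|M| + 1)⁻¹ • w := by rw [smul_inv_smul₀ hMp.ne']
    rw [this, he, Finset.smul_sum]
    exact Finset.sum_congr rfl fun u _ => by rw [smul_smul]
  · by_contra hxQ
    obtain ⟨w, r, h1, h2⟩ := sep_point (convex_convexHull ℝ _) hQcomp.isClosed hxQ
    have hr : 0 < r := by simpa using h1 0 h0Q
    obtain ⟨a, ha, ha1, he⟩ := hrep (r⁻¹ • w) (by
      intro p hp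
      rw [inner_smul_left]
      simp only [conj_trivial]
      rw [inv_mul_le_iff₀ hr]
      linarith [h1 p (subset_convexHull ℝ _ hp)])
    have h3 : 1 < inner ℝ (r⁻¹ • w) x := by
      rw [inner_smul_left]; simp only [conj_trivial]
      rw [lt_inv_mul_iff₀ hr]; linarith
    rw [he, sum_inner] at h3
    have : ∑ u ∈ hfin.toFinset.erase 0, inner ℝ (a u • u) x ≤
        ∑ u ∈ hfin.toFinset.erase 0, a u := by
      refine Finset.sum_le_sum fun u hu => ?_
      obtain ⟨p, hp, hle⟩ := hx u hu
      have hu1 := hWQ u (extremePoints_subset (hfin.mem_toFinset.1 (Finset.mem_of_mem_erase hu))) p hp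
      rw [inner_smul_left]; simp only [conj_trivial]
      have := mul_le_mul_of_nonneg_left (hle.trans hu1) (ha u)
      linarith
    linarith

/-- Outer approximation by polytopes. -/
theorem outer_approx {n : ℕ} {C : Set (En n)} (hC : IsCompact C) (hcv : Convex ℝ C)
    (hne : C.Nonempty) {η : ℝ} (hη : 0 < η) :
    ∃ F : Finset (En n), C ⊆ interior (convexHull ℝ (F : Set (En n))) ∧
      convexHull ℝ (F : Set (En n)) ⊆ C + Metric.closedBall (0 : En n) η := by
  classical
  have h : ∀ x : En n, ∃ F : Finset (En n), x ∈ interior (convexHull ℝ (F : Set (En n))) ∧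
      convexHull ℝ (F : Set (En n)) ⊆ Metric.closedBall x η := by
    intro x
    obtain ⟨b, h1, h2⟩ := exists_mem_interior_convexHull_affineBasis (Metric.closedBall_mem_nhds x hη)
    refine ⟨(Set.finite_range b).toFinset, ?_, ?_⟩ <;> simpa
  choose F h1 h2 using h
  obtain ⟨t, htC, ht⟩ := hC.elim_nhds_subcover (fun x => interior (convexHull ℝ (F x : Set (En n))))
    (fun x _ => isOpen_interior.mem_nhds (h1 x))
  refine ⟨t.biUnion F, ?_, ?_⟩
  · refine ht.trans ?_
    refine iUnion₂_subset fun x hx => interior_mono (convexHull_mono ?_)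
    exact_mod_cast Finset.subset_biUnion_of_mem F hx
  · refine convexHull_min ?_ (hcv.add (convex_closedBall 0 η))
    intro p hp
    obtain ⟨x, hx, hpx⟩ := Finset.mem_biUnion.1 (Finset.mem_coe.1 hp)
    have := h2 x (subset_convexHull ℝ _ hpx)
    refine ⟨x, htC x hx, p - x, ?_, by simp⟩
    rw [mem_closedBall_iff_norm] at this ⊢; simpa using this

end PolarSec
end ConvexPaper

namespace ConvexPaper
section GenSec
open MeasureTheory Set Filter Topology
open scoped Pointwise

theorem bdd_of_dir {n : ℕ} {S : Set (En n)} (hb : ∀ w : En n, ∃ M, ∀ x ∈ S, inner ℝ w x ≤ M) :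
    Bornology.IsBounded S := by
  choose M hM using hb
  rw [isBounded_iff_forall_norm_le]
  let e := EuclideanSpace.basisFun (Fin n) ℝ
  refine ⟨∑ i, (|M (e i)| + |M (-(e i))|), fun x hx => ?_⟩
  calc ‖x‖ = ‖∑ i, inner ℝ (e i) x • e i‖ := by rw [e.sum_repr']
    _ ≤ ∑ i, ‖inner ℝ (e i) x • e i‖ := norm_sum_le _ _
    _ ≤ _ := by
      refine Finset.sum_le_sum fun i _ => ?_
      rw [norm_smul, e.norm_eq_one, mul_one, Real.norm_eq_abs, abs_le]
      have h1 := hM (e i) x hx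
      have h2 := hM (-(e i)) x hx
      rw [inner_neg_left] at h2
      have := le_abs_self (M (e i))
      have := le_abs_self (M (-(e i)))
      have := abs_nonneg (M (e i))
      have := abs_nonneg (M (-(e i)))
      constructor <;> linarith

variable {n : ℕ} {ι : Type} [Fintype ι] [DecidableEq ι]

theorem eq_of_span {u : ι → En n} {τ : Finset ι}
    (hs : Submodule.span ℝ (Set.range fun i : τ => u i) = ⊤) {x y : En n}
    (h : ∀ i ∈ τ, inner ℝ (u i) x = inner ℝ (u i) y) : x = y := by
  have : ∀ w : En n, inner ℝ w (x - y) = 0 := by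
    intro w
    have hw : w ∈ Submodule.span ℝ (Set.range fun i : τ => u i) := by rw [hs]; trivial
    induction hw using Submodule.span_induction with
    | mem w hw =>
      obtain ⟨i, rfl⟩ := hw
      simp [inner_sub_right, h i.1 i.2]
    | zero => simp
    | add a b _ _ ha hb => rw [inner_add_left, ha, hb, add_zero]
    | smul c a _ ha => rw [inner_smul_left, ha, mul_zero]
  exact sub_eq_zero.1 (inner_self_eq_zero.1 (this (x - y)))

theorem span_of_li {u : ι → En n} {τ : Finset ι} (hl : LinearIndependent ℝ fun i : τ => u i)
    (hc : τ.card = n) : Submodule.span ℝ (Set.range fun i : τ => u i) = ⊤ := by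
  refine hl.span_eq_top_of_card_eq_finrank' ?_
  simp [hc]

theorem exists_vertmap (u : ι → En n) (τ : Finset ι) : ∃ T : (ι → ℝ) →ₗ[ℝ] En n,
    LinearIndependent ℝ (fun i : τ => u i) → τ.card = n →
    ∀ i ∈ τ, ∀ h, inner ℝ (u i) (T h) = h i := by
  by_cases hl : LinearIndependent ℝ (fun i : τ => u i) ∧ τ.card = n
  swap
  · exact ⟨0, fun h1 h2 => absurd ⟨h1, h2⟩ hl⟩
  obtain ⟨hl, hc⟩ := hl
  let Φ : En n →ₗ[ℝ] (τ → ℝ) := LinearMap.pi fun i => (innerₛₗ ℝ (u i.1) : En n →ₗ[ℝ] ℝ)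
  have hΦ : ∀ x i, Φ x i = inner ℝ (u i.1) x := fun x i => rfl
  have hinj : Function.Injective Φ := fun x y hxy =>
    eq_of_span (span_of_li hl hc) fun i hi => by
      have := congrFun hxy ⟨i, hi⟩
      rwa [hΦ, hΦ] at this
  have hsur : Function.Surjective Φ :=
    (LinearMap.injective_iff_surjective_of_finrank_eq_finrank (by simp [hc])).1 hinj
  obtain ⟨G, hG⟩ := LinearMap.exists_rightInverse_of_surjective Φ (LinearMap.range_eq_top.2 hsur)
  refine ⟨G ∘ₗ LinearMap.funLeft ℝ ℝ Subtype.val, fun _ _ i hi h => ?_⟩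
  have := congrFun (LinearMap.congr_fun hG (LinearMap.funLeft ℝ ℝ (Subtype.val : τ → ι) h)) ⟨i, hi⟩
  rw [LinearMap.comp_apply, hΦ] at this
  exact this

theorem exists_generic (u : ι → En n) : ∃ (Λ : Finset (ι → ℝ)) (ω : ι → ℝ),
    (∀ l ∈ Λ, ∑ i, l i • u i = 0) ∧ (∀ l ∈ Λ, ∑ i, l i * ω i ≠ 0) ∧
    ∀ τ : Finset ι, ¬ LinearIndependent ℝ (fun i : τ => u i) → ∃ l ∈ Λ, ∀ i, i ∉ τ → l i = 0 := by
  classical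
  have h : ∀ τ : Finset ι, ∃ l : ι → ℝ, ¬ LinearIndependent ℝ (fun i : τ => u i) →
      (l ≠ 0 ∧ (∀ i, i ∉ τ → l i = 0) ∧ ∑ i, l i • u i = 0) := by
    intro τ
    by_cases hl : LinearIndependent ℝ (fun i : τ => u i)
    · exact ⟨0, fun h => absurd hl h⟩
    obtain ⟨g, hg, i, hi⟩ := Fintype.not_linearIndependent_iff.1 hl
    refine ⟨fun i => if h : i ∈ τ then g ⟨i, h⟩ else 0, fun _ => ⟨fun h0 => ?_, fun i hi => ?_, ?_⟩⟩
    · have := congrFun h0 i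
      simp at this
      exact hi this
    · simp [hi]
    · rw [← hg, ← Finset.sum_subset (Finset.subset_univ τ), ← Finset.sum_coe_sort]
      · exact Finset.sum_congr rfl fun i _ => by simp
      · intro i _ hi
        simp [hi]
  choose l hl using h
  let dep : Finset (Finset ι) := Finset.univ.filter fun τ => ¬ LinearIndependent ℝ (fun i : τ => u i)
  let φ : (ι → ℝ) → ((ι → ℝ) →ₗ[ℝ] ℝ) := fun l => ∑ i, l i • LinearMap.proj i
  have hφ : ∀ l ω, φ l ω = ∑ i, l i * ω i := fun l ω => by simp [φ]
  let s : Finset (Subspace ℝ (ι → ℝ)) := dep.image fun τ => LinearMap.ker (φ (l τ))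
  have hs : ⊤ ∉ s := by
    intro hs
    obtain ⟨τ, hτ, he⟩ := Finset.mem_image.1 hs
    have hne := (hl τ (Finset.mem_filter.1 hτ).2).1
    apply hne
    funext i
    have : Pi.single i (1 : ℝ) ∈ LinearMap.ker (φ (l τ)) := by rw [he]; trivial
    rw [LinearMap.mem_ker, hφ] at this
    simpa [Pi.single_apply] using this
  have hne := Subspace.biUnion_ne_univ_of_top_notMem hs
  obtain ⟨ω, hω⟩ := (Set.ne_univ_iff_exists_notMem _).1 hne
  refine ⟨dep.image l, ω, ?_, ?_, ?_⟩
  · intro m hm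
    obtain ⟨τ, hτ, rfl⟩ := Finset.mem_image.1 hm
    exact (hl τ (Finset.mem_filter.1 hτ).2).2.2
  · intro m hm h0
    obtain ⟨τ, hτ, rfl⟩ := Finset.mem_image.1 hm
    apply hω
    refine Set.mem_biUnion (x := LinearMap.ker (φ (l τ))) (Finset.mem_image_of_mem _ hτ) ?_
    change φ (l τ) ω = 0
    rw [hφ, h0]
  · intro τ hτ
    have : τ ∈ dep := Finset.mem_filter.2 ⟨Finset.mem_univ _, hτ⟩
    exact ⟨l τ, Finset.mem_image_of_mem _ this, (hl τ hτ).2.1⟩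

end GenSec
end ConvexPaper

namespace ConvexPaper
section GenSec2
open MeasureTheory Set Filter Topology
open scoped Pointwise
variable {n : ℕ} {ι : Type} [Fintype ι] [DecidableEq ι]

/-- LP duality in general position. -/
theorem lp_cov (u : ι → En n) (g : ι → ℝ)
    (hps : ∀ w : En n, ∃ a : ι → ℝ, (∀ i, 0 ≤ a i) ∧ w = ∑ i, a i • u i)
    (hg : ∀ i, 0 < g i)
    (hgen : ∀ (τ : Finset ι) (x : En n), (∀ i ∈ τ, inner ℝ (u i) x = g i) →
      LinearIndependent ℝ (fun i : τ => u i)) (w : En n) :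
    ∃ (x : En n) (τ : Finset ι), (∀ i, inner ℝ (u i) x ≤ g i) ∧ (∀ i ∈ τ, inner ℝ (u i) x = g i) ∧
      LinearIndependent ℝ (fun i : τ => u i) ∧ τ.card = n ∧
      ∃ a : ι → ℝ, (∀ i, 0 ≤ a i) ∧ w = ∑ i ∈ τ, a i • u i := by
  classical
  set P : Set (En n) := {x | ∀ i, inner ℝ (u i) x ≤ g i} with hP
  have hPc : IsClosed P := by
    have : P = ⋂ i, {x | inner ℝ (u i) x ≤ g i} := by ext x; simp [hP]
    rw [this]
    exact isClosed_iInter fun i => isClosed_le (by fun_prop) continuous_const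
  have hPb : Bornology.IsBounded P := by
    refine bdd_of_dir fun w => ?_
    obtain ⟨a, ha, rfl⟩ := hps w
    refine ⟨∑ i, a i * g i, fun x hx => ?_⟩
    rw [sum_inner]
    refine Finset.sum_le_sum fun i _ => ?_
    rw [inner_smul_left]
    exact mul_le_mul_of_nonneg_left (hx i) (by simpa using ha i)
  have hPk : IsCompact P := Metric.isCompact_of_isClosed_isBounded hPc hPb
  have h0P : (0 : En n) ∈ P := fun i => by simpa using (hg i).le
  obtain ⟨x0, hx0, hmax0⟩ := hPk.exists_isMaxOn ⟨0, h0P⟩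
    (f := fun x => inner ℝ w x) (by fun_prop)
  set Mx : Set (En n) := {x | x ∈ P ∧ ∀ y ∈ P, inner ℝ w y ≤ inner ℝ w x} with hMx
  let act : En n → Finset ι := fun x => Finset.univ.filter fun i => inner ℝ (u i) x = g i
  have hact : ∀ x i, i ∈ act x ↔ inner ℝ (u i) x = g i := fun x i => by simp [act]
  obtain ⟨x, hx, hxm⟩ : ∃ x ∈ Mx, ∀ y ∈ Mx, (act y).card ≤ (act x).card := by
    have hfin : (act '' Mx).Finite := Set.toFinite _
    obtain ⟨I, hI, hIm⟩ := Set.exists_max_image (act '' Mx) Finset.card hfin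
      ⟨_, x0, ⟨hx0, fun y hy => hmax0 hy⟩, rfl⟩
    obtain ⟨x, hx, rfl⟩ := hI
    exact ⟨x, hx, fun y hy => hIm _ ⟨y, hy, rfl⟩⟩
  have hxP : x ∈ P := hx.1
  -- no directions orthogonal to active normals
  have hspan0' : ∀ d : En n, d ≠ 0 → 0 ≤ inner ℝ w d → (∀ i ∈ act x, inner ℝ (u i) d = 0) → False := by
    intro d hd hwd hort
    have hj : ∃ j, 0 < inner ℝ (u j) d := by
      by_contra hcon
      push Not at hcon
      obtain ⟨a, ha, hda⟩ := hps d
      have h1 : 0 < inner ℝ d d := by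
        rw [real_inner_self_eq_norm_sq]; positivity
      have h2 : inner ℝ d d ≤ 0 := by
        nth_rewrite 1 [hda]
        rw [sum_inner]
        refine Finset.sum_nonpos fun i _ => ?_
        rw [inner_smul_left]
        exact mul_nonpos_of_nonneg_of_nonpos (by simpa using ha i) (hcon i)
      linarith
    obtain ⟨j0, hj0⟩ := hj
    obtain ⟨j, hj, hjm⟩ := Finset.exists_min_image (Finset.univ.filter fun j => 0 < inner ℝ (u j) d)
      (fun j => (g j - inner ℝ (u j) x) / inner ℝ (u j) d) ⟨j0, by simpa using hj0⟩
    have hjd : 0 < inner ℝ (u j) d := (Finset.mem_filter.1 hj).2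
    set t := (g j - inner ℝ (u j) x) / inner ℝ (u j) d with ht
    have ht0 : 0 ≤ t := div_nonneg (sub_nonneg.2 (hxP j)) hjd.le
    have hin : ∀ i, inner ℝ (u i) (x + t • d) = inner ℝ (u i) x + t * inner ℝ (u i) d := fun i => by
      rw [inner_add_right, inner_smul_right]
    have hx'P : x + t • d ∈ P := by
      intro i
      rw [hin]
      by_cases hi : 0 < inner ℝ (u i) d
      · have := hjm i (by simpa using hi)
        rw [le_div_iff₀ hi] at this
        linarith
      · have := hxP i
        nlinarith
    have hx'M : x + t • d ∈ Mx := by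
      refine ⟨hx'P, fun y hy => (hx.2 y hy).trans ?_⟩
      rw [inner_add_right, inner_smul_right]
      nlinarith
    have hlt : (act x).card < (act (x + t • d)).card := by
      apply Finset.card_lt_card
      rw [Finset.ssubset_iff_of_subset]
      · refine ⟨j, ?_, fun hjx => ?_⟩
        · rw [hact, hin, ht]; field_simp; ring
        · exact hjd.ne' (hort j hjx)
      · intro i hi
        rw [hact, hin, hort i hi, (hact x i).1 hi]; ring
    exact absurd (hxm _ hx'M) (not_le.2 hlt)
  have hspan0 : ∀ d : En n, (∀ i ∈ act x, inner ℝ (u i) d = 0) → d = 0 := by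
    intro d hort
    by_contra hd
    rcases le_total 0 (inner ℝ w d) with h | h
    · exact hspan0' d hd h hort
    · exact hspan0' (-d) (by simpa using hd) (by simpa using h) (fun i hi => by simp [hort i hi])
  have hspan : Submodule.span ℝ (Set.range fun i : act x => u i) = ⊤ := by
    rw [← Submodule.orthogonal_eq_bot_iff, Submodule.eq_bot_iff]
    intro d hd
    refine hspan0 d fun i hi => ?_
    exact hd (u i) (Submodule.subset_span ⟨⟨i, hi⟩, rfl⟩)
  have hli := hgen (act x) x fun i hi => (hact x i).1 hi
  have hcard : (act x).card = n := by
    have := linearIndependent_iff_card_eq_finrank_span.1 hli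
    rw [Set.finrank, hspan, finrank_top, finrank_euclideanSpace_fin] at this
    simpa using this
  refine ⟨x, act x, hxP, fun i hi => (hact x i).1 hi, hli, hcard, ?_⟩
  have hw : w ∈ Submodule.span ℝ (Set.range fun i : act x => u i) := by rw [hspan]; trivial
  obtain ⟨c, hc⟩ := (Submodule.mem_span_range_iff_exists_fun ℝ).1 hw
  obtain ⟨T, hT⟩ := exists_vertmap u (act x)
  have hT := hT hli hcard
  refine ⟨fun i => if h : i ∈ act x then c ⟨i, h⟩ else 0, fun i => ?_, ?_⟩
  swap
  · rw [← hc, ← Finset.sum_coe_sort (act x)]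
    exact Finset.sum_congr rfl fun i _ => by simp
  by_cases hi : i ∈ act x
  swap
  · simp [hi]
  simp only [hi, dif_pos]
  set d := T (-Pi.single i 1) with hd
  have hwd : inner ℝ w d = - c ⟨i, hi⟩ := by
    rw [← hc, sum_inner, Finset.sum_eq_single ⟨i, hi⟩]
    · rw [inner_smul_left, hd, hT i hi]; simp
    · intro j _ hj
      rw [inner_smul_left, hd, hT j.1 j.2]
      have : j.1 ≠ i := fun e => hj (Subtype.ext e)
      simp [Pi.single_apply, this]
    · simp
  have hev : ∀ᶠ ε in 𝓝[>] (0 : ℝ), ∀ j ∈ Finset.univ.filter (fun j => j ∉ act x),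
      inner ℝ (u j) (x + ε • d) < g j := by
    rw [Finset.eventually_all]
    intro j hj
    refine nhdsWithin_le_nhds ?_
    have hcont : Continuous fun ε : ℝ => inner ℝ (u j) (x + ε • d) := by fun_prop
    have hlt : inner ℝ (u j) (x + (0 : ℝ) • d) < g j := by
      rw [zero_smul, add_zero]
      exact lt_of_le_of_ne (hxP j) fun e => (Finset.mem_filter.1 hj).2 ((hact x j).2 e)
    exact (hcont.tendsto 0).eventually (gt_mem_nhds hlt)
  obtain ⟨ε, hε, hε0⟩ := (hev.and self_mem_nhdsWithin).exists
  have hε0 : 0 < ε := hε0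
  have hmem : x + ε • d ∈ P := by
    intro j
    by_cases hj : j ∈ act x
    · rw [inner_add_right, inner_smul_right, hd, hT j hj, (hact x j).1 hj]
      have : (0 : ℝ) ≤ (Pi.single i 1 : ι → ℝ) j := by
        rw [Pi.single_apply]; split_ifs <;> norm_num
      simp only [Pi.neg_apply]
      nlinarith
    · exact (hε j (by simpa using hj)).le
  have := hx.2 _ hmem
  rw [inner_add_right, inner_smul_right, hwd] at this
  nlinarith

/-- A simple fan refining the normal fan of `P(g₀)`. -/
theorem exists_polyData (u : ι → En n) (g0 : ι → ℝ)
    (hps : ∀ w : En n, ∃ a : ι → ℝ, (∀ i, 0 ≤ a i) ∧ w = ∑ i, a i • u i)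
    (hg0 : ∀ i, 0 < g0 i) :
    ∃ D : PolyData n ι, D.u = u ∧ (∃ g ∈ D.Om, ∀ i, 0 < g i) ∧
      (∀ τ ∈ D.𝓑, ∀ i, inner ℝ (u i) (D.vert τ g0) ≤ g0 i) ∧
      ∀ τ ∈ D.𝓑, ∀ x y : En n, (∀ i ∈ τ, inner ℝ (u i) x = inner ℝ (u i) y) → x = y := by
  classical
  obtain ⟨Λ, ω, hΛ0, hΛω, hΛ⟩ := exists_generic u
  choose T hT using exists_vertmap u
  have ev1 : ∀ᶠ ε in 𝓝[>] (0 : ℝ), ∀ l ∈ Λ, ∑ i, l i * (g0 + ε • ω) i ≠ 0 := by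
    rw [Finset.eventually_all]
    intro l hl
    have hω := hΛω l hl
    have e : ∀ ε : ℝ, ∑ i, l i * (g0 + ε • ω) i = ∑ i, l i * g0 i + ε * ∑ i, l i * ω i := fun ε => by
      rw [Finset.mul_sum, ← Finset.sum_add_distrib]
      exact Finset.sum_congr rfl fun i _ => by simp; ring
    simp_rw [e]
    by_cases h0 : ∑ i, l i * g0 i = 0
    · filter_upwards [self_mem_nhdsWithin] with ε hε
      have hε : 0 < ε := hε
      rw [h0, zero_add]
      exact mul_ne_zero hε.ne' hω
    · refine nhdsWithin_le_nhds ?_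
      have hc : Continuous fun ε : ℝ => ∑ i, l i * g0 i + ε * ∑ i, l i * ω i := by fun_prop
      exact (hc.tendsto 0).eventually_ne (by simpa using h0)
  have ev2 : ∀ᶠ ε in 𝓝[>] (0 : ℝ), ∀ i ∈ (Finset.univ : Finset ι), 0 < (g0 + ε • ω) i := by
    rw [Finset.eventually_all]
    intro i _
    refine nhdsWithin_le_nhds ?_
    have hc : Continuous fun ε : ℝ => (g0 + ε • ω) i := by
      simp only [Pi.add_apply, Pi.smul_apply]; fun_prop
    exact (hc.tendsto 0).eventually (lt_mem_nhds (by simpa using hg0 i))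
  have ev3 : ∀ᶠ ε in 𝓝[>] (0 : ℝ), ∀ τ ∈ (Finset.univ : Finset (Finset ι)),
      (∀ i, inner ℝ (u i) (T τ (g0 + ε • ω)) ≤ (g0 + ε • ω) i) →
        ∀ i, inner ℝ (u i) (T τ g0) ≤ g0 i := by
    rw [Finset.eventually_all]
    intro τ _
    by_cases h : ∀ i, inner ℝ (u i) (T τ g0) ≤ g0 i
    · exact Filter.Eventually.of_forall fun _ _ => h
    push Not at h
    obtain ⟨i, hi⟩ := h
    refine nhdsWithin_le_nhds ?_
    have hTc : Continuous (T τ) := LinearMap.continuous_of_finiteDimensional _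
    have hc : Continuous fun ε : ℝ => inner ℝ (u i) (T τ (g0 + ε • ω)) - (g0 + ε • ω) i := by
      refine (continuous_const.inner (hTc.comp (by fun_prop))).sub ?_
      simp only [Pi.add_apply, Pi.smul_apply]; fun_prop
    have := (hc.tendsto 0).eventually (lt_mem_nhds (a := 0) (by
      rw [zero_smul, add_zero]; linarith))
    filter_upwards [this] with ε hε hcon
    exact absurd (hcon i) (not_le.2 (by linarith))
  obtain ⟨ε, h1, h2, h3⟩ := (ev1.and (ev2.and ev3)).exists
  set g := g0 + ε • ω with hg
  have hgpos : ∀ i, 0 < g i := fun i => h2 i (Finset.mem_univ _)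
  have hgen : ∀ (τ : Finset ι) (x : En n), (∀ i ∈ τ, inner ℝ (u i) x = g i) →
      LinearIndependent ℝ (fun i : τ => u i) := by
    intro τ x hx
    by_contra hl
    obtain ⟨l, hl, hl0⟩ := hΛ τ hl
    apply h1 l hl
    have : inner ℝ (∑ i, l i • u i) x = ∑ i, l i * g i := by
      rw [sum_inner]
      refine Finset.sum_congr rfl fun i _ => ?_
      rw [inner_smul_left]
      by_cases hi : i ∈ τ
      · rw [hx i hi]; rfl
      · rw [hl0 i hi]; simp
    rw [← this, hΛ0 l hl, inner_zero_left]
  let 𝓑 : Finset (Finset ι) := Finset.univ.filter fun τ => τ.card = n ∧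
    LinearIndependent ℝ (fun i : τ => u i) ∧ ∀ i, inner ℝ (u i) (T τ g) ≤ g i
  have hB : ∀ τ, τ ∈ 𝓑 ↔ τ.card = n ∧ LinearIndependent ℝ (fun i : τ => u i) ∧
    ∀ i, inner ℝ (u i) (T τ g) ≤ g i := fun τ => by simp [𝓑]
  refine ⟨⟨u, 𝓑, fun τ hτ => ((hB τ).1 hτ).1, T, fun τ hτ i hi h =>
    hT τ ((hB τ).1 hτ).2.1 ((hB τ).1 hτ).1 i hi h, fun w => ?_⟩, rfl, ⟨g, ?_, hgpos⟩, ?_, ?_⟩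
  · obtain ⟨x, τ, hx, hxτ, hl, hc, a, ha, hw⟩ := lp_cov u g hps hgpos hgen w
    refine ⟨τ, (hB τ).2 ⟨hc, hl, ?_⟩, a, ha, hw⟩
    have : T τ g = x := eq_of_span (span_of_li hl hc) fun i hi => by
      rw [hT τ hl hc i hi, hxτ i hi]
    rw [this]; exact hx
  · intro τ hτ i hi
    have hτ' := (hB τ).1 hτ
    change inner ℝ (u i) (T τ g) < g i
    refine lt_of_le_of_ne (hτ'.2.2 i) fun he => ?_
    have := hgen (insert i τ) (T τ g) (fun j hj => by
      rcases Finset.mem_insert.1 hj with rfl | hj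
      · exact he
      · exact hT τ hτ'.2.1 hτ'.1 j hj g)
    have := this.fintype_card_le_finrank
    rw [finrank_euclideanSpace_fin, Fintype.card_coe, Finset.card_insert_of_notMem hi, hτ'.1] at this
    omega
  · intro τ hτ
    exact h3 τ (Finset.mem_univ _) ((hB τ).1 hτ).2.2
  · intro τ hτ x y h
    exact eq_of_span (span_of_li ((hB τ).1 hτ).2.1 ((hB τ).1 hτ).1) h

end GenSec2
end ConvexPaper

namespace ConvexPaper
section ApproxSec
open MeasureTheory Set Filter Topology
open scoped Pointwise

theorem exists_approx {n : ℕ} {J : Type} [Fintype J] [Nonempty J] (C : J → Set (En n))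
    (hC : ∀ j, IsCompact (C j)) (hcv : ∀ j, Convex ℝ (C j)) (hne : ∀ j, (C j).Nonempty)
    {η : ℝ} (hη : 0 < η) :
    ∃ (ι : Type) (_ : Fintype ι) (_ : DecidableEq ι) (D : PolyData n ι) (c : J → ι → ℝ),
      ∀ j, c j ∈ D.Om ∧ C j ⊆ D.P (c j) ∧ D.P (c j) ⊆ C j + Metric.closedBall (0 : En n) η := by
  classical
  choose F hF1 hF2 using fun j => outer_approx (hC j) (hcv j) (hne j) (half_pos hη)
  choose k hk using hne
  set K : J → Set (En n) := fun j => convexHull ℝ (F j : Set (En n)) with hK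
  have hKc : ∀ j, IsCompact (K j) := fun j => (F j).finite_toSet.isCompact_convexHull ℝ
  have hKcv : ∀ j, Convex ℝ (K j) := fun j => convex_convexHull ℝ _
  have hkK : ∀ j, k j ∈ interior (K j) := fun j => hF1 j (hk j)
  obtain ⟨j0⟩ := ‹Nonempty J›
  set q := ∑ j, k j with hq
  have hqint : q ∈ interior (∑ j, K j) := by
    rw [hq, ← Finset.add_sum_erase _ k (Finset.mem_univ j0), ← Finset.add_sum_erase _ K (Finset.mem_univ j0)]
    refine subset_interior_add_left (Set.add_mem_add (hkK j0) ?_)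
    exact Set.finsetSum_mem_finsetSum _ _ _ fun j _ => interior_subset (hkK j)
  set F' : Finset (En n) := ∑ j, F j + {-q} with hF'
  have hF'c : convexHull ℝ (F' : Set (En n)) = ∑ j, K j + {-q} := by
    rw [hF', Finset.coe_add, Finset.coe_sum, convexHull_add, convexHull_sum, Finset.coe_singleton,
      convexHull_singleton]
  have h0 : (0 : En n) ∈ interior (convexHull ℝ (F' : Set (En n))) := by
    rw [hF'c]
    have := subset_interior_add_left (t := {-q}) (Set.add_mem_add hqint (Set.mem_singleton (-q)))
    simpa using this
  obtain ⟨U, hU0, hUps, hUP⟩ := polar_fin F' h0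
  have hmax : ∀ j (u : U), ∃ m ∈ K j, ∀ x ∈ K j, inner ℝ u.1 x ≤ inner ℝ u.1 m := fun j u => by
    obtain ⟨m, hm, hm'⟩ := (hKc j).exists_isMaxOn ⟨k j, interior_subset (hkK j)⟩
      (f := fun x => inner ℝ u.1 x) (by fun_prop)
    exact ⟨m, hm, fun x hx => hm' hx⟩
  choose mm hmK hmm using hmax
  let h : J → U → ℝ := fun j u => inner ℝ u.1 (mm j u)
  let g0 : U → ℝ := fun u => ∑ j, h j u - inner ℝ u.1 q
  have hsup : ∀ (u : U) x, x ∈ ∑ j, K j → inner ℝ u.1 x ≤ ∑ j, h j u := by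
    intro u x hx
    obtain ⟨v, hv, rfl⟩ := (Set.mem_fintype_sum _ _).1 hx
    rw [inner_sum]
    exact Finset.sum_le_sum fun j _ => hmm j u _ (hv j)
  have hg0 : ∀ u, 0 < g0 u := by
    intro u
    have hu0 : u.1 ≠ 0 := hU0 u.1 u.2
    obtain ⟨r, hr, hball⟩ := Metric.isOpen_iff.1 isOpen_interior q hqint
    have hn : 0 < ‖u.1‖ := norm_pos_iff.2 hu0
    have hm : q + (r / (2 * ‖u.1‖)) • u.1 ∈ ∑ j, K j := by
      apply interior_subset (hball _)
      rw [mem_ball_iff_norm, add_sub_cancel_left, norm_smul, Real.norm_of_nonneg (by positivity)]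
      have : r / (2 * ‖u.1‖) * ‖u.1‖ = r / 2 := by field_simp
      rw [this]; linarith
    have := hsup u _ hm
    rw [inner_add_right, inner_smul_right, real_inner_self_eq_norm_sq] at this
    have hp : 0 < r / (2 * ‖u.1‖) * ‖u.1‖ ^ 2 := by positivity
    simp only [g0]; linarith
  have hps : ∀ w : En n, ∃ a : U → ℝ, (∀ i, 0 ≤ a i) ∧ w = ∑ i, a i • i.1 := by
    intro w
    obtain ⟨a, ha, hw⟩ := hUps w
    refine ⟨fun u => a u.1, fun u => ha _, ?_⟩
    rw [hw, ← Finset.sum_coe_sort]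
  obtain ⟨D, hDu, ⟨g, hgO, hgp⟩, hDv, hDeq⟩ := exists_polyData (fun u : U => u.1) g0 hps hg0
  have hDu' : ∀ i, D.u i = i.1 := fun i => congrFun hDu i
  have hA : ∀ τ ∈ D.𝓑, ∀ j, D.vert τ (h j) ∈ K j := by
    intro τ hτ
    have hmem : D.vert τ g0 ∈ convexHull ℝ (F' : Set (En n)) := by
      refine hUP _ fun u hu => ⟨∑ j, mm j ⟨u, hu⟩ + -q, ?_, ?_⟩
      · rw [hF'c]
        exact Set.add_mem_add (Set.finsetSum_mem_finsetSum _ _ _ fun j _ => hmK j _)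
          (Set.mem_singleton _)
      · refine (hDv τ hτ ⟨u, hu⟩).trans_eq ?_
        rw [inner_add_right, inner_neg_right, inner_sum]; rfl
    rw [hF'c] at hmem
    obtain ⟨s, hs, r, hr, hsum⟩ := Set.mem_add.1 hmem
    rw [Set.mem_singleton_iff] at hr
    obtain ⟨v, hv, rfl⟩ := (Set.mem_fintype_sum _ _).1 hs
    intro j
    have : D.vert τ (h j) = v j := by
      refine hDeq τ hτ _ _ fun i hi => ?_
      have e1 : ∀ h, inner ℝ i.1 (D.vert τ h) = h i := fun h => by
        rw [← hDu' i]; exact D.vert_spec τ hτ i hi h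
      rw [e1]
      have e2 := e1 g0
      rw [← hsum, hr, inner_add_right, inner_neg_right, inner_sum] at e2
      have e3 : ∑ j, inner ℝ i.1 (v j) = ∑ j, h j i := by simp only [g0] at e2; linarith
      have := (Finset.sum_eq_sum_iff_of_le (fun j _ => hmm j i (v j) (hv j))).1 e3 j (Finset.mem_univ _)
      exact this.symm
    rw [this]; exact hv j
  set R := ∑ τ ∈ D.𝓑, ‖D.vert τ g‖ with hR
  have hR0 : 0 ≤ R := Finset.sum_nonneg fun _ _ => norm_nonneg _
  set δ := (η / 2) / (R + 1) with hδ
  have hδ0 : 0 < δ := by positivity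
  have hsmall : ∀ τ ∈ D.𝓑, ‖δ • D.vert τ g‖ ≤ η / 2 := by
    intro τ hτ
    rw [norm_smul, Real.norm_of_nonneg hδ0.le, hδ, div_mul_eq_mul_div, div_le_iff₀ (by linarith)]
    have : ‖D.vert τ g‖ ≤ R :=
      Finset.single_le_sum (f := fun τ => ‖D.vert τ g‖) (fun _ _ => norm_nonneg _) hτ
    nlinarith
  refine ⟨U, inferInstance, inferInstance, D, fun j => h j + δ • g, fun j => ⟨?_, ?_, ?_⟩⟩
  · intro τ hτ i hi
    rw [map_add, map_smul, inner_add_right, inner_smul_right]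
    have h1 := hmm j i _ (hA τ hτ j)
    rw [← hDu' i] at h1
    have h2 := mul_lt_mul_of_pos_left (hgO τ hτ i hi) hδ0
    have h3 : h j i = inner ℝ (D.u i) (mm j i) := by rw [hDu' i]
    simp only [Pi.add_apply, Pi.smul_apply, smul_eq_mul]
    rw [h3]; linarith
  · intro x hx i
    have h1 := hmm j i x (interior_subset (hF1 j hx))
    have h2 := mul_pos hδ0 (hgp i)
    rw [hDu' i]
    simp only [Pi.add_apply, Pi.smul_apply, smul_eq_mul]
    linarith
  · have hsub : D.P (h j + δ • g) ⊆ K j + Metric.closedBall (0 : En n) (η / 2) := by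
      intro x hx
      by_contra hcon
      obtain ⟨w, r, hw1, hw2⟩ := sep_point ((hKcv j).add (convex_closedBall 0 (η / 2)))
        ((hKc j).add (isCompact_closedBall 0 (η / 2))).isClosed hcon
      obtain ⟨τ, hτ, hx'⟩ := D.exists_vert w
      have h1 := hx' _ x hx
      have h2 := hw1 (D.vert τ (h j + δ • g)) (by
        rw [map_add, map_smul]
        exact Set.add_mem_add (hA τ hτ j) (by simpa using hsmall τ hτ))
      linarith
    refine hsub.trans ?_
    refine (Set.add_subset_add_right (hF2 j)).trans ?_
    rw [add_assoc]
    refine Set.add_subset_add_left ?_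
    rintro _ ⟨a, ha, b, hb, rfl⟩
    rw [mem_closedBall_zero_iff] at *
    exact (norm_add_le a b).trans (by linarith)

/-- Minkowski additivity on the type cone. -/
theorem PolyData.P_add {n : ℕ} {ι : Type} [Fintype ι] [DecidableEq ι] {D : PolyData n ι}
    {h k : ι → ℝ} (hh : h ∈ D.Om) (hk : k ∈ D.Om) : D.P (h + k) = D.P h + D.P k := by
  apply Set.Subset.antisymm
  · intro x hx
    by_contra hcon
    obtain ⟨w, r, hw1, hw2⟩ := sep_point ((D.P_convex h).add (D.P_convex k))
      ((D.P_compact h).add (D.P_compact k)).isClosed hcon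
    obtain ⟨τ, hτ, hx'⟩ := D.exists_vert w
    have h1 := hx' _ x hx
    have h2 := hw1 (D.vert τ (h + k)) (by
      rw [map_add]
      exact Set.add_mem_add (D.vert_mem hh hτ) (D.vert_mem hk hτ))
    linarith
  · rintro _ ⟨a, ha, b, hb, rfl⟩ i
    rw [inner_add_right]
    exact add_le_add (ha i) (hb i)

theorem PolyData.P_sum {n : ℕ} {ι : Type} [Fintype ι] [DecidableEq ι] {D : PolyData n ι}
    {κ : Type*} [DecidableEq κ] (h : κ → ι → ℝ) (hh : ∀ a, h a ∈ D.Om) (S : Finset κ) (hS : S.Nonempty) :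
    D.P (∑ a ∈ S, h a) = ∑ a ∈ S, D.P (h a) ∧ ∑ a ∈ S, h a ∈ D.Om := by
  induction hS using Finset.Nonempty.cons_induction with
  | singleton a => simp [hh a]
  | cons a S ha _ ih =>
    rw [Finset.sum_cons, Finset.sum_cons, D.P_add (hh a) ih.2, ih.1]
    exact ⟨rfl, D.Om_add (hh a) ih.2⟩

end ApproxSec
end ConvexPaper

namespace ConvexPaper
section LimSec
open MeasureTheory Set Filter Topology
open scoped Pointwise

/-- Monomial given by a list of indices. -/
noncomputable def xl {J : Type*} (l : List J) : MvPolynomial J ℝ := (l.map MvPolynomial.X).prod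

/-- Linear forms. -/
noncomputable def Vx (J : Type*) : Submodule ℝ (MvPolynomial J ℝ) :=
  Submodule.span ℝ (Set.range MvPolynomial.X)

/-- Lorentzian functionals of degree `d`. -/
def LC {J : Type*} (d : ℕ) (ψ : MvPolynomial J ℝ →ₗ[ℝ] ℝ) : Prop :=
  (∀ l : List J, l.length = d → 0 < ψ (xl l)) ∧
    ∀ l : List J, l.length + 2 = d → Lor (Vx J) ψ (xl l)

theorem vol_sandwich {n : ℕ} {J : Type} (C : J → Set (En n)) (hC : ∀ j, IsCompact (C j))
    (hne : ∀ j, (C j).Nonempty)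
    (P : ℕ → J → Set (En n)) (h1 : ∀ ν j, C j ⊆ P ν j)
    (h2 : ∀ ν j, P ν j ⊆ C j + Metric.closedBall (0 : En n) (1 / ((ν : ℝ) + 1)))
    (f : ℕ → J) (S : Finset ℕ) :
    Tendsto (fun ν => (volume (∑ i ∈ S, P ν (f i))).toReal) atTop
      (𝓝 (volume (∑ i ∈ S, C (f i))).toReal) := by
  set Q := ∑ i ∈ S, C (f i) with hQ
  have hQc : IsCompact Q := by
    clear_value Q
    subst hQ
    induction S using Finset.induction_on with
    | empty => simpa using isCompact_singleton
    | insert a S ha ih => rw [Finset.sum_insert ha]; exact (hC _).add ih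
  have hsub : ∀ ν, ∑ i ∈ S, P ν (f i) ⊆ Metric.cthickening ((S.card : ℝ) * (1 / ((ν : ℝ) + 1))) Q := by
    intro ν x hx
    obtain ⟨g, hg, rfl⟩ := (Set.mem_finsetSum _ _ _).1 hx
    have : ∀ i, ∃ c b : En n, (i ∈ S → c ∈ C (f i)) ∧ (i ∈ S → ‖b‖ ≤ 1 / ((ν : ℝ) + 1)) ∧
        (i ∈ S → g i = c + b) := by
      intro i
      by_cases hi : i ∈ S
      · obtain ⟨c, hc, b, hb, hcb⟩ := h2 ν _ (hg hi)
        exact ⟨c, b, fun _ => hc, fun _ => by simpa using hb, fun _ => hcb.symm⟩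
      · exact ⟨0, 0, fun h => absurd h hi, fun h => absurd h hi, fun h => absurd h hi⟩
    choose c b hc hb hcb using this
    refine Metric.mem_cthickening_of_dist_le _ (∑ i ∈ S, c i) _ _
      (Set.finsetSum_mem_finsetSum _ _ _ fun i hi => hc i hi) ?_
    rw [Finset.sum_congr rfl hcb, Finset.sum_add_distrib, dist_eq_norm, add_sub_cancel_left]
    refine (norm_sum_le _ _).trans ((Finset.sum_le_sum hb).trans ?_)
    simp
  have hlim : Tendsto (fun ν : ℕ => volume (Metric.cthickening ((S.card : ℝ) * (1 / ((ν : ℝ) + 1))) Q))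
      atTop (𝓝 (volume Q)) := by
    refine (tendsto_measure_cthickening_of_isCompact hQc).comp ?_
    have := (tendsto_one_div_add_atTop_nhds_zero_nat (𝕜 := ℝ)).const_mul (S.card : ℝ)
    simpa using this
  have : Tendsto (fun ν => volume (∑ i ∈ S, P ν (f i))) atTop (𝓝 (volume Q)) :=
    tendsto_of_tendsto_of_tendsto_of_le_of_le tendsto_const_nhds hlim
      (fun ν => measure_mono (Set.finsetSum_subset_finsetSum _ _ _ fun i _ => h1 ν _))
      (fun ν => measure_mono (hsub ν))
  exact (ENNReal.tendsto_toReal hQc.measure_lt_top.ne).comp this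

theorem psi_prod {n : ℕ} {ι : Type} [Fintype ι] [DecidableEq ι] {D : PolyData n ι}
    {ψ : MvPolynomial ι ℝ →ₗ[ℝ] ℝ}
    (hψ : ∀ h ∈ D.Om, ψ (lf h ^ n) = n.factorial * (volume (D.P h)).toReal)
    (hn : n ≠ 0) (c : ℕ → ι → ℝ) (hc : ∀ i, c i ∈ D.Om) :
    ψ (∏ i ∈ Finset.range n, lf (c i)) =
    ∑ S ∈ (Finset.range n).powerset.filter (fun S => S.Nonempty),
      (-1 : ℝ) ^ (n - S.card) * (volume (∑ i ∈ S, D.P (c i))).toReal := by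
  have h := (POL (Finset.range n) fun i => lf (c i)).2
  rw [Finset.card_range] at h
  have h2 := congrArg ψ h
  rw [map_sum] at h2
  have e1 : ((-1 : MvPolynomial ι ℝ) ^ n * (n.factorial : MvPolynomial ι ℝ) * ∏ i ∈ Finset.range n, lf (c i))
      = ((-1 : ℝ) ^ n * n.factorial) • ∏ i ∈ Finset.range n, lf (c i) := by
    rw [MvPolynomial.smul_eq_C_mul]; simp
  rw [e1, map_smul, smul_eq_mul] at h2
  have h3 : ∑ S ∈ (Finset.range n).powerset, ψ ((-1) ^ S.card * (∑ j ∈ S, lf (c j)) ^ n) =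
      ∑ S ∈ (Finset.range n).powerset.filter (fun S => S.Nonempty),
        ((-1 : ℝ) ^ n * n.factorial) *
        ((-1 : ℝ) ^ (n - S.card) * (volume (∑ i ∈ S, D.P (c i))).toReal) := by
    rw [Finset.sum_filter]
    refine Finset.sum_congr rfl fun S hS => ?_
    split_ifs with hS'
    · obtain ⟨h4, h5⟩ := PolyData.P_sum c hc S hS'
      have e2 : ((-1 : MvPolynomial ι ℝ) ^ S.card * (∑ j ∈ S, lf (c j)) ^ n)
        = ((-1 : ℝ) ^ S.card) • (∑ j ∈ S, lf (c j)) ^ n := by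
        rw [MvPolynomial.smul_eq_C_mul]; simp
      rw [e2, map_smul, ← lf_sum, hψ _ h5, h4, smul_eq_mul]
      have hcard : S.card ≤ n := by
        simpa using Finset.card_le_card (Finset.mem_powerset.1 hS)
      have e3 : (-1 : ℝ) ^ S.card = (-1) ^ n * (-1) ^ (n - S.card) := by
        rw [← pow_add]
        obtain ⟨t, rfl⟩ := Nat.exists_eq_add_of_le hcard
        rw [Nat.add_sub_cancel_left, show S.card + t + t = S.card + 2 * t by ring, pow_add, pow_mul]
        simp
      rw [e3]; ring
    · rw [Finset.not_nonempty_iff_eq_empty.1 hS']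
      simp [hn]
  rw [h3, ← Finset.mul_sum] at h2
  refine (mul_left_cancel₀ ?_ h2).symm
  exact mul_ne_zero (pow_ne_zero _ (by norm_num)) (by exact_mod_cast n.factorial_ne_zero)

theorem exists_seq {n : ℕ} (hn : n ≠ 0) {J : Type} [Fintype J] [Nonempty J] (C : J → Set (En n))
    (hC : ∀ j, IsCompact (C j)) (hcv : ∀ j, Convex ℝ (C j)) (hne : ∀ j, (C j).Nonempty) :
    ∃ ψ : ℕ → MvPolynomial J ℝ →ₗ[ℝ] ℝ, (∀ ν, LC n (ψ ν)) ∧ ∀ l : List J, l.length = n →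
      Tendsto (fun ν => ψ ν (xl l)) atTop (𝓝 (mixedVol n (l.map C))) := by
  classical
  have key : ∀ ν : ℕ, ∃ (P : J → Set (En n)) (ψ : MvPolynomial J ℝ →ₗ[ℝ] ℝ),
      (∀ j, C j ⊆ P j) ∧
      (∀ j, P j ⊆ C j + Metric.closedBall (0 : En n) (1 / ((ν : ℝ) + 1))) ∧ LC n ψ ∧
      ∀ l : List J, l.length = n → ∀ f : ℕ → J, (∀ i (hi : i < l.length), f i = l[i]) →
        ψ (xl l) = ((n.factorial : ℝ))⁻¹ *
          ∑ S ∈ (Finset.range n).powerset.filter (fun S => S.Nonempty),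
            (-1 : ℝ) ^ (n - S.card) * (volume (∑ i ∈ S, P (f i))).toReal := by
    intro ν
    obtain ⟨ι, _, _, D, c, hc⟩ := exists_approx C hC hcv hne (η := 1 / ((ν : ℝ) + 1)) (by positivity)
    obtain ⟨j0⟩ := ‹Nonempty J›
    obtain ⟨τ, hτ, -⟩ := D.cov 0
    have hι : Nonempty ι := by
      have h1 := D.card_eq τ hτ
      have : τ.Nonempty := by rw [← Finset.card_pos]; omega
      exact ⟨this.choose⟩
    have hO : D.Om.Nonempty := ⟨_, (hc j0).1⟩
    obtain ⟨ψ, hψ⟩ := D.exists_psi hO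
    have hf : D.face ∅ := ⟨τ, hτ, Finset.empty_subset _⟩
    let ae : MvPolynomial J ℝ →ₐ[ℝ] MvPolynomial ι ℝ := MvPolynomial.aeval fun j => lf (c j)
    have hae : ∀ l : List J, ae (xl l) = lp (l.map c) := by
      intro l
      simp only [xl, lp, map_list_prod, List.map_map]
      congr 1
      refine List.map_congr_left fun j _ => ?_
      simp [ae]
    have hxp : xp (∅ : Finset ι) = (1 : MvPolynomial ι ℝ) := by simp [xp]
    have hV : ∀ g ∈ Vx J, ae g ∈ Vl ι := by
      intro g hg
      have : Vx J ≤ (Vl ι).comap ae.toLinearMap := by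
        rw [Vx, Submodule.span_le]
        rintro _ ⟨j, rfl⟩
        exact ⟨c j, by simp [ae, lfL]⟩
      exact this hg
    have hfac : (0 : ℝ) < (n.factorial : ℝ)⁻¹ := by positivity
    refine ⟨fun j => D.P (c j), (n.factorial : ℝ)⁻¹ • ψ ∘ₗ ae.toLinearMap, fun j => (hc j).2.1,
      fun j => (hc j).2.2, ⟨?_, ?_⟩, ?_⟩
    · intro l hl
      have := D.pos hO hψ (l.map c) (by simpa using fun j _ => (hc j).1) ∅ hf (by simpa using hl)
      rw [hxp, one_mul, ← hae] at this
      exact mul_pos hfac this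
    · intro l hl
      have := D.trickle hO hψ (l.map c) (by simpa using fun j _ => (hc j).1) ∅ hf (by simpa using hl)
      rw [hxp, one_mul, ← hae] at this
      intro g hg h hh hpos
      simp only [LinearMap.smul_apply, LinearMap.comp_apply, AlgHom.toLinearMap_apply, map_mul,
        smul_eq_mul] at hpos ⊢
      have := this _ (hV g hg) _ (hV h hh) (by
        by_contra hcon
        push Not at hcon
        nlinarith)
      have h3 := mul_le_mul_of_nonneg_left this (mul_pos hfac hfac).le
      nlinarith
    · intro l hl f hf
      have h1 := psi_prod hψ hn (fun i => c (f i)) (fun i => (hc _).1)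
      rw [← h1]
      simp only [LinearMap.smul_apply, LinearMap.comp_apply, AlgHom.toLinearMap_apply, hae, smul_eq_mul]
      congr 2
      rw [lp, ← hl, List.map_map, Finset.prod_range, ← List.prod_ofFn]
      congr 1
      refine List.ext_getElem (by simp) fun i h1 h2 => ?_
      simp [hf i (by simpa using h2)]
  choose P ψ h1 h2 h3 h4 using key
  refine ⟨ψ, h3, fun l hl => ?_⟩
  obtain ⟨j0⟩ := ‹Nonempty J›
  have hf : ∀ i (hi : i < l.length), (fun i => l.getD i j0) i = l[i] := fun i hi => by
    simp [hi]
  simp only [h4 _ l hl _ hf]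
  unfold mixedVol
  refine Tendsto.const_mul _ (tendsto_finsetSum _ fun S hS => Tendsto.const_mul _ ?_)
  have hlim := vol_sandwich C hC hne P h1 h2 (fun i => l.getD i j0) S
  have : ∑ i ∈ S, (l.map C).getD i 0 = ∑ i ∈ S, C (l.getD i j0) := by
    refine Finset.sum_congr rfl fun i hi => ?_
    have : i < l.length := by
      have := Finset.mem_powerset.1 (Finset.mem_filter.1 hS).1 hi
      simpa [hl] using this
    simp [this]
  rw [this]
  exact hlim

end LimSec
end ConvexPaper

namespace ConvexPaper
section SchurDet
open MvPolynomial

/-- Complete homogeneous polynomials in the first `c` variables, integer index. -/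
noncomputable def hz : ℕ → ℤ → MvPolynomial ℕ ℝ
  | 0, k => if k = 0 then 1 else 0
  | c + 1, k => ∑ j ∈ Finset.range (k.toNat + 1), X c ^ j * hz c (k - j)

theorem hz_neg (c : ℕ) {k : ℤ} (hk : k < 0) : hz c k = 0 := by
  induction c generalizing k with
  | zero => simp [hz, hk.ne]
  | succ c ih =>
    rw [hz]
    refine Finset.sum_eq_zero fun j _ => ?_
    rw [ih (by omega), mul_zero]

theorem hz_zero (c : ℕ) : hz c 0 = 1 := by
  induction c with
  | zero => simp [hz]
  | succ c ih => simp [hz, ih]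

theorem hz_succ (c : ℕ) (k : ℤ) : hz (c + 1) k = hz c k + X c * hz (c + 1) (k - 1) := by
  rcases lt_or_ge k 1 with hk | hk
  · rw [hz_neg (c + 1) (show k - 1 < 0 by omega)]
    rcases lt_or_ge k 0 with h | h
    · rw [hz_neg _ h, hz_neg _ h]; simp
    · obtain rfl : k = 0 := by omega
      simp [hz_zero]
  · obtain ⟨n, rfl⟩ : ∃ n : ℕ, k = n + 1 := ⟨(k - 1).toNat, by omega⟩
    rw [hz, hz, show ((n : ℤ) + 1).toNat = n + 1 by omega, Finset.sum_range_succ',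
      show ((n : ℤ) + 1 - 1).toNat = n by omega, Finset.mul_sum, add_comm]
    congr 1
    · simp
    · refine Finset.sum_congr rfl fun j _ => ?_
      rw [show (n : ℤ) + 1 - 1 - j = n + 1 - ((j + 1 : ℕ) : ℤ) by push_cast; ring]
      ring

/-- Signed elementary symmetric polynomials. -/
noncomputable def wz : ℕ → ℕ → MvPolynomial ℕ ℝ
  | 0, j => if j = 0 then 1 else 0
  | c + 1, 0 => wz c 0
  | c + 1, j + 1 => wz c (j + 1) - X c * wz c j

theorem wz_zero (c : ℕ) : wz c 0 = 1 := by
  induction c with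
  | zero => simp [wz]
  | succ c ih => simp [wz, ih]

theorem wz_big (c : ℕ) {j : ℕ} (h : c < j) : wz c j = 0 := by
  induction c generalizing j with
  | zero => simp [wz]; omega
  | succ c ih =>
    obtain ⟨j, rfl⟩ : ∃ i, j = i + 1 := ⟨j - 1, by omega⟩
    rw [wz, ih (by omega), ih (by omega)]; simp

theorem wz_hz (c m : ℕ) (hm : c ≤ m) (k : ℤ) :
    ∑ j ∈ Finset.range (m + 1), wz c j * hz c (k - j) = if k = 0 then 1 else 0 := by
  induction c generalizing m k with
  | zero =>
    rw [Finset.sum_eq_single 0]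
    · simp [wz, hz]
    · intro j _ hj; simp [wz, hj]
    · simp
  | succ c ih =>
    obtain ⟨m, rfl⟩ : ∃ i, m = i + 1 := ⟨m - 1, by omega⟩
    rw [← ih m (by omega) k, Finset.sum_range_succ']
    simp only [wz, sub_mul, Finset.sum_sub_distrib]
    have h1 : ∑ j ∈ Finset.range (m + 1), wz c (j + 1) * hz (c + 1) (k - ((j + 1 : ℕ) : ℤ)) +
        wz c 0 * hz (c + 1) (k - ((0 : ℕ) : ℤ)) =
        ∑ j ∈ Finset.range (m + 1), wz c j * hz (c + 1) (k - j) := by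
      rw [← Finset.sum_range_succ' (fun j => wz c j * hz (c + 1) (k - (j : ℤ))),
        Finset.sum_range_succ, wz_big c (by omega)]
      simp
    rw [sub_add_eq_add_sub, h1, ← Finset.sum_sub_distrib]
    refine Finset.sum_congr rfl fun j _ => ?_
    rw [hz_succ c (k - j), show k - ((j + 1 : ℕ) : ℤ) = k - j - 1 by push_cast; ring]
    ring

/-- State determinants. -/
noncomputable def Zd (e c k : ℕ) (d : ℕ → ℤ) : MvPolynomial ℕ ℝ :=
  (Matrix.of fun i j : Fin e =>
    if (i : ℕ) < k then hz (c + 1) (d i - (j : ℕ)) else hz c (d i - (j : ℕ))).det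

/-- Lowering the `i`-th entry. -/
def dl (d : ℕ → ℤ) (i : ℕ) : ℕ → ℤ := Function.update d i (d i - 1)

theorem dl_same (d : ℕ → ℤ) (i : ℕ) : dl d i i = d i - 1 := by simp [dl]
theorem dl_ne (d : ℕ → ℤ) {i j : ℕ} (h : j ≠ i) : dl d i j = d j := by simp [dl, h]

theorem Zd_congr {e c k : ℕ} {d d' : ℕ → ℤ} (h : ∀ i < e, d i = d' i) : Zd e c k d = Zd e c k d' := by
  unfold Zd
  congr 1
  ext i j : 2
  simp only [Matrix.of_apply]
  rw [h i i.2]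

theorem Zd_rec {e c k : ℕ} (hk : k < e) (d : ℕ → ℤ) :
    Zd e c (k + 1) d = Zd e c k d + X c * Zd e c (k + 1) (dl d k) := by
  set M := (Matrix.of fun i j : Fin e =>
    if (i : ℕ) < k then hz (c + 1) (d i - (j : ℕ)) else hz c (d i - (j : ℕ))) with hM
  have h1 : Zd e c (k + 1) d = (M.updateRow ⟨k, hk⟩ fun j => hz (c + 1) (d k - (j : ℕ))).det := by
    unfold Zd; congr 1; ext i j : 2
    by_cases h : i = ⟨k, hk⟩
    · subst h; simp
    · have : (i : ℕ) ≠ k := fun h' => h (Fin.ext h')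
      rw [Matrix.updateRow_ne h, hM]
      simp only [Matrix.of_apply]
      have : (i : ℕ) < k + 1 ↔ (i : ℕ) < k := by omega
      simp only [this]
  have h2 : Zd e c k d = (M.updateRow ⟨k, hk⟩ fun j => hz c (d k - (j : ℕ))).det := by
    unfold Zd; congr 1; ext i j : 2
    by_cases h : i = ⟨k, hk⟩
    · subst h; simp
    · rw [Matrix.updateRow_ne h, hM]
  have h3 : Zd e c (k + 1) (dl d k) =
      (M.updateRow ⟨k, hk⟩ fun j => hz (c + 1) (d k - (j : ℕ) - 1)).det := by
    unfold Zd; congr 1; ext i j : 2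
    by_cases h : i = ⟨k, hk⟩
    · subst h; simp [dl_same, sub_right_comm]
    · have : (i : ℕ) ≠ k := fun h' => h (Fin.ext h')
      rw [Matrix.updateRow_ne h, hM]
      simp only [Matrix.of_apply, dl_ne d this]
      have : (i : ℕ) < k + 1 ↔ (i : ℕ) < k := by omega
      simp only [this]
  rw [h1, h2, h3, ← Matrix.det_updateRow_smul, ← Matrix.det_updateRow_add]
  congr 2
  ext j : 1
  simp only [Pi.add_apply, Pi.smul_apply, smul_eq_mul]
  exact hz_succ c _

theorem Zd_eq_zero_of_eq {e c k i i' : ℕ} (hi : i < e) (hi' : i' < e) (hne : i ≠ i')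
    (hk : i < k ↔ i' < k) {d : ℕ → ℤ} (h : d i = d i') : Zd e c k d = 0 := by
  refine Matrix.det_zero_of_row_eq (i := ⟨i, hi⟩) (j := ⟨i', hi'⟩) (by simpa using hne) ?_
  ext j : 1
  simp only [Matrix.of_apply, hk, h]

theorem Zd_eq_zero_of_neg {e c k i : ℕ} (hi : i < e) {d : ℕ → ℤ} (h : d i < 0) : Zd e c k d = 0 := by
  refine Matrix.det_eq_zero_of_row_eq_zero ⟨i, hi⟩ fun j => ?_
  simp only [Matrix.of_apply]
  rw [hz_neg _ (by omega), hz_neg _ (by omega)]; simp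

theorem Zd_swap {e c k i i' : ℕ} (hi : i < e) (hi' : i' < e) (hne : i ≠ i')
    (hk : i < k ↔ i' < k) (d : ℕ → ℤ) : Zd e c k (d ∘ Equiv.swap i i') = - Zd e c k d := by
  have h := Matrix.det_permute (Equiv.swap (⟨i, hi⟩ : Fin e) ⟨i', hi'⟩) (Matrix.of fun i j : Fin e =>
    if (i : ℕ) < k then hz (c + 1) (d i - (j : ℕ)) else hz c (d i - (j : ℕ)))
  rw [Equiv.Perm.sign_swap (by simpa using hne)] at h
  unfold Zd
  rw [show -(Matrix.of fun i j : Fin e =>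
    if (i : ℕ) < k then hz (c + 1) (d i - (j : ℕ)) else hz c (d i - (j : ℕ))).det = _ from by
      simpa using h.symm]
  congr 1
  ext a j : 2
  simp only [Matrix.of_apply, Matrix.submatrix_apply, id, Function.comp]
  rcases eq_or_ne a ⟨i, hi⟩ with rfl | h1
  · simp [hk]
  rcases eq_or_ne a ⟨i', hi'⟩ with rfl | h2
  · simp [hk]
  have h1' : (a : ℕ) ≠ i := fun h => h1 (Fin.ext h)
  have h2' : (a : ℕ) ≠ i' := fun h => h2 (Fin.ext h)
  rw [Equiv.swap_apply_of_ne_of_ne h1 h2, Equiv.swap_apply_of_ne_of_ne h1' h2']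

/-- With `e` alphabets and `e+1` rows the determinant vanishes unless some entry is zero. -/
theorem Zd_eq_zero_of_ne {e : ℕ} {d : ℕ → ℤ} (h : ∀ i < e + 1, d i ≠ 0) : Zd (e + 1) e 0 d = 0 := by
  refine Matrix.exists_mulVec_eq_zero_iff.1 ⟨fun j : Fin (e + 1) => wz e j, ?_, ?_⟩
  · intro h0
    have := congrFun h0 0
    simp [wz_zero] at this
  · ext i : 1
    have := wz_hz e e le_rfl (d i)
    rw [if_neg (h i i.2), Finset.sum_range] at this
    simp only [Matrix.mulVec, dotProduct, Matrix.of_apply, Nat.not_lt_zero, if_false, Pi.zero_apply]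
    rw [← this]
    exact Finset.sum_congr rfl fun j _ => mul_comm _ _

/-- Row removal. -/
theorem Zd_drop {e c : ℕ} {d : ℕ → ℤ} (h : d 0 = 0) :
    Zd (e + 1) c 0 d = Zd e c 0 (fun i => d (i + 1) - 1) := by
  unfold Zd
  rw [Matrix.det_succ_row_zero, Finset.sum_eq_single 0]
  · simp only [Matrix.of_apply, Fin.val_zero, h]
    simp only [Nat.not_lt_zero, if_false, Nat.cast_zero, sub_zero, hz_zero, pow_zero, one_mul]
    congr 1
    ext i j : 2
    simp only [Matrix.submatrix_apply, Matrix.of_apply, Fin.succAbove_zero, Fin.val_succ]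
    push_cast
    congr 1; ring_nf
  · intro j _ hj
    have : (j : ℕ) ≠ 0 := fun h => hj (Fin.ext h)
    simp only [Matrix.of_apply, Fin.val_zero, h]
    simp only [Nat.not_lt_zero, if_false]
    rw [hz_neg _ (by omega)]; simp
  · simp

theorem Zd_top {e : ℕ} (d : ℕ → ℤ) : Zd (e + 1) e (e + 1) d = Zd (e + 1) (e + 1) 0 d := by
  unfold Zd
  congr 1
  ext i j : 2
  simp only [Matrix.of_apply, i.2, if_true, Nat.not_lt_zero, if_false]

theorem hz_supp (c : ℕ) (k : ℤ) : hz c k ∈ supported ℝ (Set.Iio c) := by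
  induction c generalizing k with
  | zero => rw [hz]; split_ifs; exacts [one_mem _, zero_mem _]
  | succ c ih =>
    rw [hz]
    refine sum_mem fun j _ => mul_mem (pow_mem ?_ _) ?_
    · exact Algebra.subset_adjoin ⟨c, by simp, rfl⟩
    · exact supported_mono (fun x hx => by simp at hx ⊢; omega) (ih _)

theorem Zd_supp (e c : ℕ) (d : ℕ → ℤ) : Zd e c 0 d ∈ supported ℝ (Set.Iio c) := by
  unfold Zd
  rw [Matrix.det_apply]
  refine sum_mem fun σ _ => ?_
  rw [Units.smul_def]
  refine zsmul_mem (prod_mem fun i _ => ?_) _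
  simp only [Matrix.of_apply, Nat.not_lt_zero, if_false]
  exact hz_supp _ _

/-- Level-one expansion. -/
theorem Zd_one {e : ℕ} (d : ℕ → ℤ) (D : ℕ) (hD : d 0 = D) (h : ∀ j : ℕ, 0 < j → j ≤ D →
      Zd (e + 1) e 0 (Function.update d 0 j) = 0) :
    Zd (e + 1) e 1 d = X e ^ D * Zd (e + 1) e 0 (Function.update d 0 0) := by
  induction D generalizing d with
  | zero =>
    rw [Zd_rec (by omega), Zd_eq_zero_of_neg (i := 0) (d := dl d 0) (by omega) (by rw [dl_same, hD]; simp)]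
    simp only [mul_zero, add_zero, pow_zero, one_mul]
    congr 1
    rw [eq_comm, Function.update_eq_self_iff, hD]; simp
  | succ D ih =>
    rw [Zd_rec (by omega)]
    have h1 := h (D + 1) (by omega) le_rfl
    rw [show ((D + 1 : ℕ) : ℤ) = d 0 from hD.symm, Function.update_eq_self] at h1
    rw [h1, ih (dl d 0) (by rw [dl_same, hD]; simp)]
    · simp only [dl, Function.update_idem]; ring
    · intro j hj hjD
      have := h j hj (by omega)
      simpa only [dl, Function.update_idem] using this

end SchurDet
end ConvexPaper

namespace ConvexPaper
section SchurState
open MvPolynomial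

theorem Lor.pull {𝔸 𝔸' : Type*} [CommRing 𝔸] [Algebra ℝ 𝔸] [CommRing 𝔸'] [Algebra ℝ 𝔸']
    {V' : Submodule ℝ 𝔸'} {χ : 𝔸 →ₗ[ℝ] ℝ} {χ' : 𝔸' →ₗ[ℝ] ℝ} {G : Type*} [DecidableEq G]
    (v : G → 𝔸) (v' : G → 𝔸') (β : G → ℝ) (hβ : ∀ g, 0 ≤ β g) (hv' : ∀ g, v' g ∈ V')
    (hform : ∀ g g', χ (v g * v g') = χ' (v' g * v' g') - if g = g' then β g else 0)
    (hL : Lor V' χ' 1) : Lor (Submodule.span ℝ (Set.range v)) χ 1 := by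
  have hB : ∀ c c' : G →₀ ℝ, χ ((c.sum fun i a => a • v i) * (c'.sum fun i a => a • v i)) =
      χ' ((c.sum fun i a => a • v' i) * (c'.sum fun i a => a • v' i)) -
        c.sum fun i a => a * (c' i * β i) := by
    intro c c'
    simp only [Finsupp.sum, Finset.sum_mul_sum, map_sum, smul_mul_smul_comm, map_smul, hform, smul_eq_mul,
      mul_sub, Finset.sum_sub_distrib]
    congr 1
    refine Finset.sum_congr rfl fun i hi => ?_
    simp only [mul_ite, mul_zero, Finset.sum_ite_eq]
    split_ifs with h
    · ring
    · simp [Finsupp.notMem_support_iff.1 h]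
  intro g hg h hh hpos
  obtain ⟨c, rfl⟩ := Finsupp.mem_span_range_iff_exists_finsupp.1 hg
  obtain ⟨c', rfl⟩ := Finsupp.mem_span_range_iff_exists_finsupp.1 hh
  simp only [one_mul] at hpos ⊢
  have hm : ∀ c : G →₀ ℝ, (c.sum fun i a => a • v' i) ∈ V' := fun c =>
    V'.sum_mem fun i _ => V'.smul_mem _ (hv' i)
  have hLor := hL _ (hm c) _ (hm c')
  simp only [one_mul] at hLor
  rw [hB] at hpos ⊢
  rw [hB, hB]
  set F := χ' ((c.sum fun i a => a • v' i) * (c.sum fun i a => a • v' i))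
  set F2 := χ' ((c.sum fun i a => a • v' i) * (c'.sum fun i a => a • v' i))
  set F3 := χ' ((c'.sum fun i a => a • v' i) * (c'.sum fun i a => a • v' i))
  classical
  set T := c.support ∪ c'.support
  have hs : ∀ a b : G →₀ ℝ, a.support ⊆ T → (a.sum fun i x => x * (b i * β i)) = ∑ i ∈ T, a i * (b i * β i) := by
    intro a b ha
    exact Finsupp.sum_of_support_subset _ ha _ (by simp)
  rw [hs c c Finset.subset_union_left] at hpos ⊢
  rw [hs c c' Finset.subset_union_left, hs c' c' Finset.subset_union_right]
  set p := ∑ i ∈ T, c i * (c i * β i)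
  set q := ∑ i ∈ T, c i * (c' i * β i)
  set r := ∑ i ∈ T, c' i * (c' i * β i)
  have hQ : ∀ s t : ℝ, 0 ≤ s ^ 2 * p + 2 * s * t * q + t ^ 2 * r := by
    intro s t
    have : s ^ 2 * p + 2 * s * t * q + t ^ 2 * r = ∑ i ∈ T, (s * c i + t * c' i) ^ 2 * β i := by
      simp only [p, q, r, Finset.mul_sum, ← Finset.sum_add_distrib]
      exact Finset.sum_congr rfl fun i _ => by ring
    rw [this]
    exact Finset.sum_nonneg fun i _ => mul_nonneg (sq_nonneg _) (hβ i)
  have hp : 0 ≤ p := by simpa using hQ 1 0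
  have hF : 0 < F := by linarith
  have h1 := hLor hF
  have h2 := hQ (-F2) F
  by_contra hcon
  push Not at hcon
  have h3 : F2 ^ 2 * (F - p) - 2 * F * F2 * (F2 - q) + F ^ 2 * (F3 - r) ≤ 0 := by
    have : F * (F * F3 - F2 ^ 2) ≤ 0 := mul_nonpos_of_nonneg_of_nonpos hF.le (by linarith)
    nlinarith
  have h4 := mul_nonpos_of_nonneg_of_nonpos hpos.le h3
  have h5 : 0 < F ^ 2 * ((F - p) * (F3 - r) - (F2 - q) ^ 2) := mul_pos (pow_pos hF 2) (by linarith)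
  nlinarith [sq_nonneg (F2 * (F - p) - F * (F2 - q))]

/-- Reversal of exponents. -/
noncomputable def revP (M : ℕ →₀ ℕ) : MvPolynomial ℕ ℝ →ₗ[ℝ] MvPolynomial ℕ ℝ :=
  (basisMonomials ℕ ℝ).constr ℝ fun β => if β ≤ M then monomial (M - β) 1 else 0

theorem revP_mono (M β : ℕ →₀ ℕ) : revP M (monomial β 1) = if β ≤ M then monomial (M - β) 1 else 0 := by
  have := (basisMonomials ℕ ℝ).constr_basis ℝ (fun β => if β ≤ M then monomial (M - β) (1 : ℝ) else 0) β
  rwa [coe_basisMonomials] at this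

theorem lin_ext_mono {σ R N : Type*} [CommSemiring R] [AddCommMonoid N] [Module R N]
    {f g : MvPolynomial σ R →ₗ[R] N} (h : ∀ β, f (monomial β 1) = g (monomial β 1)) : f = g := by
  refine (basisMonomials σ R).ext fun β => ?_
  rw [coe_basisMonomials]; exact h β

theorem revP_X_mul (M : ℕ →₀ ℕ) (l : ℕ) (p : MvPolynomial ℕ ℝ) :
    revP (M + Finsupp.single l 1) (X l * p) = revP M p := by
  have : revP (M + Finsupp.single l 1) ∘ₗ LinearMap.mulLeft ℝ (X l) = revP M := by
    refine lin_ext_mono fun β => ?_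
    simp only [LinearMap.comp_apply, LinearMap.mulLeft_apply]
    rw [X, monomial_mul, one_mul, revP_mono, revP_mono, add_comm (Finsupp.single l 1)]
    simp only [add_le_add_iff_right, add_tsub_add_eq_tsub_right]
  exact LinearMap.congr_fun this p

theorem revP_Xpow_mul (M : ℕ →₀ ℕ) (l a : ℕ) (p : MvPolynomial ℕ ℝ) :
    revP (M + Finsupp.single l a) (X l ^ a * p) = revP M p := by
  induction a with
  | zero => simp
  | succ a ih =>
    rw [Finsupp.single_add, ← add_assoc, pow_succ', mul_assoc, revP_X_mul, ih]

theorem revP_supp (M : ℕ →₀ ℕ) (c a : ℕ) {p : MvPolynomial ℕ ℝ} (hp : p ∈ supported ℝ (Set.Iio c)) :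
    revP (M + Finsupp.single c a) p = X c ^ a * revP M p := by
  rw [p.as_sum, map_sum, map_sum, Finset.mul_sum]
  refine Finset.sum_congr rfl fun β hβ => ?_
  have hβc : β c = 0 := by
    by_contra h
    have := mem_supported.1 hp (Finset.mem_coe.2 ((mem_vars_iff_mem_support c).2 ⟨β, hβ, by simpa using h⟩))
    simp at this
  rw [← mul_one (coeff β p), ← smul_eq_mul, ← smul_monomial, map_smul, map_smul, revP_mono, revP_mono, mul_smul_comm]
  congr 1
  have : β ≤ M + Finsupp.single c a ↔ β ≤ M := by
    constructor
    · intro h i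
      rcases eq_or_ne i c with rfl | hi
      · omega
      · simpa [hi.symm] using h i
    · intro h; exact h.trans (by simp)
  simp only [this]
  split_ifs with h
  · rw [X_pow_eq_monomial, monomial_mul, one_mul]
    refine congrArg (fun z => monomial z (1 : ℝ)) (Finsupp.ext fun i => ?_)
    have := h i
    simp only [Finsupp.coe_tsub, Finsupp.coe_add, Pi.sub_apply, Pi.add_apply]
    omega
  · simp

variable {J : Type}

/-- The big algebra. -/
abbrev BigA (J : Type) := MvPolynomial (Option ℕ) (MvPolynomial J ℝ)

/-- Functional with prescribed values on monomials. -/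
noncomputable def Phi (f : (Option ℕ →₀ ℕ) → MvPolynomial J ℝ) :
    BigA J →ₗ[MvPolynomial J ℝ] MvPolynomial J ℝ :=
  (basisMonomials (Option ℕ) (MvPolynomial J ℝ)).constr ℝ f

theorem Phi_mono (f : (Option ℕ →₀ ℕ) → MvPolynomial J ℝ) (μ) : Phi f (monomial μ 1) = f μ := by
  have := (basisMonomials (Option ℕ) (MvPolynomial J ℝ)).constr_basis ℝ f μ
  rwa [coe_basisMonomials] at this

theorem Phi_X (f : (Option ℕ →₀ ℕ) → MvPolynomial J ℝ) (i : Option ℕ) (p : BigA J) :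
    Phi f (X i * p) = Phi (fun μ => f (μ + Finsupp.single i 1)) p := by
  have : Phi f ∘ₗ LinearMap.mulLeft (MvPolynomial J ℝ) (X i) = Phi (fun μ => f (μ + Finsupp.single i 1)) := by
    refine lin_ext_mono fun μ => ?_
    simp only [LinearMap.comp_apply, LinearMap.mulLeft_apply]
    rw [X, monomial_mul, one_mul, Phi_mono, Phi_mono, add_comm]
  exact LinearMap.congr_fun this p

theorem Phi_add (f g : (Option ℕ →₀ ℕ) → MvPolynomial J ℝ) (p : BigA J) :
    Phi (f + g) p = Phi f p + Phi g p := by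
  have : Phi (f + g) = Phi f + Phi g := by
    refine lin_ext_mono fun μ => ?_
    simp only [LinearMap.add_apply, Phi_mono, Pi.add_apply]
  rw [this]; rfl

/-- State values. -/
noncomputable def St (x : ℕ → J) (e c k : ℕ) (d : ℕ → ℤ) (M : ℕ →₀ ℕ) (μ : Option ℕ →₀ ℕ) :
    MvPolynomial J ℝ :=
  rename x (revP (M + Finsupp.single c (μ none)) (Zd e c k (fun i => d i - μ (some i))))

/-- State functional. -/
noncomputable def chi (ψ : MvPolynomial J ℝ →ₗ[ℝ] ℝ) (x : ℕ → J) (e c k : ℕ) (d : ℕ → ℤ)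
    (M : ℕ →₀ ℕ) : BigA J →ₗ[ℝ] ℝ :=
  ψ ∘ₗ (Phi (St x e c k d M)).restrictScalars ℝ

variable (ψ : MvPolynomial J ℝ →ₗ[ℝ] ℝ) (x : ℕ → J)

/-- Multiply a functional. -/
noncomputable def mulF (a : MvPolynomial J ℝ) : MvPolynomial J ℝ →ₗ[ℝ] ℝ :=
  ψ ∘ₗ LinearMap.mulLeft ℝ a

theorem mulF_apply (a b : MvPolynomial J ℝ) : mulF ψ a b = ψ (a * b) := rfl

theorem chi_shift {e c k e' c' k' : ℕ} {d d' : ℕ → ℤ} {M M' : ℕ →₀ ℕ} {i : Option ℕ}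
    (h : ∀ μ, St x e c k d M (μ + Finsupp.single i 1) = St x e' c' k' d' M' μ) (p : BigA J) :
    chi ψ x e c k d M (X i * p) = chi ψ x e' c' k' d' M' p := by
  have h' : (fun μ => St x e c k d M (μ + Finsupp.single i 1)) = St x e' c' k' d' M' := funext h
  simp only [chi, LinearMap.comp_apply, LinearMap.restrictScalars_apply, Phi_X]
  rw [h']

theorem chi_C_mul (e c k : ℕ) (d : ℕ → ℤ) (M : ℕ →₀ ℕ) (a : MvPolynomial J ℝ) (p : BigA J) :
    chi ψ x e c k d M (C a * p) = chi (mulF ψ a) x e c k d M p := by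
  simp only [chi, LinearMap.comp_apply, LinearMap.restrictScalars_apply, mulF_apply]
  rw [← smul_eq_C_mul, map_smul, smul_eq_mul]

theorem chi_y_mul (e c k : ℕ) (d : ℕ → ℤ) (M : ℕ →₀ ℕ) (i : ℕ) (p : BigA J) :
    chi ψ x e c k d M (X (some i) * p) = chi ψ x e c k (dl d i) M p := by
  refine chi_shift ψ x (fun μ => ?_) p
  simp only [St]
  congr 3
  · simp
  · ext j
    rcases eq_or_ne j i with rfl | h
    · simp [dl_same]; ring
    · simp [dl_ne d h, h.symm]

theorem chi_eta_mul (e c k : ℕ) (d : ℕ → ℤ) (M : ℕ →₀ ℕ) (p : BigA J) :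
    chi ψ x e c k d M (X none * p) = chi ψ x e c k d (M + Finsupp.single c 1) p := by
  refine chi_shift ψ x (fun μ => ?_) p
  simp only [St]
  congr 3
  · rw [add_assoc, ← Finsupp.single_add]; simp [add_comm]
  · ext j; simp

theorem chi_one (e c k : ℕ) (d : ℕ → ℤ) (M : ℕ →₀ ℕ) :
    chi ψ x e c k d M 1 = ψ (rename x (revP M (Zd e c k d))) := by
  simp only [chi, LinearMap.comp_apply, LinearMap.restrictScalars_apply]
  rw [show (1 : BigA J) = monomial 0 1 from rfl, Phi_mono]
  simp [St]

theorem chi_rec {e c k : ℕ} (hk : k < e) (d : ℕ → ℤ) (M : ℕ →₀ ℕ) (p : BigA J) :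
    chi ψ x e c (k + 1) d (M + Finsupp.single c 1) p =
      chi ψ x e c k d (M + Finsupp.single c 1) p + chi ψ x e c (k + 1) (dl d k) M p := by
  have key : St x e c (k + 1) d (M + Finsupp.single c 1) =
      St x e c k d (M + Finsupp.single c 1) + St x e c (k + 1) (dl d k) M := funext fun μ => ?_
  · simp only [chi, LinearMap.comp_apply, LinearMap.restrictScalars_apply]
    rw [← map_add, ← Phi_add, key]
  simp only [St, Pi.add_apply]
  rw [Zd_rec hk, map_add, map_add]
  congr 2
  rw [add_right_comm, revP_X_mul]
  congr 2
  ext j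
  rcases eq_or_ne j k with rfl | h
  · simp [dl_same]; ring
  · simp [dl_ne _ h]

end SchurState
end ConvexPaper

namespace ConvexPaper
section SchurPos
open MvPolynomial

/-- Valid row data. -/
structure VD (e N : ℕ) (d : ℕ → ℤ) : Prop where
  strict : ∀ i, i + 1 < e → d i < d (i + 1)
  pos : 0 < e → 0 ≤ d 0
  bound : ∀ i < e, d i ≤ N + i

theorem VD.ge {e N : ℕ} {d : ℕ → ℤ} (h : VD e N d) : ∀ i < e, (i : ℤ) ≤ d i := by
  intro i
  induction i with
  | zero => intro hi; simpa using h.pos hi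
  | succ i ih => intro hi; have := ih (by omega); have := h.strict i hi; push_cast; omega

theorem VD.drop {e N : ℕ} {d : ℕ → ℤ} (h : VD (e + 1) N d) : VD e N (fun i => d (i + 1) - 1) where
  strict i hi := by have := h.strict (i + 1) (by omega); omega
  pos he := by
    have := h.strict 0 (by omega)
    have := h.pos (by omega)
    show 0 ≤ d (0 + 1) - 1
    omega
  bound i hi := by have := h.bound (i + 1) (by omega); push_cast at this; omega

theorem VD.low {e N : ℕ} {d : ℕ → ℤ} (h : VD e N d) {k : ℕ} (hk : k + 1 < e) (h2 : d k + 2 ≤ d (k + 1)) :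
    VD e N (dl d (k + 1)) where
  strict i hi := by
    have := h.strict i hi
    rcases eq_or_ne i k with rfl | h3
    · rw [dl_same, dl_ne _ (by omega)]; omega
    · rw [dl_ne d (show i + 1 ≠ k + 1 by omega)]
      rcases eq_or_ne i (k + 1) with rfl | h4
      · rw [dl_same]; omega
      · rw [dl_ne _ h4]; exact this
  pos he := by rw [dl_ne _ (by omega)]; exact h.pos he
  bound i hi := by
    have := h.bound i hi
    rcases eq_or_ne i (k + 1) with rfl | h4
    · rw [dl_same]; omega
    · rw [dl_ne _ h4]; exact this

/-- Degree deficit. -/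
def dsum (e : ℕ) (d : ℕ → ℤ) : ℤ := ∑ i ∈ Finset.range e, (d i - i)

theorem dsum_drop (e : ℕ) (d : ℕ → ℤ) : dsum (e + 1) d = d 0 + dsum e (fun i => d (i + 1) - 1) := by
  unfold dsum
  rw [Finset.sum_range_succ', add_comm]
  congr 1
  · simp
  · exact Finset.sum_congr rfl fun i _ => by push_cast; ring

theorem dsum_low {e k : ℕ} (hk : k < e) (d : ℕ → ℤ) : dsum e (dl d k) = dsum e d - 1 := by
  unfold dsum
  have hk' : k ∈ Finset.range e := by simpa using hk
  rw [← Finset.add_sum_erase _ _ hk', ← Finset.add_sum_erase _ (fun i => d i - (i : ℤ)) hk', dl_same,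
    Finset.sum_congr rfl (g := fun i => d i - (i : ℤ))]
  · ring
  · intro i hi; rw [dl_ne _ (Finset.ne_of_mem_erase hi)]

theorem VD.dsum_le {e N : ℕ} {d : ℕ → ℤ} (h : VD e N d) : dsum e d ≤ e * N := by
  unfold dsum
  refine (Finset.sum_le_card_nsmul _ _ (N : ℤ) fun i hi => ?_).trans ?_
  · have := h.bound i (by simpa using hi); omega
  · simp

/-- The exponent vector for finished columns. -/
noncomputable def MN (N e : ℕ) : ℕ →₀ ℕ := ∑ l ∈ Finset.range e, Finsupp.single l N

theorem MN_succ (N e : ℕ) : MN N (e + 1) = MN N e + Finsupp.single e N := by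
  unfold MN; rw [Finset.sum_range_succ]

variable {J : Type}

theorem LC.mul {D : ℕ} {ψ : MvPolynomial J ℝ →ₗ[ℝ] ℝ} (l : List J) (h : LC (l.length + D) ψ) :
    LC D (mulF ψ (xl l)) := by
  have hx : ∀ l' : List J, xl l * xl l' = xl (l ++ l') := fun l' => by simp [xl]
  refine ⟨fun l' hl' => ?_, fun l' hl' => ?_⟩
  · rw [mulF_apply, hx]; exact h.1 _ (by simp [hl'])
  · have := h.2 (l ++ l') (by simp; omega)
    intro g hg k hk hpos
    simp only [mulF_apply, ← mul_assoc, hx] at hpos ⊢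
    exact this g hg k hk hpos

theorem LC.mulX {D a : ℕ} {ψ : MvPolynomial J ℝ →ₗ[ℝ] ℝ} (j : J) (h : LC (a + D) ψ) :
    LC D (mulF ψ (X j ^ a)) := by
  have := LC.mul (D := D) (ψ := ψ) (List.replicate a j) (by simpa using h)
  simpa [xl] using this

variable (x : ℕ → J)

/-- level-one evaluation -/
theorem level_one {e N m Δ : ℕ} {d : ℕ → ℤ} (hΔ : d 0 = Δ) (hm : Δ ≤ m)
    (hg : Δ = 0 ∨ ∀ i, 0 < i → i < e + 1 → d i ≠ 0) :
    rename x (revP (MN N e + Finsupp.single e m) (Zd (e + 1) e 1 d)) =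
      X (x e) ^ (m - Δ) * rename x (revP (MN N e) (Zd e e 0 (fun i => d (i + 1) - 1))) := by
  rw [Zd_one d Δ hΔ, Zd_drop (by simp)]
  · obtain ⟨a, rfl⟩ := Nat.exists_eq_add_of_le hm
    rw [add_comm Δ a, Finsupp.single_add, ← add_assoc, revP_Xpow_mul, revP_supp _ _ _ (Zd_supp _ _ _),
      map_mul, map_pow, rename_X, Nat.add_sub_cancel]
    simp
  · intro j hj hjD
    rcases hg with h | h
    · omega
    · apply Zd_eq_zero_of_ne
      intro i hi
      rcases Nat.eq_zero_or_pos i with rfl | h0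
      · simp; omega
      · rw [Function.update_of_ne (by omega)]; exact h i h0 hi

theorem level_one_neg {e m k : ℕ} {M} {d : ℕ → ℤ} (hd : d 0 < 0) :
    rename x (revP (M + Finsupp.single e m) (Zd (e + 1) e k d)) = 0 := by
  rw [Zd_eq_zero_of_neg (i := 0) (by omega) hd]; simp

theorem pos_both (N e : ℕ) :
    (∀ (D : ℕ) (ψ : MvPolynomial J ℝ →ₗ[ℝ] ℝ), LC D ψ → ∀ d, VD e N d →
      (e * N : ℤ) = D + dsum e d → 0 < ψ (rename x (revP (MN N e) (Zd e e 0 d)))) ∧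
    (∀ k ≤ e, ∀ (m D : ℕ) (ψ : MvPolynomial J ℝ →ₗ[ℝ] ℝ), LC D ψ → ∀ d, VD (e + 1) N d →
      d k - k ≤ m → (e * N + m : ℤ) = D + dsum (e + 1) d →
      0 < ψ (rename x (revP (MN N e + Finsupp.single e m) (Zd (e + 1) e (k + 1) d)))) := by
  have step : ∀ e, (∀ (D : ℕ) (ψ : MvPolynomial J ℝ →ₗ[ℝ] ℝ), LC D ψ → ∀ d, VD e N d →
      (e * N : ℤ) = D + dsum e d → 0 < ψ (rename x (revP (MN N e) (Zd e e 0 d)))) →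
      (∀ k ≤ e, ∀ (m D : ℕ) (ψ : MvPolynomial J ℝ →ₗ[ℝ] ℝ), LC D ψ → ∀ d, VD (e + 1) N d →
      d k - k ≤ m → (e * N + m : ℤ) = D + dsum (e + 1) d →
      0 < ψ (rename x (revP (MN N e + Finsupp.single e m) (Zd (e + 1) e (k + 1) d)))) := by
    intro e ih k
    induction k with
    | zero =>
      intro _ m D ψ hψ d hd hm hdeg
      obtain ⟨Δ, hΔ⟩ := Int.eq_ofNat_of_zero_le (hd.pos (by omega))
      have hΔm : Δ ≤ m := by simp only [hΔ] at hm; omega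
      have hge := hd.ge
      rw [level_one x hΔ hΔm (Or.inr fun i h0 hi => by have := hge i hi; omega), ← mulF_apply]
      rw [dsum_drop, hΔ] at hdeg
      have hle := hd.drop.dsum_le
      obtain ⟨D', hD'⟩ : ∃ D', D = (m - Δ) + D' := Nat.exists_eq_add_of_le (by zify [hΔm]; linarith)
      subst hD'
      refine ih D' _ (LC.mulX _ hψ) _ hd.drop ?_
      push_cast [hΔm] at hdeg
      linarith
    | succ k ihk =>
      intro hke m
      induction m with
      | zero =>
        intro D ψ hψ d hd hm hdeg
        have h1 := hd.strict k (by omega)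
        have h2 := hd.ge k (by omega)
        rw [Zd_rec (by omega), Zd_eq_zero_of_eq (i := k) (i' := k + 1) (d := dl d (k + 1)) (by omega) (by omega)
          (by omega) (by omega), mul_zero, add_zero]
        · exact ihk (by omega) 0 D ψ hψ d hd (by push_cast at hm ⊢; omega) hdeg
        · rw [dl_same, dl_ne _ (by omega)]; push_cast at hm; omega
      | succ m ihm =>
        intro D ψ hψ d hd hm hdeg
        have h1 := hd.strict k (by omega)
        rw [Zd_rec (by omega)]
        have hA := ihk (by omega) (m + 1) D ψ hψ d hd (by push_cast at hm ⊢; omega) hdeg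
        by_cases h3 : d k + 2 ≤ d (k + 1)
        · have hB := ihm D ψ hψ (dl d (k + 1)) (hd.low (by omega) h3)
            (by rw [dl_same]; push_cast at hm ⊢; omega)
            (by rw [dsum_low (by omega)]; push_cast at hdeg; linarith)
          rw [map_add, map_add, map_add]
          refine add_pos hA ?_
          rwa [Finsupp.single_add, ← add_assoc, revP_X_mul]
        · rw [Zd_eq_zero_of_eq (i := k) (i' := k + 1) (d := dl d (k + 1)) (by omega) (by omega)
            (by omega) (by omega), mul_zero, add_zero]
          · exact hA
          · rw [dl_same, dl_ne _ (by omega)]; omega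
  have fin : ∀ e, (∀ (D : ℕ) (ψ : MvPolynomial J ℝ →ₗ[ℝ] ℝ), LC D ψ → ∀ d, VD e N d →
      (e * N : ℤ) = D + dsum e d → 0 < ψ (rename x (revP (MN N e) (Zd e e 0 d)))) := by
    intro e
    induction e with
    | zero =>
      intro D ψ hψ d hd hdeg
      obtain rfl : D = 0 := by simp [dsum] at hdeg; omega
      have h1 := hψ.1 [] rfl
      have h2 : revP (MN N 0) (Zd 0 0 0 d) = 1 := by
        have h3 := revP_mono (MN N 0) 0
        have h4 : Zd 0 0 0 d = monomial 0 1 := by simp [Zd]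
        rw [h4, h3]; simp [MN]
      rw [h2]; simpa [xl] using h1
    | succ e ih =>
      intro D ψ hψ d hd hdeg
      rw [← Zd_top, MN_succ]
      refine step e ih e le_rfl N D ψ hψ d hd ?_ ?_
      · have := hd.bound e (by omega); omega
      · push_cast at hdeg; linarith
  exact ⟨fin e, step e (fin e)⟩

end SchurPos
end ConvexPaper

namespace ConvexPaper
section SchurLorA
open MvPolynomial

theorem Lor.to_one {𝔸 : Type*} [CommRing 𝔸] [Algebra ℝ 𝔸] {V : Submodule ℝ 𝔸} {χ χ' : 𝔸 →ₗ[ℝ] ℝ}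
    {a : 𝔸} (h : ∀ p, χ (a * p) = χ' p) (hL : Lor V χ a) : Lor V χ' 1 := by
  intro g hg k hk
  have := hL g hg k hk
  simpa only [one_mul, mul_assoc, h] using this

theorem Lor.of_one {𝔸 : Type*} [CommRing 𝔸] [Algebra ℝ 𝔸] {V : Submodule ℝ 𝔸} {χ χ' : 𝔸 →ₗ[ℝ] ℝ}
    {a : 𝔸} (h : ∀ p, χ (a * p) = χ' p) (hL : Lor V χ' 1) : Lor V χ a := by
  intro g hg k hk
  have := hL g hg k hk
  simpa only [one_mul, mul_assoc, h] using this

theorem Lor.mono {𝔸 : Type*} [CommRing 𝔸] [Algebra ℝ 𝔸] {V W : Submodule ℝ 𝔸} {χ : 𝔸 →ₗ[ℝ] ℝ}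
    {a : 𝔸} (h : V ≤ W) (hL : Lor W χ a) : Lor V χ a :=
  fun g hg k hk => hL g (h hg) k (h hk)

variable {J : Type}

/-- Generators of the test space. -/
noncomputable def gen (J : Type) (e : ℕ) : J ⊕ Option (Fin e) → BigA J
  | Sum.inl j => C (X j)
  | Sum.inr none => X none
  | Sum.inr (some i) => X (some (i : ℕ))

/-- Generators without the auxiliary variable. -/
noncomputable def gen0 (J : Type) (e : ℕ) : J ⊕ Fin e → BigA J
  | Sum.inl j => C (X j)
  | Sum.inr i => X (some (i : ℕ))

/-- Test space. -/
noncomputable def VB (J : Type) (e : ℕ) : Submodule ℝ (BigA J) := Submodule.span ℝ (Set.range (gen J e))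

/-- Test space without the auxiliary variable. -/
noncomputable def VB0 (J : Type) (e : ℕ) : Submodule ℝ (BigA J) := Submodule.span ℝ (Set.range (gen0 J e))

theorem VB_C (e : ℕ) (j : J) : (C (X j) : BigA J) ∈ VB J e := Submodule.subset_span ⟨Sum.inl j, rfl⟩
theorem VB_eta (e : ℕ) : (X none : BigA J) ∈ VB J e := Submodule.subset_span ⟨Sum.inr none, rfl⟩
theorem VB_y {e i : ℕ} (hi : i < e) : (X (some i) : BigA J) ∈ VB J e :=
  Submodule.subset_span ⟨Sum.inr (some ⟨i, hi⟩), rfl⟩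
theorem VB0_C (e : ℕ) (j : J) : (C (X j) : BigA J) ∈ VB0 J e := Submodule.subset_span ⟨Sum.inl j, rfl⟩
theorem VB0_y {e i : ℕ} (hi : i < e) : (X (some i) : BigA J) ∈ VB0 J e :=
  Submodule.subset_span ⟨Sum.inr ⟨i, hi⟩, rfl⟩

theorem VB0_le (e : ℕ) : VB0 J e ≤ VB J e := by
  refine Submodule.span_le.2 ?_
  rintro _ ⟨j | i, rfl⟩
  · exact VB_C e j
  · exact VB_y i.2

theorem Phi_anti {f : (Option ℕ →₀ ℕ) → MvPolynomial J ℝ} {s : Equiv.Perm (Option ℕ)}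
    (hf : ∀ μ, f (μ.mapDomain s) = - f μ) {p : BigA J} (hp : rename s p = p) : Phi f p = 0 := by
  have h : Phi f ∘ₗ (rename s).toLinearMap = - Phi f := by
    refine lin_ext_mono fun μ => ?_
    simp only [LinearMap.comp_apply, AlgHom.toLinearMap_apply, rename_monomial, LinearMap.neg_apply]
    rw [Phi_mono, Phi_mono, hf]
  have h1 := LinearMap.congr_fun h p
  simp only [LinearMap.comp_apply, AlgHom.toLinearMap_apply, hp, LinearMap.neg_apply] at h1
  have h2 : (2 : MvPolynomial J ℝ) * Phi f p = 0 := by linear_combination h1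
  exact (mul_eq_zero.1 h2).resolve_left two_ne_zero

variable (ψ : MvPolynomial J ℝ →ₗ[ℝ] ℝ) (x : ℕ → J)

theorem Zd_anti {e c l k : ℕ} {d : ℕ → ℤ} (hk : k + 1 < e) (hl : k < l ↔ k + 1 < l) (hd : d k = d (k + 1))
    (M : ℕ →₀ ℕ) (q : MvPolynomial ℕ ℝ) {p : BigA J}
    (hp : rename (Equiv.swap (some k) (some (k + 1))) p = p) :
    Phi (fun μ => rename x (revP (M + Finsupp.single c (μ none)) (q * Zd e c l (fun i => d i - μ (some i))))) p = 0 := by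
  refine Phi_anti (s := Equiv.swap (some k) (some (k + 1))) (fun μ => ?_) hp
  have hm : ∀ o, (μ.mapDomain (Equiv.swap (some k) (some (k + 1)))) o = μ (Equiv.swap (some k) (some (k + 1)) o) := by
    intro o
    conv_lhs => rw [← Equiv.swap_apply_self (some k) (some (k + 1)) o]
    rw [Finsupp.mapDomain_apply (Equiv.injective _)]
  have h2 : (fun i => d i - ((μ.mapDomain (Equiv.swap (some k) (some (k + 1)))) (some i) : ℤ)) =
      (fun i => d i - (μ (some i) : ℤ)) ∘ Equiv.swap k (k + 1) := by
    funext i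
    simp only [hm, Function.comp]
    rcases eq_or_ne i k with rfl | h1
    · simp [hd]
    · rcases eq_or_ne i (k + 1) with rfl | h3
      · simp [hd]
      · rw [Equiv.swap_apply_of_ne_of_ne h1 h3, Equiv.swap_apply_of_ne_of_ne (by simpa using h1) (by simpa using h3)]
  have h3 : (μ.mapDomain (Equiv.swap (some k) (some (k + 1)))) none = μ none := by
    rw [hm, Equiv.swap_apply_of_ne_of_ne (by simp) (by simp)]
  beta_reduce
  rw [h2, h3, Zd_swap (by omega) (by omega) (by omega) hl, mul_neg, map_neg, map_neg]

theorem chi_anti {e c l k : ℕ} {d : ℕ → ℤ} (hk : k + 1 < e) (hl : k < l ↔ k + 1 < l) (hd : d k = d (k + 1))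
    (M : ℕ →₀ ℕ) {p : BigA J}
    (hp : rename (Equiv.swap (some k) (some (k + 1))) p = p) : chi ψ x e c l d M p = 0 := by
  have h := Zd_anti (c := c) x hk hl hd M 1 hp
  have h1 : St x e c l d M = (fun μ => rename x (revP (M + Finsupp.single c (μ none))
      (1 * Zd e c l (fun i => d i - μ (some i))))) := by
    funext μ; rw [one_mul]; rfl
  simp only [chi, LinearMap.comp_apply, LinearMap.restrictScalars_apply]
  rw [h1, h, map_zero]

theorem chi_step {e c k : ℕ} {d : ℕ → ℤ} (hk : k + 1 < e) (hd : d (k + 1) = d k + 1)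
    (M : ℕ →₀ ℕ) {p : BigA J}
    (hp : rename (Equiv.swap (some k) (some (k + 1))) p = p) :
    chi ψ x e c (k + 2) d M p = chi ψ x e c (k + 1) d M p := by
  have h := Zd_anti (c := c) (l := k + 2) (d := dl d (k + 1)) x hk (by omega)
    (by rw [dl_same, dl_ne _ (by omega)]; omega) M (X c) hp
  have h1 : St x e c (k + 2) d M = St x e c (k + 1) d M + (fun μ => rename x (revP (M + Finsupp.single c (μ none))
      (X c * Zd e c (k + 2) (fun i => dl d (k + 1) i - μ (some i))))) := by
    funext μ
    simp only [St, Pi.add_apply]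
    rw [Zd_rec hk, map_add, map_add]
    congr 5
    funext j
    rcases eq_or_ne j (k + 1) with rfl | h
    · simp [dl_same]; ring
    · simp [dl_ne _ h]
  simp only [chi, LinearMap.comp_apply, LinearMap.restrictScalars_apply]
  rw [h1, Phi_add, h, add_zero]

theorem chi_pair_yy {e c l : ℕ} {d : ℕ → ℤ} {M} (i i' : ℕ) :
    chi ψ x e c l d M (X (some i) * X (some i')) = ψ (rename x (revP M (Zd e c l (dl (dl d i) i')))) := by
  rw [chi_y_mul, ← mul_one (X (some i')), chi_y_mul, chi_one]

theorem chi_pair_yC {e c l : ℕ} {d : ℕ → ℤ} {M} (i : ℕ) (a) :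
    chi ψ x e c l d M (X (some i) * C a) = ψ (a * rename x (revP M (Zd e c l (dl d i)))) := by
  rw [chi_y_mul, ← mul_one (C a), chi_C_mul, chi_one, mulF_apply]

theorem chi_pair_CC {e c l : ℕ} {d : ℕ → ℤ} {M} (a b) :
    chi ψ x e c l d M (C a * C b) = ψ (a * (b * rename x (revP M (Zd e c l d)))) := by
  rw [chi_C_mul, ← mul_one (C b), chi_C_mul, chi_one, mulF_apply, mulF_apply]

theorem chi_pair_en {e c l m : ℕ} {d : ℕ → ℤ} {M} (p) :
    chi ψ x e c l d (M + Finsupp.single c m) (X none * p) = chi ψ x e c l d (M + Finsupp.single c (m + 1)) p := by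
  rw [chi_eta_mul, add_assoc, ← Finsupp.single_add]

theorem chi_val_C {e c l : ℕ} {d : ℕ → ℤ} {M} (a) :
    chi ψ x e c l d M (C a) = ψ (a * rename x (revP M (Zd e c l d))) := by
  rw [← mul_one (C a), chi_C_mul, chi_one, mulF_apply]

theorem chi_val_y {e c l : ℕ} {d : ℕ → ℤ} {M} (i : ℕ) :
    chi ψ x e c l d M (X (some i)) = ψ (rename x (revP M (Zd e c l (dl d i)))) := by
  rw [← mul_one (X (some i)), chi_y_mul, chi_one]

theorem chi_val_e {e c l m : ℕ} {d : ℕ → ℤ} {M} :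
    chi ψ x e c l d (M + Finsupp.single c m) (X none) = ψ (rename x (revP (M + Finsupp.single c (m + 1)) (Zd e c l d))) := by
  rw [← mul_one (X none), chi_pair_en, chi_one]

end SchurLorA
end ConvexPaper

namespace ConvexPaper
section SchurLorB
open MvPolynomial
variable {J : Type} (x : ℕ → J)

/-- The Lorentzian statement at a given level. -/
def QL (N e k : ℕ) : Prop := ∀ (m D : ℕ) (ψ : MvPolynomial J ℝ →ₗ[ℝ] ℝ), LC D ψ → ∀ d, VD (e + 1) N d →
      d k - k ≤ m → (e * N + m + 2 : ℤ) = D + dsum (e + 1) d →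
      Lor (VB J (e + 1)) (chi ψ x (e + 1) e (k + 1) d (MN N e + Finsupp.single e m)) 1

theorem QL_T {N e k : ℕ} (hk : k + 1 ≤ e) (ihk : QL x N e k) (m D : ℕ) (ψ : MvPolynomial J ℝ →ₗ[ℝ] ℝ)
    (hψ : LC D ψ) (d : ℕ → ℤ) (hd : VD (e + 1) N d) (h3 : d k + 2 ≤ d (k + 1))
    (hm : d (k + 1) - (k + 1 : ℕ) ≤ (m + 1 : ℕ)) (hdeg : (e * N + (m + 1 : ℕ) + 2 : ℤ) = D + dsum (e + 1) d)
    (ihm : Lor (VB J (e + 1)) (chi ψ x (e + 1) e (k + 2) (dl d (k + 1)) (MN N e + Finsupp.single e m)) 1) :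
    Lor (VB J (e + 1)) (chi ψ x (e + 1) e (k + 2) d (MN N e + Finsupp.single e (m + 1))) 1 := by
  set χ := chi ψ x (e + 1) e (k + 2) d (MN N e + Finsupp.single e m) with hχ
  have hd' := hd.low (by omega) h3
  have hs' : dsum (e + 1) (dl d (k + 1)) = dsum (e + 1) d - 1 := dsum_low (by omega) d
  have hη : ∀ p, χ (X none * p) = chi ψ x (e + 1) e (k + 2) d (MN N e + Finsupp.single e (m + 1)) p :=
    fun p => chi_pair_en ψ x p
  have hv : ∀ p, χ (X (some (k + 1)) * p) =
      chi ψ x (e + 1) e (k + 2) (dl d (k + 1)) (MN N e + Finsupp.single e m) p :=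
    fun p => chi_y_mul ψ x _ _ _ _ _ _ p
  have hu : ∀ p, χ ((X none - X (some (k + 1))) * p) =
      chi ψ x (e + 1) e (k + 1) d (MN N e + Finsupp.single e (m + 1)) p := by
    intro p
    rw [sub_mul, map_sub, hη, hv, Finsupp.single_add, ← add_assoc, chi_rec ψ x (by omega : k + 1 < e + 1)]
    ring
  have hsum : (X none - X (some (k + 1)) : BigA J) + X (some (k + 1)) = X none := by ring
  have hpos := (pos_both x N e).2
  push_cast at hm hdeg
  have hLu : Lor (VB J (e + 1)) χ (X none - X (some (k + 1))) := by
    refine Lor.of_one hu (ihk (m + 1) D ψ hψ d hd ?_ ?_)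
    · push_cast; omega
    · push_cast; linarith
  have hLv : Lor (VB J (e + 1)) χ (X (some (k + 1))) := Lor.of_one hv ihm
  have key := Lor.T2 (χ := χ) (V := VB J (e + 1)) (u := X none - X (some (k + 1))) (v := X (some (k + 1)))
    (Submodule.sub_mem _ (VB_eta _) (VB_y (by omega))) (VB_y (by omega)) hLu hLv ?_ ?_ ?_
  · rw [hsum] at key
    exact Lor.to_one hη key
  · rw [hsum, mul_comm (X none : BigA J), mul_assoc, hu, chi_pair_en, chi_val_y]
    refine hpos k (by omega) _ D ψ hψ _ hd' ?_ ?_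
    · rw [dl_ne _ (by omega)]; push_cast; omega
    · rw [hs']; push_cast; linarith
  · rw [hsum, mul_assoc, hu, chi_pair_en, chi_val_e]
    refine (hpos k (by omega) _ D ψ hψ _ hd ?_ ?_).le
    · push_cast; omega
    · push_cast; linarith
  · rw [hsum, mul_assoc, hv, chi_pair_en, chi_val_e]
    refine (hpos (k + 1) (by omega) _ D ψ hψ _ hd' ?_ ?_).le
    · rw [dl_same]; push_cast; omega
    · rw [hs']; push_cast; linarith

theorem VD.low2 {e N : ℕ} {d : ℕ → ℤ} (h : VD e N d) {k : ℕ} (hk : k + 1 < e) (h2 : d (k + 1) = d k + 1)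
    (h0 : k = 0 → 1 ≤ d 0) (h1 : ∀ l, k = l + 1 → d l + 2 ≤ d k) :
    VD e N (dl (dl d k) (k + 1)) where
  strict i hi := by
    have := h.strict i hi
    rcases eq_or_ne i k with rfl | h3
    · rw [dl_same, dl_ne _ (by omega), dl_same, dl_ne _ (by omega)]; omega
    rcases eq_or_ne i (k + 1) with rfl | h4
    · rw [dl_same, dl_ne _ (by omega), dl_ne _ (by omega), dl_ne _ (by omega)]; omega
    rw [dl_ne _ h4, dl_ne _ h3, dl_ne _ (by omega)]
    rcases eq_or_ne k (i + 1) with rfl | h5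
    · rw [dl_same]; have := h1 i rfl; omega
    · rw [dl_ne _ (by omega)]; exact this
  pos he := by
    rw [dl_ne _ (by omega)]
    rcases eq_or_ne k 0 with rfl | h5
    · rw [dl_same]; have := h0 rfl; omega
    · rw [dl_ne _ (by omega)]; exact h.pos he
  bound i hi := by
    have := h.bound i hi
    have hle : ∀ (d : ℕ → ℤ) k, dl d k i ≤ d i := by
      intro d k
      rcases eq_or_ne i k with rfl | h3
      · rw [dl_same]; omega
      · rw [dl_ne _ h3]
    exact ((hle _ _).trans (hle _ _)).trans this

theorem QL_S {N e k : ℕ} (hk : k + 1 ≤ e) (ihk : QL x N e k) (m D : ℕ) (ψ : MvPolynomial J ℝ →ₗ[ℝ] ℝ)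
    (hψ : LC D ψ) (d : ℕ → ℤ) (hd : VD (e + 1) N d) (h3 : d (k + 1) = d k + 1)
    (hm : d (k + 1) - (k + 1 : ℕ) ≤ m) (hdeg : (e * N + m + 2 : ℤ) = D + dsum (e + 1) d) :
    Lor (VB J (e + 1)) (chi ψ x (e + 1) e (k + 2) d (MN N e + Finsupp.single e m)) 1 := by
  classical
  set M := MN N e + Finsupp.single e m with hM
  set κ := ψ (rename x (revP M (Zd (e + 1) e (k + 2) (dl (dl d k) (k + 1))))) with hκ
  push_cast at hm
  have hκ0 : 0 ≤ κ := by
    by_cases h0 : k = 0 ∧ d 0 = 0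
    · obtain ⟨rfl, h0⟩ := h0
      rw [hκ, hM, level_one_neg x (by rw [dl_ne _ (by omega), dl_same]; omega), map_zero]
    by_cases h1 : ∃ l, k = l + 1 ∧ d k = d l + 1
    · obtain ⟨l, rfl, h1⟩ := h1
      rw [hκ, Zd_eq_zero_of_eq (i := l) (i' := l + 1) (by omega) (by omega) (by omega) (by omega)]
      · simp
      · rw [dl_ne _ (by omega), dl_ne _ (by omega), dl_ne _ (by omega), dl_same]; omega
    · have hv := hd.low2 (k := k) (by omega) h3
        (fun hk0 => by subst hk0; have := hd.pos (by omega); omega)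
        (fun l hl => by
          subst hl
          have := hd.strict l (by omega)
          by_contra hc
          exact h1 ⟨l, rfl, by omega⟩)
      refine ((pos_both x N e).2 (k + 1) hk m D ψ hψ _ hv ?_ ?_).le
      · rw [dl_same, dl_ne _ (by omega)]; push_cast; omega
      · rw [dsum_low (by omega), dsum_low (by omega)]; linarith
  let a : Fin (e + 1) := ⟨k, by omega⟩
  let b : Fin (e + 1) := ⟨k + 1, by omega⟩
  have hab : a ≠ b := by simp [a, b]
  let v : J ⊕ Option (Fin (e + 1)) → BigA J := fun g =>
    if g = Sum.inr (some a) then X (some k) + X (some (k + 1)) else gen J (e + 1) g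
  let v' : J ⊕ Option (Fin (e + 1)) → BigA J := fun g =>
    if g = Sum.inr (some b) then 0 else v g
  have hvb : v (Sum.inr (some b)) = X (some (k + 1)) := by simp [v, gen, hab.symm, b]
  have hva : v (Sum.inr (some a)) = X (some k) + X (some (k + 1)) := by simp [v]
  have hinv : ∀ g, g ≠ Sum.inr (some b) → rename (Equiv.swap (some k) (some (k + 1))) (v g) = v g := by
    intro g hg
    by_cases hga : g = Sum.inr (some a)
    · subst hga; rw [hva]; simp [add_comm]
    · have : v g = gen J (e + 1) g := by simp [v, hga]
      rw [this]
      rcases g with j | _ | i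
      · simp [gen]
      · simp [gen, Equiv.swap_apply_of_ne_of_ne]
      · have h1 : (i : ℕ) ≠ k := fun h => hga (by simp [a, Fin.ext_iff, h])
        have h2 : (i : ℕ) ≠ k + 1 := fun h => hg (by simp [b, Fin.ext_iff, h])
        simp only [gen, rename_X]
        rw [Equiv.swap_apply_of_ne_of_ne (by simpa using h1) (by simpa using h2)]
  have hvmem : ∀ g, v g ∈ VB J (e + 1) := by
    intro g
    by_cases hga : g = Sum.inr (some a)
    · subst hga; rw [hva]; exact Submodule.add_mem _ (VB_y (by omega)) (VB_y (by omega))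
    · have : v g = gen J (e + 1) g := by simp [v, hga]
      rw [this]; exact Submodule.subset_span ⟨g, rfl⟩
  have hs1 : ∀ p : BigA J, rename (Equiv.swap (some k) (some (k + 1))) p = p →
      chi ψ x (e + 1) e (k + 2) d M (X (some (k + 1)) * p) = 0 := by
    intro p hp
    rw [chi_y_mul]
    exact chi_anti ψ x (k := k) (by omega) (by omega) (by rw [dl_same, dl_ne _ (by omega)]; omega) M hp
  have hL := Lor.pull (χ := chi ψ x (e + 1) e (k + 2) d M) (χ' := chi ψ x (e + 1) e (k + 1) d M)
    (V' := VB J (e + 1)) v v' (fun g => if g = Sum.inr (some b) then κ else 0)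
    (fun g => by beta_reduce; split_ifs <;> simp [hκ0])
    (fun g => by
      by_cases h : g = Sum.inr (some b)
      · simp [v', h]
      · simp only [v', h, if_false]; exact hvmem g)
    ?_ (ihk m D ψ hψ d hd (by omega) hdeg)
  · refine Lor.mono (Submodule.span_le.2 ?_) hL
    rintro _ ⟨g, rfl⟩
    by_cases hga : g = Sum.inr (some a)
    · have : gen J (e + 1) g = v (Sum.inr (some a)) - v (Sum.inr (some b)) := by
        rw [hva, hvb, hga]; simp [gen, a]
      rw [this]
      exact Submodule.sub_mem _ (Submodule.subset_span ⟨_, rfl⟩) (Submodule.subset_span ⟨_, rfl⟩)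
    · have : gen J (e + 1) g = v g := by simp [v, hga]
      rw [this]; exact Submodule.subset_span ⟨_, rfl⟩
  · intro g g'
    by_cases h : g = Sum.inr (some b)
    · subst h
      have hv0 : v' (Sum.inr (some b)) = 0 := by simp [v']
      rw [hv0, zero_mul, map_zero, hvb]
      by_cases h' : g' = Sum.inr (some b)
      · subst h'
        rw [hvb]
        simp only [if_true]
        have h1 := hs1 (X (some k) + X (some (k + 1))) (by simp [add_comm])
        rw [mul_add, map_add, mul_comm, chi_pair_yy] at h1
        linarith
      · rw [if_neg (fun hh => h' hh.symm), hs1 _ (hinv g' h')]; simp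
    · have hvg : v' g = v g := by simp [v', h]
      rw [hvg, if_neg h]
      have e0 : (if g = g' then (0 : ℝ) else 0) = 0 := by split_ifs <;> rfl
      rw [e0, sub_zero]
      by_cases h' : g' = Sum.inr (some b)
      · subst h'
        have hv0 : v' (Sum.inr (some b)) = 0 := by simp [v']
        rw [hv0, mul_zero, map_zero, hvb, mul_comm, hs1 _ (hinv g h)]
      · have hvg' : v' g' = v g' := by simp [v', h']
        rw [hvg']
        exact chi_step ψ x (by omega) h3 M (by rw [map_mul, hinv g h, hinv g' h'])

theorem QL_step {N e k : ℕ} (hk : k + 1 ≤ e) (ihk : QL x N e k) : QL x N e (k + 1) := by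
  intro m
  induction m with
  | zero =>
    intro D ψ hψ d hd hm hdeg
    have h1 := hd.strict k (by omega)
    have h2 := hd.ge k (by omega)
    refine QL_S x hk ihk 0 D ψ hψ d hd ?_ hm hdeg
    push_cast at hm; omega
  | succ m ihm =>
    intro D ψ hψ d hd hm hdeg
    have h1 := hd.strict k (by omega)
    by_cases h3 : d k + 2 ≤ d (k + 1)
    · refine QL_T x hk ihk m D ψ hψ d hd h3 hm hdeg ?_
      refine ihm D ψ hψ _ (hd.low (by omega) h3) ?_ ?_
      · rw [dl_same]; push_cast at hm ⊢; omega
      · rw [dsum_low (by omega)]; push_cast at hdeg; linarith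
    · exact QL_S x hk ihk (m + 1) D ψ hψ d hd (by omega) hm hdeg

end SchurLorB
end ConvexPaper

namespace ConvexPaper
section SchurLorC
open MvPolynomial
variable {J : Type} (x : ℕ → J)

/-- The Lorentzian statement for finished columns. -/
def PL (N e : ℕ) : Prop := ∀ (D : ℕ) (ψ : MvPolynomial J ℝ →ₗ[ℝ] ℝ), LC D ψ → ∀ d, VD e N d →
      (e * N + 2 : ℤ) = D + dsum e d → Lor (VB0 J e) (chi ψ x e e 0 d (MN N e)) 1

/-- Shifted row data. -/
def sh (d : ℕ → ℤ) : ℕ → ℤ := fun i => d (i + 1) - 1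

theorem sh_zero (d : ℕ → ℤ) : sh (dl d 0) = sh d := by
  funext i; simp [sh, dl_ne]

theorem sh_succ (d : ℕ → ℤ) (i : ℕ) : sh (dl d (i + 1)) = dl (sh d) i := by
  funext j
  rcases eq_or_ne j i with rfl | h
  · simp [sh, dl_same]
  · rw [dl_ne _ h]; simp [sh, dl_ne, h]

/-- Finished-column value. -/
noncomputable def Tv (N e : ℕ) (d : ℕ → ℤ) : MvPolynomial J ℝ := rename x (revP (MN N e) (Zd e e 0 d))

/-- Level one value. -/
noncomputable def Lv (N e m : ℕ) (d : ℕ → ℤ) : MvPolynomial J ℝ :=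
  rename x (revP (MN N e + Finsupp.single e m) (Zd (e + 1) e 1 d))

theorem Lv_eq {N e m a Δ : ℕ} {d : ℕ → ℤ} (hΔ : d 0 = Δ) (hm : m = Δ + a)
    (hg : Δ = 0 ∨ ∀ i, 0 < i → i < e + 1 → d i ≠ 0) : Lv x N e m d = X (x e) ^ a * Tv x N e (sh d) := by
  subst hm
  rw [Lv, level_one x hΔ (by omega) hg, Nat.add_sub_cancel_left]; rfl

theorem Lv_neg {N e m : ℕ} {d : ℕ → ℤ} (hd : d 0 < 0) : Lv x N e m d = 0 := level_one_neg x hd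

theorem Lv_special {N e m : ℕ} {d : ℕ → ℤ} (he : 0 < e) (h0 : d 0 = 1) (h1 : d 1 = 0) :
    Lv x N e m d = - (X (x e) ^ m * Tv x N e (sh (dl (d ∘ Equiv.swap 0 1) 0))) := by
  have e1 : Zd (e + 1) e 1 d = Zd (e + 1) e 0 d := by
    rw [Zd_rec (by omega), Zd_rec (by omega), Zd_eq_zero_of_neg (i := 0) (d := dl (dl d 0) 0) (by omega)
      (by rw [dl_same, dl_same]; omega), Zd_eq_zero_of_eq (i := 0) (i' := 1) (d := dl d 0) (by omega) (by omega)
      (by omega) (by omega) (by rw [dl_same, dl_ne _ (by omega)]; omega)]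
    simp
  have e2 : Zd (e + 1) e 0 d = - Zd (e + 1) e 0 (d ∘ Equiv.swap 0 1) := by
    rw [Zd_swap (by omega) (by omega) (by omega) (by omega), neg_neg]
  rw [Lv, e1, e2, Zd_drop (by simp [h1]), map_neg, map_neg, revP_supp _ _ _ (Zd_supp _ _ _), map_mul, map_pow,
    rename_X, sh_zero]
  rfl

theorem Tv_neg {N e : ℕ} {d : ℕ → ℤ} {i : ℕ} (hi : i < e) (hd : d i < 0) : Tv x N e d = 0 := by
  rw [Tv, Zd_eq_zero_of_neg hi hd]; simp

theorem VD.low0 {e N : ℕ} {d : ℕ → ℤ} (h : VD e N d) (h2 : 1 ≤ d 0) : VD e N (dl d 0) where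
  strict i hi := by
    have := h.strict i hi
    rw [dl_ne d (show i + 1 ≠ 0 by omega)]
    rcases eq_or_ne i 0 with rfl | h3
    · rw [dl_same]; omega
    · rw [dl_ne _ h3]; exact this
  pos he := by rw [dl_same]; omega
  bound i hi := by
    have := h.bound i hi
    rcases eq_or_ne i 0 with rfl | h4
    · rw [dl_same]; omega
    · rw [dl_ne _ h4]; exact this

set_option maxHeartbeats 1000000 in
theorem QL_zero {N e : ℕ} (ih : PL x N e) : QL x N e 0 := by
  classical
  intro m D ψ hψ d hd hm hdeg
  obtain ⟨Δ, hΔ⟩ := Int.eq_ofNat_of_zero_le (hd.pos (by omega))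
  obtain ⟨a, rfl⟩ : ∃ a, m = Δ + a := Nat.exists_eq_add_of_le (by simp only [hΔ] at hm; omega)
  have hge : ∀ i, i < e → (Δ : ℤ) + 1 + i ≤ d (i + 1) := by
    intro i
    induction i with
    | zero => intro hi; have := hd.strict 0 (by omega); simp at this ⊢; omega
    | succ i ih => intro hi; have := ih (by omega); have := hd.strict (i + 1) (by omega); push_cast; omega
  have hdr : VD e N (sh d) := hd.drop
  have hds : dsum (e + 1) d = Δ + dsum e (sh d) := by rw [dsum_drop, hΔ]; rfl
  have hle := hdr.dsum_le
  rw [hds] at hdeg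
  push_cast at hdeg
  obtain ⟨D', rfl⟩ : ∃ D', D = a + D' := Nat.exists_eq_add_of_le (by zify; linarith)
  push_cast at hdeg
  have hψ' := LC.mulX (x e) hψ
  have hP := ih D' _ hψ' (sh d) hdr (by linarith)
  -- auxiliary nonnegativity
  have hb0 : 0 ≤ ψ (X (x e) ^ (a + 2) * Tv x N e (sh d)) := by
    obtain ⟨D'', rfl⟩ : ∃ D'', D' = 2 + D'' := Nat.exists_eq_add_of_le (by zify; linarith)
    rw [← mulF_apply]
    refine ((pos_both x N e).1 D'' _ (LC.mulX _ (by rwa [add_assoc])) _ hdr ?_).le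
    push_cast at hdeg; linarith
  have hb1 : 0 < e → Δ = 1 → 0 ≤ ψ (X (x e) ^ (a + 1) * Tv x N e (dl (sh d) 0)) := by
    intro he h1
    obtain ⟨D'', rfl⟩ : ∃ D'', D' = 1 + D'' := Nat.exists_eq_add_of_le (by zify; linarith)
    rw [← mulF_apply]
    refine ((pos_both x N e).1 D'' _ (LC.mulX _ (by rwa [add_assoc])) _ (hdr.low0 ?_) ?_).le
    · have := hge 0 he; simp only [sh]; simp at this ⊢; omega
    · rw [dsum_low he]; push_cast at hdeg; linarith
  let y0 : BigA J := if Δ = 0 then 0 else C (X (x e))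
  let v' : J ⊕ Option (Fin (e + 1)) → BigA J := fun g => match g with
    | Sum.inl j => C (X j)
    | Sum.inr none => C (X (x e))
    | Sum.inr (some i) => Fin.cases y0 (fun i => X (some (i : ℕ))) i
  let β : J ⊕ Option (Fin (e + 1)) → ℝ := fun g => match g with
    | Sum.inl j => 0
    | Sum.inr none => 0
    | Sum.inr (some i) => Fin.cases (if Δ = 1 then ψ (X (x e) ^ (a + 2) * Tv x N e (sh d)) else 0)
        (fun i => if Δ = 1 ∧ d 1 = 2 ∧ (i : ℕ) = 0 then ψ (X (x e) ^ (a + 1) * Tv x N e (dl (sh d) 0)) else 0) i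
  set χ := chi ψ x (e + 1) e 1 d (MN N e + Finsupp.single e (Δ + a)) with hχ
  set χ' := chi (mulF ψ (X (x e) ^ a)) x e e 0 (sh d) (MN N e) with hχ'
  -- evaluations
  have nz0 : ∀ i, 0 < i → i < e + 1 → d i ≠ 0 := by
    intro i h0 hi
    obtain ⟨i, rfl⟩ := Nat.exists_eq_add_of_lt h0
    have := hge i (by omega)
    simp only [zero_add]; omega
  have nzy0 : ∀ (d' : ℕ → ℤ), (∀ i, 0 < i → i < e + 1 → d' i ≠ 0) →
      (∀ i, 0 < i → i < e + 1 → dl d' 0 i ≠ 0) := by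
    intro d' h i h0 hi; rw [dl_ne _ (by omega)]; exact h i h0 hi
  have nz1 : ∀ k < e, Δ = 0 ∨ ∀ i, 0 < i → i < e + 1 → dl d (k + 1) i ≠ 0 := by
    intro k hk
    by_cases hD : Δ = 0
    · exact Or.inl hD
    refine Or.inr fun i h0 hi => ?_
    rcases eq_or_ne i (k + 1) with rfl | h
    · rw [dl_same]; have := hge k hk; omega
    · rw [dl_ne _ h]; exact nz0 i h0 hi
  -- the form identity
  let F : J ⊕ Option (Fin (e + 1)) → J ⊕ Option (Fin (e + 1)) → Prop := fun g g' =>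
    χ (gen J (e + 1) g * gen J (e + 1) g') = χ' (v' g * v' g') - if g = g' then β g else 0
  have hFsymm : ∀ g g', F g g' → F g' g := by
    intro g g' h
    by_cases hh : g = g'
    · subst hh; exact h
    · have hh' : ¬ g' = g := fun q => hh q.symm
      simp only [F, if_neg hh, if_neg hh'] at h ⊢
      rw [mul_comm, h, mul_comm]
  have cCC : ∀ p q, χ' (C p * C q) = ψ (X (x e) ^ a * (p * (q * Tv x N e (sh d)))) := fun p q =>
    chi_pair_CC _ x p q
  have cyC : ∀ i p, χ' (X (some i) * C p) = ψ (X (x e) ^ a * (p * Tv x N e (dl (sh d) i))) := fun i p =>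
    chi_pair_yC _ x i p
  have cyy : ∀ i i', χ' (X (some i) * X (some i')) = ψ (X (x e) ^ a * Tv x N e (dl (dl (sh d) i) i')) := fun i i' =>
    chi_pair_yy _ x i i'
  have bCC : ∀ p q, χ (C p * C q) = ψ (p * (q * Lv x N e (Δ + a) d)) := fun p q =>
    chi_pair_CC _ x p q
  have byC : ∀ i p, χ (X (some i) * C p) = ψ (p * Lv x N e (Δ + a) (dl d i)) := fun i p =>
    chi_pair_yC _ x i p
  have byy : ∀ i i', χ (X (some i) * X (some i')) = ψ (Lv x N e (Δ + a) (dl (dl d i) i')) := fun i i' =>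
    chi_pair_yy _ x i i'
  have beC : ∀ p, χ (X none * C p) = ψ (p * Lv x N e (Δ + a + 1) d) := fun p => by
    rw [hχ, chi_pair_en, chi_val_C]; rfl
  have bey : ∀ i, χ (X none * X (some i)) = ψ (Lv x N e (Δ + a + 1) (dl d i)) := fun p => by
    rw [hχ, chi_pair_en, chi_val_y]; rfl
  have bee : χ (X none * X none) = ψ (Lv x N e (Δ + a + 2) d) := by
    rw [hχ, chi_pair_en, chi_val_e]; rfl
  have nd : ∀ s : ℕ, Lv x N e (Δ + a + s) d = X (x e) ^ (a + s) * Tv x N e (sh d) := fun s =>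
    Lv_eq x hΔ (by omega) (Or.inr nz0)
  have nd1 : ∀ (s : ℕ) (i : ℕ), i < e → Lv x N e (Δ + a + s) (dl d (i + 1)) =
      X (x e) ^ (a + s) * Tv x N e (dl (sh d) i) := fun s i hi => by
    rw [Lv_eq x (a := a + s) (Δ := Δ) (by rw [dl_ne _ (by omega)]; exact hΔ) (by omega) (nz1 i hi), sh_succ]
  have nd0 : ∀ s : ℕ, Δ ≠ 0 → Lv x N e (Δ + a + s) (dl d 0) = X (x e) ^ (a + s + 1) * Tv x N e (sh d) := fun s h => by
    rw [Lv_eq x (a := a + s + 1) (Δ := Δ - 1) (by rw [dl_same]; omega) (by omega) (Or.inr (nzy0 _ nz0)), sh_zero]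
  have nd0' : ∀ s : ℕ, Δ = 0 → Lv x N e (Δ + a + s) (dl d 0) = 0 := fun s h =>
    Lv_neg x (by rw [dl_same]; omega)
  have nd00 : Lv x N e (Δ + a) (dl (dl d 0) 0) = if Δ ≤ 1 then 0 else X (x e) ^ (a + 2) * Tv x N e (sh d) := by
    split_ifs with h
    · exact Lv_neg x (by rw [dl_same, dl_same]; omega)
    · rw [Lv_eq x (a := a + 2) (Δ := Δ - 2) (by rw [dl_same, dl_same]; omega) (by omega)
        (Or.inr (nzy0 _ (nzy0 _ nz0))), sh_zero, sh_zero]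
  have nd01 : ∀ i, i < e → Lv x N e (Δ + a) (dl (dl d (i + 1)) 0) =
      if Δ = 0 then 0 else X (x e) ^ (a + 1) * Tv x N e (dl (sh d) i) := fun i hi => by
    split_ifs with h
    · exact Lv_neg x (by rw [dl_same, dl_ne _ (by omega)]; omega)
    · rw [Lv_eq x (a := a + 1) (Δ := Δ - 1) (by rw [dl_same, dl_ne _ (by omega)]; omega) (by omega)
        (Or.inr (nzy0 _ ((nz1 i hi).resolve_left h))), sh_zero, sh_succ]
  have nd11 : ∀ i i', i < e → i' < e → ¬ (Δ = 1 ∧ d 1 = 2 ∧ i = 0 ∧ i' = 0) →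
      Lv x N e (Δ + a) (dl (dl d (i + 1)) (i' + 1)) = X (x e) ^ a * Tv x N e (dl (dl (sh d) i) i') := by
    intro i i' hi hi' hns
    rw [Lv_eq x (a := a) (Δ := Δ) (by rw [dl_ne _ (by omega), dl_ne _ (by omega)]; exact hΔ) rfl, sh_succ, sh_succ]
    by_cases hD : Δ = 0
    · exact Or.inl hD
    refine Or.inr fun j h0 hj => ?_
    have hz1 := (nz1 i hi).resolve_left hD j h0 hj
    rcases eq_or_ne j (i' + 1) with rfl | h
    · rw [dl_same]
      rcases eq_or_ne i i' with rfl | h2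
      · rw [dl_same]
        have := hge i hi
        intro hcon
        have hi0 : i = 0 := by omega
        subst hi0
        simp only [zero_add, Nat.cast_zero, add_zero] at this hcon
        exact hns ⟨by omega, by omega, rfl, rfl⟩
      · rw [dl_ne _ (by omega)]; have := hge i' hi'; omega
    · rw [dl_ne _ h]; exact hz1
  have fCC : ∀ j j', F (Sum.inl j) (Sum.inl j') := by
    intro j j'
    have h := nd 0
    simp only [add_zero] at h
    simp only [F, gen, v', β, cCC, bCC, h]
    simp only [ite_self, sub_zero]
    congr 1; ring
  have fCe : ∀ j, F (Sum.inr none) (Sum.inl j) := by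
    intro j
    simp only [F, gen, v', β, cCC, beC, nd]
    simp only [ite_self, sub_zero]
    congr 1; ring
  have fee : F (Sum.inr none) (Sum.inr none) := by
    simp only [F, gen, v', β, cCC, bee, nd]
    simp only [ite_self, sub_zero]
    congr 1; ring
  have fyC : ∀ (i : Fin e) j, F (Sum.inr (some i.succ)) (Sum.inl j) := by
    intro i j
    have h := nd1 0 i i.2
    simp only [add_zero] at h
    simp only [F, gen, v', Fin.cases_succ, Fin.val_succ, cyC, byC, h, reduceCtorEq, if_false, sub_zero]
    congr 1; ring
  have fye : ∀ (i : Fin e), F (Sum.inr none) (Sum.inr (some i.succ)) := by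
    intro i
    have h := nd1 1 i i.2
    simp only [F, gen, v', Fin.cases_succ, Fin.val_succ, bey, h, mul_comm (C _) (X _), cyC, Sum.inr.injEq,
      reduceCtorEq, if_false, sub_zero]
    congr 1; ring
  have f0C : ∀ j, F (Sum.inr (some 0)) (Sum.inl j) := by
    intro j
    simp only [F, gen, v', Fin.cases_zero, Fin.val_zero, byC, reduceCtorEq, if_false, sub_zero, y0]
    split_ifs with h
    · have := nd0' 0 h
      simp only [add_zero] at this
      rw [this]; simp
    · have := nd0 0 h
      simp only [add_zero] at this
      rw [this, cCC]; congr 1; ring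
  have f0e : F (Sum.inr none) (Sum.inr (some 0)) := by
    simp only [F, gen, v', Fin.cases_zero, Fin.val_zero, bey, reduceCtorEq, if_false, sub_zero, y0, Sum.inr.injEq]
    split_ifs with h
    · rw [nd0' 1 h]; simp
    · rw [nd0 1 h, cCC]; congr 1; ring
  have f00 : F (Sum.inr (some 0)) (Sum.inr (some 0)) := by
    simp only [F, gen, v', Fin.cases_zero, Fin.val_zero, byy, nd00, y0, β, if_true]
    by_cases h0 : Δ = 0
    · simp [h0]
    · rw [if_neg h0, cCC]
      have e1 : X (x e) ^ a * (X (x e) * (X (x e) * Tv x N e (sh d))) = X (x e) ^ (a + 2) * Tv x N e (sh d) := by ring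
      rw [e1]
      by_cases h1 : Δ = 1
      · simp [h1]
      · simp [h1, show ¬ Δ ≤ 1 by omega]
  have f0y : ∀ (i : Fin e), F (Sum.inr (some i.succ)) (Sum.inr (some 0)) := by
    intro i
    simp only [F, gen, v', Fin.cases_zero, Fin.cases_succ, Fin.val_succ, Fin.val_zero, byy, nd01 i i.2, y0,
      Sum.inr.injEq, Option.some.injEq, Fin.succ_ne_zero, if_false, sub_zero]
    split_ifs with h
    · simp
    · rw [cyC]; congr 1; ring
  have fyy : ∀ (i i' : Fin e), F (Sum.inr (some i.succ)) (Sum.inr (some i'.succ)) := by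
    intro i i'
    simp only [F, gen, v', Fin.cases_succ, Fin.val_succ, byy, cyy, β, Sum.inr.injEq, Option.some.injEq,
      Fin.succ_inj]
    by_cases hs : Δ = 1 ∧ d 1 = 2 ∧ (i : ℕ) = 0 ∧ (i' : ℕ) = 0
    · obtain ⟨h1, h2, h3, h4⟩ := hs
      have hii : i = i' := Fin.ext (by omega)
      have he : 0 < e := by have := i.2; omega
      rw [if_pos hii, if_pos ⟨h1, h2, h3⟩, h3, h4]
      have ee : dl (dl d (0 + 1)) (0 + 1) 0 = 1 := by rw [dl_ne _ (by omega), dl_ne _ (by omega)]; omega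
      have ee' : dl (dl d (0 + 1)) (0 + 1) 1 = 0 := by rw [dl_same, dl_same]; simp; omega
      rw [Lv_special x he ee ee', Tv_neg (i := 0) x he (d := dl (dl (sh d) 0) 0)
        (by rw [dl_same, dl_same]; simp [sh]; omega), mul_zero, map_zero, map_neg, zero_sub, h1, add_comm 1 a]
      have efun : sh (dl (dl (dl d (0 + 1)) (0 + 1) ∘ Equiv.swap 0 1) 0) = dl (sh d) 0 := by
        rw [sh_zero]
        funext j
        rcases eq_or_ne j 0 with rfl | hj
        · rw [dl_same]; simp [sh, dl_ne, h2]; omega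
        · rw [dl_ne _ hj]
          simp only [sh, Function.comp]
          rw [Equiv.swap_apply_of_ne_of_ne (by omega) (by omega), dl_ne _ (by omega), dl_ne _ (by omega)]
      rw [efun]
    · rw [nd11 i i' i.2 i'.2 hs]
      have : (if i = i' then (if Δ = 1 ∧ d 1 = 2 ∧ (i : ℕ) = 0 then
          ψ (X (x e) ^ (a + 1) * Tv x N e (dl (sh d) 0)) else 0) else (0 : ℝ)) = 0 := by
        split_ifs with q1 q2
        · subst q1; exact absurd ⟨q2.1, q2.2.1, q2.2.2, q2.2.2⟩ hs
        · rfl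
        · rfl
      rw [this, sub_zero]
  refine Lor.pull (V' := VB0 J e) (χ' := χ') (gen J (e + 1)) v' β ?_ ?_ ?_ hP
  · rintro (j | _ | i)
    · exact le_rfl
    · exact le_rfl
    · refine Fin.cases ?_ (fun i => ?_) i
      · simp only [β, Fin.cases_zero]; split_ifs
        · exact hb0
        · exact le_rfl
      · simp only [β, Fin.cases_succ]; split_ifs with h
        · exact hb1 (by have := i.2; omega) h.1
        · exact le_rfl
  · rintro (j | _ | i)
    · exact VB0_C e j
    · exact VB0_C e _
    · refine Fin.cases ?_ (fun i => ?_) i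
      · simp only [v', Fin.cases_zero, y0]; split_ifs
        · exact Submodule.zero_mem _
        · exact VB0_C e _
      · exact VB0_y i.2
  · show ∀ g g', F g g'
    rintro (j | _ | i) (j' | _ | i')
    · exact fCC j j'
    · exact hFsymm _ _ (fCe j)
    · exact hFsymm _ _ (Fin.cases (f0C j) (fun i => fyC i j) i')
    · exact fCe j'
    · exact fee
    · exact Fin.cases f0e fye i'
    · exact Fin.cases (f0C j') (fun i => fyC i j') i
    · exact hFsymm _ _ (Fin.cases f0e fye i)
    · refine Fin.cases (Fin.cases f00 (fun i => hFsymm _ _ (f0y i)) i') (fun i => Fin.cases (f0y i) (fun i' => fyy i i') i') i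

end SchurLorC
end ConvexPaper

namespace ConvexPaper
section SchurLorD
open MvPolynomial
variable {J : Type} (x : ℕ → J)

theorem PL_zero (N : ℕ) : PL x N 0 := by
  classical
  intro D ψ hψ d hd hdeg
  obtain rfl : D = 2 := by simp [dsum] at hdeg; omega
  have h2 : revP (MN N 0) (Zd 0 0 0 d) = 1 := by
    have h3 := revP_mono (MN N 0) 0
    have h4 : Zd 0 0 0 d = monomial 0 1 := by simp [Zd]
    rw [h4, h3]; simp [MN]
  refine Lor.pull (χ' := ψ) (V' := Vx J) (gen0 J 0) (fun g => match g with
    | Sum.inl j => X j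
    | Sum.inr i => i.elim0) (fun _ => 0) (fun _ => le_rfl) ?_ ?_ ?_
  · rintro (j | i)
    · exact Submodule.subset_span ⟨j, rfl⟩
    · exact i.elim0
  · rintro (j | i) (j' | i')
    · simp only [gen0, chi_pair_CC, h2, map_one, mul_one, ite_self, sub_zero]
    · exact i'.elim0
    · exact i.elim0
    · exact i.elim0
  · simpa [xl] using hψ.2 [] rfl

theorem QL_all {N e : ℕ} (ih : PL x N e) : ∀ k ≤ e, QL x N e k := by
  intro k
  induction k with
  | zero => intro _; exact QL_zero x ih
  | succ k ihk => intro hk; exact QL_step x hk (ihk (by omega))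

theorem PL_all (N e : ℕ) : PL x N e := by
  classical
  induction e with
  | zero => exact PL_zero x N
  | succ e ih =>
    intro D ψ hψ d hd hdeg
    have hQ := QL_all x ih e le_rfl N D ψ hψ d hd
      (by have := hd.bound e (by omega); omega) (by push_cast at hdeg; linarith)
    refine Lor.pull (V' := VB J (e + 1)) (gen0 J (e + 1)) (gen0 J (e + 1)) (fun _ => 0) (fun _ => le_rfl)
      (fun g => VB0_le _ (Submodule.subset_span ⟨g, rfl⟩)) ?_ hQ
    rintro (j | i) (j' | i')
    · simp only [gen0, chi_pair_CC, Zd_top, MN_succ, ite_self, sub_zero]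
    · simp only [gen0, mul_comm (C _) (X _), chi_pair_yC, Zd_top, MN_succ, ite_self, sub_zero]
    · simp only [gen0, chi_pair_yC, Zd_top, MN_succ, ite_self, sub_zero]
    · simp only [gen0, chi_pair_yy, Zd_top, MN_succ, ite_self, sub_zero]

theorem LC_Tv {N e w D : ℕ} {d : ℕ → ℤ} (hd : VD e N d) (hw : (e * N : ℤ) = w + dsum e d)
    {ψ : MvPolynomial J ℝ →ₗ[ℝ] ℝ} (hψ : LC (w + D) ψ) : LC D (mulF ψ (Tv x N e d)) := by
  classical
  refine ⟨fun l hl => ?_, fun l hl => ?_⟩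
  · have h1 : LC w (mulF ψ (xl l)) := LC.mul l (by rwa [hl, add_comm])
    have := (pos_both x N e).1 w _ h1 d hd hw
    rw [mulF_apply] at this ⊢
    rwa [mul_comm]
  · have h1 : LC (w + 2) (mulF ψ (xl l)) := LC.mul l (by
      rw [show l.length + (w + 2) = w + D by omega]; exact hψ)
    have hP := PL_all x N e (w + 2) _ h1 d hd (by push_cast; linarith)
    have hL := Lor.pull (V' := VB0 J e) (χ := mulF (mulF ψ (Tv x N e d)) (xl l)) (fun j : J => (X j : MvPolynomial J ℝ))
      (fun j => C (X j)) (fun _ => 0) (fun _ => le_rfl) (fun g => VB0_C e g) ?_ hP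
    · exact Lor.of_one (fun p => rfl) hL
    · intro j j'
      rw [chi_pair_CC]
      simp only [mulF_apply, ite_self, sub_zero]
      congr 1
      simp only [Tv]; ring

end SchurLorD
end ConvexPaper

namespace ConvexPaper
section DualJT
open MvPolynomial

/-- Signed elementary polynomials with integer index. -/
noncomputable def wq (e : ℕ) (k : ℤ) : MvPolynomial ℕ ℝ := if 0 ≤ k then wz e k.toNat else 0

theorem wq_neg {e : ℕ} {k : ℤ} (h : k < 0) : wq e k = 0 := by rw [wq, if_neg (by omega)]
theorem wq_nat (e k : ℕ) : wq e (k : ℤ) = wz e k := by rw [wq, if_pos (by omega)]; simp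

theorem hz_wq (e n : ℕ) (r t : Fin n) :
    ∑ s : Fin n, hz e ((r : ℤ) - (s : ℕ)) * wq e ((s : ℕ) - (t : ℤ)) = if r = t then 1 else 0 := by
  rw [Fin.sum_univ_eq_sum_range (fun s => hz e ((r : ℤ) - (s : ℕ)) * wq e ((s : ℕ) - (t : ℤ))) n]
  have hsub : Finset.range n ⊆ Finset.range ((t : ℕ) + (e + n + 1)) := by
    intro i; simp only [Finset.mem_range]; omega
  rw [Finset.sum_subset hsub, Finset.sum_range_add, Finset.sum_eq_zero, zero_add]
  · have h := wz_hz e (e + n) (by omega) ((r : ℤ) - (t : ℤ))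
    have h2 : ((r : ℤ) - (t : ℤ) = 0) ↔ r = t := by rw [Fin.ext_iff]; omega
    simp only [h2] at h
    rw [← h]
    refine Finset.sum_congr rfl fun j _ => ?_
    rw [mul_comm]
    congr 1
    · rw [← wq_nat]; congr 1; push_cast; ring
    · congr 1; push_cast; ring
  · intro i hi
    rw [Finset.mem_range] at hi
    rw [wq_neg (by omega), mul_zero]
  · intro i _ hi
    rw [Finset.mem_range] at hi
    rw [hz_neg _ (by have := r.2; omega), zero_mul]

theorem dual_JT {N e : ℕ} (μ : Fin N → ℕ) (d : ℕ → ℤ) (ρ : Fin e ⊕ Fin N ≃ Fin (e + N))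
    (hd : ∀ i : Fin e, d i = ((ρ (Sum.inl i) : ℕ) : ℤ)) (hp : ∀ l, (ρ (Sum.inr l) : ℕ) = μ l + l) :
    ∃ ε : ℤˣ, Zd e e 0 d = ((ε : ℤ) : MvPolynomial ℕ ℝ) *
      (Matrix.of fun j l : Fin N => wq e ((e : ℤ) + (j : ℕ) - ((μ l : ℤ) + (l : ℕ)))).det := by
  classical
  let T : Matrix (Fin (e + N)) (Fin (e + N)) (MvPolynomial ℕ ℝ) := Matrix.of fun r s => hz e ((r : ℤ) - (s : ℕ))
  let W : Matrix (Fin (e + N)) (Fin (e + N)) (MvPolynomial ℕ ℝ) := Matrix.of fun r s => wq e ((r : ℕ) - (s : ℤ))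
  have hTW : T * W = 1 := by
    ext1 r t
    rw [Matrix.mul_apply, Matrix.one_apply]
    exact hz_wq e (e + N) r t
  have hT : T.det = 1 := by
    rw [Matrix.det_of_isLowerTriangular T]
    · refine Finset.prod_eq_one fun i _ => ?_
      simp [T, hz_zero]
    · intro i j hij
      have : i < j := hij
      simp only [T, Matrix.of_apply]
      exact hz_neg _ (by have : (i : ℕ) < j := this; omega)
  let γ : Fin e ⊕ Fin N ≃ Fin (e + N) := finSumFinEquiv
  let A := T.submatrix ρ γ
  let B := W.submatrix γ ρ
  have hAB : A * B = 1 := by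
    rw [Matrix.submatrix_mul_equiv, hTW, Matrix.submatrix_one_equiv]
  have hA : ∃ ε : ℤˣ, A.det = ((ε : ℤ) : MvPolynomial ℕ ℝ) := by
    refine ⟨Equiv.Perm.sign (ρ.trans γ.symm), ?_⟩
    have : A = (T.submatrix γ γ).submatrix (ρ.trans γ.symm) id := by
      ext i j; simp [A]
    rw [this, Matrix.det_permute, Matrix.det_submatrix_equiv_self, hT, mul_one]
  obtain ⟨ε, hε⟩ := hA
  refine ⟨ε, ?_⟩
  have hprod : A * Matrix.fromBlocks 1 B.toBlocks₁₂ 0 B.toBlocks₂₂ = Matrix.fromBlocks A.toBlocks₁₁ 0 A.toBlocks₂₁ 1 := by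
    have h1 := hAB
    rw [← Matrix.fromBlocks_toBlocks A, ← Matrix.fromBlocks_toBlocks B, Matrix.fromBlocks_multiply,
      ← Matrix.fromBlocks_one, Matrix.fromBlocks_inj] at h1
    obtain ⟨_, h2, _, h4⟩ := h1
    conv_lhs => rw [← Matrix.fromBlocks_toBlocks A]
    rw [Matrix.fromBlocks_multiply, h2, h4]
    simp
  have hdet := congrArg Matrix.det hprod
  rw [Matrix.det_mul, Matrix.det_fromBlocks_zero₂₁, Matrix.det_fromBlocks_zero₁₂, hε, Matrix.det_one, Matrix.det_one,
    one_mul, mul_one] at hdet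
  have hZ : Zd e e 0 d = A.toBlocks₁₁.det := by
    unfold Zd
    congr 1
    ext1 i j
    simp [A, T, Matrix.toBlocks₁₁, hd, γ]
  rw [hZ, ← hdet]
  congr 2
  ext1 j l
  simp [B, W, Matrix.toBlocks₂₂, hp, γ]

end DualJT
end ConvexPaper

namespace ConvexPaper
section RevMul
open MvPolynomial

/-- Elementary polynomials, integer index, in the first `e` natural variables. -/
noncomputable def ez : ℕ → ℤ → MvPolynomial ℕ ℝ
  | 0, k => if k = 0 then 1 else 0
  | e + 1, k => ez e k + X e * ez e (k - 1)

theorem ez_neg (e : ℕ) {k : ℤ} (h : k < 0) : ez e k = 0 := by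
  induction e generalizing k with
  | zero => simp [ez, h.ne]
  | succ e ih => rw [ez, ih h, ih (by omega)]; simp

theorem wq_ez (e : ℕ) (k : ℤ) : wq e k = C ((-1 : ℝ) ^ k) * ez e k := by
  rcases lt_or_ge k 0 with h | h
  · rw [wq_neg h, ez_neg e h, mul_zero]
  obtain ⟨k, rfl⟩ := Int.eq_ofNat_of_zero_le h
  rw [wq_nat, zpow_natCast]
  clear h
  induction e generalizing k with
  | zero => rcases k with _ | k <;> simp [wz, ez]; omega
  | succ e ih =>
    rcases k with _ | k
    · rw [wz, ih, ez, ez_neg e (k := ((0 : ℕ) : ℤ) - 1) (by simp)]; simp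
    · rw [wz, ih, ih, ez]
      push_cast
      rw [add_sub_cancel_right, pow_succ]
      simp only [map_mul, map_neg, map_one]
      ring

theorem ez_supp (e : ℕ) (k : ℤ) : ez e k ∈ supported ℝ (Set.Iio e) := by
  induction e generalizing k with
  | zero => rw [ez]; split_ifs; exacts [one_mem _, zero_mem _]
  | succ e ih =>
    have hmono : supported ℝ (Set.Iio e) ≤ supported ℝ (Set.Iio (e + 1)) :=
      supported_mono (Set.Iio_subset_Iio (by omega))
    rw [ez]
    exact add_mem (hmono (ih k)) (mul_mem (X_mem_supported.2 (by simp)) (hmono (ih _)))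

theorem revP_ez (e : ℕ) (k : ℤ) : revP (MN 1 e) (ez e (e - k)) = ez e k := by
  induction e generalizing k with
  | zero =>
    simp only [ez, Nat.cast_zero, zero_sub, neg_eq_zero]
    split_ifs
    · rw [show (1 : MvPolynomial ℕ ℝ) = monomial 0 1 from rfl, revP_mono]; simp [MN]
    · simp
  | succ e ih =>
    rw [ez, map_add, MN_succ, revP_supp _ _ _ (ez_supp _ _), revP_X_mul, ez]
    have h1 := ih k
    have h2 := ih (k - 1)
    rw [show ((e : ℤ) - (k - 1)) = ((e + 1 : ℕ) : ℤ) - k by push_cast; ring] at h2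
    rw [show (((e + 1 : ℕ) : ℤ) - k - 1) = (e : ℤ) - k by push_cast; ring, h1, h2, pow_one, add_comm]

/-- Bounded exponents. -/
def Bd (M : ℕ →₀ ℕ) (p : MvPolynomial ℕ ℝ) : Prop := ∀ β ∈ p.support, β ≤ M

theorem Bd.mul {M M' : ℕ →₀ ℕ} {p q : MvPolynomial ℕ ℝ} (hp : Bd M p) (hq : Bd M' q) : Bd (M + M') (p * q) := by
  classical
  intro β hβ
  obtain ⟨a, ha, b, hb, rfl⟩ := Finset.mem_add.1 (support_mul p q hβ)
  exact add_le_add (hp a ha) (hq b hb)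

theorem Bd.add {M : ℕ →₀ ℕ} {p q : MvPolynomial ℕ ℝ} (hp : Bd M p) (hq : Bd M q) : Bd M (p + q) := by
  classical
  intro β hβ
  rcases Finset.mem_union.1 (support_add hβ) with h | h
  · exact hp β h
  · exact hq β h

theorem Bd.mono {M M' : ℕ →₀ ℕ} (h : M ≤ M') {p : MvPolynomial ℕ ℝ} (hp : Bd M p) : Bd M' p :=
  fun β hβ => (hp β hβ).trans h

theorem Bd_ez (e : ℕ) (k : ℤ) : Bd (MN 1 e) (ez e k) := by
  classical
  induction e generalizing k with
  | zero =>
    rw [ez]; intro β hβ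
    split_ifs at hβ
    · rw [show (1 : MvPolynomial ℕ ℝ) = monomial 0 1 from rfl] at hβ
      rw [Finset.mem_singleton.1 (support_monomial_subset hβ)]; exact zero_le
    · simp at hβ
  | succ e ih =>
    rw [ez, MN_succ]
    refine ((ih k).mono (by simp)).add ?_
    rw [add_comm (MN 1 e)]
    refine Bd.mul (fun β hβ => ?_) (ih _)
    rw [X] at hβ
    exact (Finset.mem_singleton.1 (support_monomial_subset hβ)).le

theorem revP_monomial (M β : ℕ →₀ ℕ) (c : ℝ) (h : β ≤ M) : revP M (monomial β c) = monomial (M - β) c := by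
  rw [← mul_one c, ← smul_eq_mul, ← smul_monomial, map_smul, revP_mono, if_pos h, smul_monomial]

theorem revP_mul {M M' : ℕ →₀ ℕ} {p q : MvPolynomial ℕ ℝ} (hp : Bd M p) (hq : Bd M' q) :
    revP (M + M') (p * q) = revP M p * revP M' q := by
  conv_lhs => rw [p.as_sum, q.as_sum]
  conv_rhs => rw [p.as_sum, q.as_sum]
  rw [Finset.sum_mul_sum, map_sum, map_sum, map_sum, Finset.sum_mul_sum]
  refine Finset.sum_congr rfl fun a ha => ?_
  rw [map_sum]
  refine Finset.sum_congr rfl fun b hb => ?_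
  have h1 := hp a ha
  have h2 := hq b hb
  rw [monomial_mul, revP_monomial _ _ _ (add_le_add h1 h2), revP_monomial _ _ _ h1, revP_monomial _ _ _ h2,
    monomial_mul]
  refine congrArg (fun z => monomial z _) (Finsupp.ext fun i => ?_)
  have := h1 i
  have := h2 i
  simp only [Finsupp.coe_tsub, Finsupp.coe_add, Pi.sub_apply, Pi.add_apply]
  omega

theorem revP_one (M : ℕ →₀ ℕ) : revP 0 (1 : MvPolynomial ℕ ℝ) = 1 := by
  rw [show (1 : MvPolynomial ℕ ℝ) = monomial 0 1 from rfl, revP_mono]; simp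

theorem revP_prod {ι : Type*} (s : Finset ι) (M : ℕ →₀ ℕ) (f : ι → MvPolynomial ℕ ℝ) (hf : ∀ i, Bd M (f i)) :
    revP (s.card • M) (∏ i ∈ s, f i) = ∏ i ∈ s, revP M (f i) ∧ Bd (s.card • M) (∏ i ∈ s, f i) := by
  classical
  induction s using Finset.induction_on with
  | empty =>
    simp only [Finset.card_empty, zero_smul, Finset.prod_empty]
    refine ⟨revP_one 0, fun β hβ => ?_⟩
    rw [show (1 : MvPolynomial ℕ ℝ) = monomial 0 1 from rfl] at hβ
    exact (Finset.mem_singleton.1 (support_monomial_subset hβ)).le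
  | insert a s ha ih =>
    rw [Finset.prod_insert ha, Finset.prod_insert ha, Finset.card_insert_of_notMem ha, succ_nsmul', ← ih.1]
    exact ⟨revP_mul (hf a) ih.2, (hf a).mul ih.2⟩

theorem MN_smul (N e : ℕ) : N • MN 1 e = MN N e := by
  simp only [MN, Finset.smul_sum, Finsupp.smul_single, smul_eq_mul, mul_one]

theorem revP_det {N e : ℕ} (k : Fin N → Fin N → ℤ) :
    revP (MN N e) (Matrix.of fun i j : Fin N => ez e (e - k i j)).det = (Matrix.of fun i j => ez e (k i j)).det := by
  rw [Matrix.det_apply, Matrix.det_apply, map_sum]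
  refine Finset.sum_congr rfl fun π _ => ?_
  have h := (revP_prod (Finset.univ : Finset (Fin N)) (MN 1 e) (fun i => ez e (e - k (π i) i))
    (fun i => Bd_ez e _)).1
  rw [Finset.card_univ, Fintype.card_fin, MN_smul] at h
  simp only [Matrix.of_apply, Units.smul_def, map_zsmul, h, revP_ez]

theorem mesymm_cons {R : Type*} [CommRing R] (a : R) (s : Multiset R) (k : ℕ) :
    (a ::ₘ s).esymm (k + 1) = s.esymm (k + 1) + a * s.esymm k := by
  simp only [Multiset.esymm, Multiset.powersetCard_cons, Multiset.map_add, Multiset.sum_add, Multiset.map_map]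
  congr 1
  simp only [Function.comp_def, Multiset.prod_cons, Multiset.sum_map_mul_left]

theorem rename_esymmZ (e : ℕ) (k : ℤ) : rename (fun i : Fin e => (i : ℕ)) (esymmZ e k) = ez e k := by
  have h1 : ∀ k : ℕ, rename (fun i : Fin e => (i : ℕ)) (esymm (Fin e) ℝ k) =
      ((Multiset.range e).map (X : ℕ → MvPolynomial ℕ ℝ)).esymm k := by
    intro k
    rw [← aeval_X_left_apply (rename _ _), aeval_rename, aeval_esymm_eq_multiset_esymm]
    congr 1
    have : (Multiset.range e) = (Finset.univ : Finset (Fin e)).val.map (fun i : Fin e => (i : ℕ)) := by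
      have h2 : (Finset.univ : Finset (Fin e)).map Fin.valEmbedding = Finset.range e := by
        rw [Fin.map_valEmbedding_univ]; ext; simp
      have h3 := congrArg Finset.val h2
      rw [Finset.map_val] at h3
      exact h3.symm
    rw [this, Multiset.map_map]
  have h2 : ∀ k : ℕ, ((Multiset.range e).map (X : ℕ → MvPolynomial ℕ ℝ)).esymm k = ez e k := by
    clear h1
    induction e with
    | zero => 
      intro k; rcases k with _ | k
      · simp [ez, Multiset.esymm]
      · have : ((k : ℤ) + 1) ≠ 0 := by omega
        simp [ez, Multiset.esymm, Multiset.powersetCard_zero_right, this]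
    | succ e ih =>
      intro k
      rw [Multiset.range_succ, Multiset.map_cons, ez]
      rcases k with _ | k
      · rw [← ih, ez_neg e (k := ((0 : ℕ) : ℤ) - 1) (by simp)]; simp [Multiset.esymm]
      · rw [mesymm_cons, ih, ih]; push_cast; rw [add_sub_cancel_right]
  unfold esymmZ
  split_ifs with h
  · rw [h1, h2, Int.toNat_of_nonneg h]
  · rw [ez_neg e (by omega), map_zero]

theorem rename_schur (e N : ℕ) (lam : Fin N → ℕ) : rename (fun i : Fin e => (i : ℕ)) (schur e N lam) =
    (Matrix.of fun i j : Fin N => ez e ((lam i : ℤ) - ((i : ℕ) : ℤ) + ((j : ℕ) : ℤ))).det := by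
  unfold schur
  rw [AlgHom.map_det]
  congr 1
  ext1 i j
  exact rename_esymmZ _ _

/-- sign extraction -/
theorem wq_det {N e : ℕ} (a b : Fin N → ℤ) : ∃ ε : ℝ, (ε = 1 ∨ ε = -1) ∧
    (Matrix.of fun i j : Fin N => wq e (a i + b j)).det = C ε * (Matrix.of fun i j : Fin N => ez e (a i + b j)).det := by
  refine ⟨(∏ i, (-1 : ℝ) ^ a i) * ∏ j, (-1 : ℝ) ^ b j, ?_, ?_⟩
  · have h : ∀ f : Fin N → ℤ, |∏ i, (-1 : ℝ) ^ f i| = 1 := by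
      intro f; rw [Finset.abs_prod]; exact Finset.prod_eq_one fun i _ => by rw [abs_zpow]; simp
    rw [← abs_eq (by norm_num : (0 : ℝ) ≤ 1), abs_mul, h, h, one_mul]
  · rw [map_mul, map_prod, map_prod, mul_assoc, ← Matrix.det_mul_row, ← Matrix.det_mul_column]
    congr 1
    ext1 i j
    simp only [Matrix.of_apply]
    rw [wq_ez, zpow_add₀ (by norm_num), map_mul]; ring

end RevMul
end ConvexPaper

namespace ConvexPaper
section SchurFinal
open MvPolynomial

theorem exists_rho {N e : ℕ} (μ : Fin N → ℕ) (hμ : Monotone μ) (hle : ∀ l, μ l ≤ e) :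
    ∃ (d : ℕ → ℤ) (ρ : Fin e ⊕ Fin N ≃ Fin (e + N)), VD e N d ∧ (e * N : ℤ) = (∑ l, μ l : ℕ) + dsum e d ∧
      (∀ i : Fin e, d i = ((ρ (Sum.inl i) : ℕ) : ℤ)) ∧ (∀ l, (ρ (Sum.inr l) : ℕ) = μ l + l) := by
  classical
  let q : ℕ → ℕ := fun i => (Finset.univ.filter fun l : Fin N => μ l ≤ i).card
  have hqN : ∀ i, q i ≤ N := fun i => (Finset.card_le_univ _).trans (by simp)
  have hqm : ∀ i j, i ≤ j → q i ≤ q j := fun i j h => Finset.card_le_card fun l hl => by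
    simp only [Finset.mem_filter, Finset.mem_univ, true_and] at hl ⊢; omega
  have hne : ∀ (i : ℕ) (l : Fin N), i + q i ≠ μ l + l := by
    intro i l
    rcases le_or_gt (μ l) i with h | h
    · have : (l : ℕ) + 1 ≤ q i := by
        have h1 : Finset.Iic l ⊆ Finset.univ.filter fun l : Fin N => μ l ≤ i := by
          intro l' hl'
          simp only [Finset.mem_filter, Finset.mem_univ, true_and]
          exact (hμ (Finset.mem_Iic.1 hl')).trans h
        have := Finset.card_le_card h1
        rwa [Fin.card_Iic] at this
      omega
    · have : q i ≤ l := by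
        have h1 : (Finset.univ.filter fun l : Fin N => μ l ≤ i) ⊆ Finset.Iio l := by
          intro l' hl'
          simp only [Finset.mem_filter, Finset.mem_univ, true_and] at hl'
          rw [Finset.mem_Iio]
          by_contra hc
          have := hμ (not_lt.1 hc)
          omega
        have := Finset.card_le_card h1
        rwa [Fin.card_Iio] at this
      omega
  let f : Fin e ⊕ Fin N → Fin (e + N) := fun s => match s with
    | Sum.inl i => ⟨i + q i, by have := hqN i; have := i.2; omega⟩
    | Sum.inr l => ⟨μ l + l, by have := hle l; have := l.2; omega⟩
  have hinj : Function.Injective f := by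
    rintro (i | l) (i' | l') h
    · simp only [f, Fin.mk.injEq] at h
      congr 1
      rcases lt_trichotomy (i : ℕ) i' with h1 | h1 | h1
      · have := hqm i i' h1.le; omega
      · exact Fin.ext h1
      · have := hqm i' i h1.le; omega
    · exact absurd (by simpa [f] using h) (hne i l')
    · exact absurd (by simpa [f] using h.symm) (hne i' l)
    · simp only [f, Fin.mk.injEq] at h
      congr 1
      rcases lt_trichotomy l l' with h1 | h1 | h1
      · have := hμ h1.le; have : (l : ℕ) < l' := h1; omega
      · exact h1
      · have := hμ h1.le; have : (l' : ℕ) < l := h1; omega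
  have hbij : Function.Bijective f := (Fintype.bijective_iff_injective_and_card f).2 ⟨hinj, by simp⟩
  refine ⟨fun i => i + q i, Equiv.ofBijective f hbij, ⟨?_, ?_, ?_⟩, ?_, ?_, ?_⟩
  · intro i _; have := hqm i (i + 1) (by omega); push_cast; omega
  · intro _; positivity
  · intro i _; have := hqN i; omega
  · have h1 : dsum e (fun i => (i : ℤ) + q i) = ∑ i ∈ Finset.range e, (q i : ℤ) :=
      Finset.sum_congr rfl fun i _ => by ring
    have h2 : ∑ i ∈ Finset.range e, q i = ∑ l, (e - μ l) := by
      have : ∀ i, q i = ∑ l, if μ l ≤ i then 1 else 0 := fun i => by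
        simp only [q, Finset.card_filter]
      simp only [this]
      rw [Finset.sum_comm]
      refine Finset.sum_congr rfl fun l _ => ?_
      rw [← Finset.card_filter]
      have : (Finset.range e).filter (fun i => μ l ≤ i) = Finset.Ico (μ l) e := by
        ext i; simp; tauto
      rw [this, Nat.card_Ico]
    have h3 : ∑ l, μ l + ∑ l, (e - μ l) = e * N := by
      rw [← Finset.sum_add_distrib, Finset.sum_congr rfl (g := fun _ => e)]
      · simp [mul_comm]
      · intro l _; have := hle l; omega
    rw [h1, ← Nat.cast_sum, h2]
    exact_mod_cast h3.symm
  · intro i; simp [f]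
  · intro l; simp [f]

theorem schur_Tv (e N : ℕ) (lam : Fin N → ℕ) (hanti : Antitone lam) (hle : ∀ l, lam l ≤ e) :
    ∃ d, VD e N d ∧ (e * N : ℤ) = (∑ l, lam l : ℕ) + dsum e d ∧ ∃ ε : ℝ, (ε = 1 ∨ ε = -1) ∧
      revP (MN N e) (Zd e e 0 d) = C ε * rename (fun i : Fin e => (i : ℕ)) (schur e N lam) := by
  obtain ⟨d, ρ, hd, hs, h1, h2⟩ := exists_rho (e := e) (fun l => lam (Fin.rev l))
    (fun a b h => hanti (Fin.rev_le_rev.2 h)) (fun l => hle _)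
  refine ⟨d, hd, ?_, ?_⟩
  · have : ∑ l, lam (Fin.rev l) = ∑ l, lam l := Equiv.sum_comp Fin.revPerm lam
    rw [hs, this]
  obtain ⟨ε, hε⟩ := dual_JT _ d ρ h1 h2
  obtain ⟨ε', hε', hdet⟩ := wq_det (e := e) (fun j : Fin N => (e : ℤ) + (j : ℕ))
    (fun l => - ((lam (Fin.rev l) : ℤ) + (l : ℕ)))
  refine ⟨(ε : ℤ) * ε', ?_, ?_⟩
  · rcases Int.units_eq_one_or ε with rfl | rfl <;> rcases hε' with rfl | rfl <;> simp
  simp only [← sub_eq_add_neg] at hdet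
  have h3 : (Matrix.of fun i j : Fin N => ez e ((e : ℤ) + (i : ℕ) - ((lam (Fin.rev j) : ℤ) + (j : ℕ)))) =
      (Matrix.of fun i j : Fin N => ez e ((e : ℤ) - ((lam (Fin.rev j) : ℤ) + (j : ℕ) - (i : ℕ)))) := by
    ext1 i j; simp only [Matrix.of_apply]; congr 1; ring
  rw [hε, hdet, h3, rename_schur]
  have hc : ∀ p : MvPolynomial ℕ ℝ, ((ε : ℤ) : MvPolynomial ℕ ℝ) * (C ε' * p) = ((ε : ℤ) * ε' : ℝ) • p := by
    intro p
    rw [smul_eq_C_mul, map_mul, mul_assoc]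
    congr 1
  rw [hc, map_smul, revP_det (fun i j => ((lam (Fin.rev j) : ℤ) + (j : ℕ) - (i : ℕ))), smul_eq_C_mul]
  congr 1
  rw [← Matrix.det_transpose, ← Matrix.det_submatrix_equiv_self Fin.revPerm]
  congr 1
  ext1 i j
  simp only [Matrix.submatrix_apply, Matrix.transpose_apply, Matrix.of_apply, Fin.revPerm_apply, Fin.rev_rev]
  congr 1
  have hi := i.2
  have hj := j.2
  rw [Fin.val_rev, Fin.val_rev]
  omega

theorem LC_schur {J : Type} [Nonempty J] {e N D : ℕ} (x : Fin e → J) (lam : Fin N → ℕ) (hanti : Antitone lam)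
    (hle : ∀ l, lam l ≤ e) {ψ : MvPolynomial J ℝ →ₗ[ℝ] ℝ} (hψ : LC ((∑ l, lam l) + D) ψ) :
    ∃ ε : ℝ, (ε = 1 ∨ ε = -1) ∧ LC D (mulF ψ (C ε * rename x (schur e N lam))) := by
  obtain ⟨d, hd, hs, ε, hε, h⟩ := schur_Tv e N lam hanti hle
  let x' : ℕ → J := fun i => if h : i < e then x ⟨i, h⟩ else Classical.arbitrary J
  refine ⟨ε, hε, ?_⟩
  have h1 := LC_Tv x' hd hs hψ
  rw [Tv, h, map_mul, rename_C, rename_rename] at h1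
  have h2 : x' ∘ (fun i : Fin e => (i : ℕ)) = x := by funext i; simp [x']
  rwa [h2] at h1

theorem LC_prod {J : Type} [Nonempty J] {p : ℕ} (t N : Fin p → ℕ) (x : ∀ i, Fin (t i) → J)
    (lam : ∀ i, Fin (N i) → ℕ) (hanti : ∀ i, Antitone (lam i)) (hle : ∀ i l, lam i l ≤ t i) (s : Finset (Fin p)) :
    ∀ {D : ℕ} {ψ : MvPolynomial J ℝ →ₗ[ℝ] ℝ}, LC ((∑ i ∈ s, ∑ l, lam i l) + D) ψ →
    ∃ ε : ℝ, (ε = 1 ∨ ε = -1) ∧ LC D (mulF ψ (C ε * ∏ i ∈ s, rename (x i) (schur (t i) (N i) (lam i)))) := by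
  classical
  induction s using Finset.induction_on with
  | empty =>
    intro D ψ hψ
    refine ⟨1, Or.inl rfl, ?_⟩
    have : mulF ψ (C 1 * ∏ i ∈ (∅ : Finset (Fin p)), rename (x i) (schur (t i) (N i) (lam i))) = ψ := by
      refine LinearMap.ext fun b => ?_
      rw [mulF_apply]; simp
    rw [this]; simpa using hψ
  | insert a s ha ih =>
    intro D ψ hψ
    rw [Finset.sum_insert ha, add_assoc] at hψ
    obtain ⟨ε, hε, h1⟩ := LC_schur (x a) (lam a) (hanti a) (hle a) hψ
    obtain ⟨ε', hε', h2⟩ := ih h1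
    refine ⟨ε * ε', by rcases hε with rfl | rfl <;> rcases hε' with rfl | rfl <;> simp, ?_⟩
    convert h2 using 1
    refine LinearMap.ext fun b => ?_
    simp only [mulF_apply]
    rw [Finset.prod_insert ha, C_mul]
    congr 1; ring

end SchurFinal
end ConvexPaper

namespace ConvexPaper
section FinalIneq
open MvPolynomial
variable {J : Type}

theorem xl_append (l l' : List J) : xl (l ++ l') = xl l * xl l' := by simp [xl]
theorem xl_cons (a : J) (l : List J) : xl (a :: l) = X a * xl l := by simp [xl]
theorem xl_rep (b : J) (k : ℕ) : xl (List.replicate k b) = X b ^ k := by simp [xl]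

theorem LC.mul1 {D : ℕ} {φ : MvPolynomial J ℝ →ₗ[ℝ] ℝ} (a : J) (h : LC (D + 1) φ) : LC D (mulF φ (X a)) := by
  have := LC.mul (D := D) [a] (by simpa [add_comm] using h)
  simpa [xl] using this

/-- Positivity of monomial values. -/
theorem LC.pp {D : ℕ} {φ : MvPolynomial J ℝ →ₗ[ℝ] ℝ} (h : LC D φ) (l : List J) (hl : l.length = D)
    {q : MvPolynomial J ℝ} (hq : q = xl l) : 0 < φ q := by rw [hq]; exact h.1 l hl

theorem LC.rev_cs {φ : MvPolynomial J ℝ →ₗ[ℝ] ℝ} (l : List J) (h : LC (l.length + 2) φ) (b a c : J) :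
    φ (X b * (X b * xl l)) * φ (X a * (X c * xl l)) ≤ 2 * φ (X b * (X a * xl l)) * φ (X b * (X c * xl l)) := by
  have hpos : ∀ a c : J, 0 < φ (X a * (X c * xl l)) := fun a c =>
    h.pp (a :: c :: l) (by simp) (by simp [xl_cons])
  set s := φ (X b * (X c * xl l)) with hs
  set t := φ (X b * (X a * xl l)) with ht
  have hs0 : 0 < s := hpos b c
  have ht0 : 0 < t := hpos b a
  have hX : ∀ j : J, (X j : MvPolynomial J ℝ) ∈ Vx J := fun j => Submodule.subset_span ⟨j, rfl⟩
  have hL := h.2 l rfl (X b) (hX b) (s • X a + t • X c)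
    (Submodule.add_mem _ (Submodule.smul_mem _ _ (hX a)) (Submodule.smul_mem _ _ (hX c)))
  have e1 : xl l * X b * X b = X b * (X b * xl l) := by ring
  have e2 : φ (xl l * X b * (s • X a + t • X c)) = s * t + t * s := by
    have : xl l * X b * (s • X a + t • X c) = s • (X b * (X a * xl l)) + t • (X b * (X c * xl l)) := by
      simp only [smul_eq_C_mul]; ring
    rw [this, map_add, map_smul, map_smul, smul_eq_mul, smul_eq_mul]
  have e3 : φ (xl l * (s • X a + t • X c) * (s • X a + t • X c)) =
      s ^ 2 * φ (X a * (X a * xl l)) + 2 * s * t * φ (X a * (X c * xl l)) + t ^ 2 * φ (X c * (X c * xl l)) := by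
    have : xl l * (s • X a + t • X c) * (s • X a + t • X c) = s ^ 2 • (X a * (X a * xl l)) +
        (2 * s * t) • (X a * (X c * xl l)) + t ^ 2 • (X c * (X c * xl l)) := by
      simp only [smul_eq_C_mul, C_mul, C_pow]
      rw [show (C 2 : MvPolynomial J ℝ) = 2 from rfl]; ring
    rw [this, map_add, map_add, map_smul, map_smul, map_smul, smul_eq_mul, smul_eq_mul, smul_eq_mul]
  rw [e1, e2, e3] at hL
  have h1 := hL (hpos b b)
  have h2 : 0 ≤ φ (X b * (X b * xl l)) * (s ^ 2 * φ (X a * (X a * xl l)) + t ^ 2 * φ (X c * (X c * xl l))) :=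
    mul_nonneg (hpos b b).le (add_nonneg (mul_nonneg (sq_nonneg _) (hpos a a).le) (mul_nonneg (sq_nonneg _) (hpos c c).le))
  have h3 : (2 * (s * t)) * (φ (X b * (X b * xl l)) * φ (X a * (X c * xl l))) ≤ (2 * (s * t)) * (2 * t * s) := by
    nlinarith
  exact le_of_mul_le_mul_left h3 (by positivity)

theorem LC.single_ineq (b a : J) : ∀ (L : List J) {φ : MvPolynomial J ℝ →ₗ[ℝ] ℝ}, LC (L.length + 1) φ →
    φ (X b ^ (L.length + 1)) * φ (X a * xl L) ≤ 2 ^ L.length * (φ (X b * xl L) * φ (X b ^ L.length * X a)) := by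
  intro L
  induction L with
  | nil => intro φ _; simp [xl]
  | cons c L ih =>
    intro φ h
    simp only [List.length_cons] at h ⊢
    have h1 := LC.rev_cs L h b a c
    have h2 := ih (LC.mul1 b h)
    simp only [mulF_apply] at h2
    rw [← pow_succ', ← mul_assoc (X b) (X b ^ _), ← pow_succ'] at h2
    have hbb : 0 < φ (X b * (X b * xl L)) := h.pp (b :: b :: L) (by simp) (by simp [xl_cons])
    have hbc : 0 < φ (X b * (X c * xl L)) := h.pp (b :: c :: L) (by simp) (by simp [xl_cons])
    have hbm : 0 < φ (X b ^ (L.length + 1 + 1)) := h.pp (List.replicate (L.length + 2) b) (by simp) (by simp [xl_rep])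
    rw [xl_cons]
    refine le_of_mul_le_mul_left ?_ hbb
    calc _ = φ (X b ^ (L.length + 1 + 1)) * (φ (X b * (X b * xl L)) * φ (X a * (X c * xl L))) := by ring
      _ ≤ φ (X b ^ (L.length + 1 + 1)) * (2 * φ (X b * (X a * xl L)) * φ (X b * (X c * xl L))) := by gcongr
      _ = 2 * φ (X b * (X c * xl L)) * (φ (X b ^ (L.length + 1 + 1)) * φ (X b * (X a * xl L))) := by ring
      _ ≤ 2 * φ (X b * (X c * xl L)) * (2 ^ L.length * (φ (X b * (X b * xl L)) * φ (X b ^ (L.length + 1) * X a))) := by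
        gcongr
      _ = _ := by ring

theorem LC.main_ineq (b : J) (L₂ : List J) : ∀ (L : List J) {φ : MvPolynomial J ℝ →ₗ[ℝ] ℝ}, LC (L.length + L₂.length) φ →
    φ (X b ^ (L.length + L₂.length)) * φ (xl L * xl L₂) ≤
      2 ^ (L.length * L₂.length) * (φ (X b ^ L.length * xl L₂) * φ (X b ^ L₂.length * xl L)) := by
  intro L
  induction L with
  | nil => intro φ _; simp [xl]; rw [mul_comm]
  | cons a L ih =>
    intro φ h
    simp only [List.length_cons] at h ⊢
    rw [xl_cons]
    have h1 := ih (LC.mul1 a (by rwa [add_right_comm] at h))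
    simp only [mulF_apply] at h1
    have h2 := LC.single_ineq b a L₂ (LC.mulX (a := L.length) b (by rw [← add_assoc]; rwa [add_right_comm] at h))
    simp only [mulF_apply] at h2
    have p1 : 0 < φ (X a * X b ^ (L.length + L₂.length)) := h.pp (a :: List.replicate (L.length + L₂.length) b)
      (by simp; omega) (by simp [xl_cons, xl_rep])
    have p2 : 0 < φ (X b ^ (L.length + 1 + L₂.length)) := h.pp (List.replicate (L.length + 1 + L₂.length) b)
      (by simp) (by simp [xl_rep])
    have p3 : 0 < φ (X a * (X b ^ L₂.length * xl L)) := h.pp (a :: (List.replicate L₂.length b ++ L))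
      (by simp; omega) (by simp [xl_cons, xl_rep, xl_append])
    have e1 : X b ^ L.length * X b ^ (L₂.length + 1) = (X b ^ (L.length + 1 + L₂.length) : MvPolynomial J ℝ) := by ring
    have e2 : X b ^ L.length * (X a * xl L₂) = X a * (X b ^ L.length * xl L₂) := by ring
    have e3 : X b ^ L.length * (X b * xl L₂) = X b ^ (L.length + 1) * xl L₂ := by ring
    have e4 : X b ^ L.length * (X b ^ L₂.length * X a) = (X a * X b ^ (L.length + L₂.length) : MvPolynomial J ℝ) := by ring
    have e5 : X b ^ L₂.length * (X a * xl L) = X a * (X b ^ L₂.length * xl L) := by ring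
    rw [e1, e2, e3, e4] at h2
    rw [e5, mul_assoc (X a : MvPolynomial J ℝ)]
    refine le_of_mul_le_mul_left ?_ p1
    calc _ = φ (X b ^ (L.length + 1 + L₂.length)) *
          (φ (X a * X b ^ (L.length + L₂.length)) * φ (X a * (xl L * xl L₂))) := by ring
      _ ≤ φ (X b ^ (L.length + 1 + L₂.length)) * (2 ^ (L.length * L₂.length) *
          (φ (X a * (X b ^ L.length * xl L₂)) * φ (X a * (X b ^ L₂.length * xl L)))) := by gcongr
      _ = 2 ^ (L.length * L₂.length) * φ (X a * (X b ^ L₂.length * xl L)) *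
          (φ (X b ^ (L.length + 1 + L₂.length)) * φ (X a * (X b ^ L.length * xl L₂))) := by ring
      _ ≤ 2 ^ (L.length * L₂.length) * φ (X a * (X b ^ L₂.length * xl L)) *
          (2 ^ L₂.length * (φ (X b ^ (L.length + 1) * xl L₂) * φ (X a * X b ^ (L.length + L₂.length)))) := by gcongr
      _ = _ := by ring

end FinalIneq
end ConvexPaper

namespace ConvexPaper
section Homog
open MvPolynomial

theorem esymm_homog (e k : ℕ) : (esymm (Fin e) ℝ k).IsHomogeneous k := by
  rw [esymm]
  refine IsHomogeneous.sum _ _ _ fun s hs => ?_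
  have := IsHomogeneous.prod s (fun i => (X i : MvPolynomial (Fin e) ℝ)) (fun _ => 1) (fun i _ => isHomogeneous_X ℝ i)
  have hc := (Finset.mem_powersetCard.1 hs).2
  simpa [hc] using this

theorem schur_homog (e N : ℕ) (lam : Fin N → ℕ) : (schur e N lam).IsHomogeneous (∑ i, lam i) := by
  rw [schur, Matrix.det_apply]
  refine IsHomogeneous.sum _ _ _ fun π _ => ?_
  rw [Units.smul_def]
  refine (homogeneousSubmodule (Fin e) ℝ (∑ i, lam i)).toAddSubgroup.zsmul_mem ?_ _
  change (∏ i, (Matrix.of fun i j : Fin N =>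
    esymmZ e ((lam i : ℤ) - ((i : ℕ) : ℤ) + ((j : ℕ) : ℤ))) (π i) i).IsHomogeneous _
  simp only [Matrix.of_apply]
  by_cases h : ∀ i, 0 ≤ ((lam (π i) : ℤ) - ((π i : ℕ) : ℤ) + ((i : ℕ) : ℤ))
  · have hs : (∑ i, lam i) = ∑ i, ((lam (π i) : ℤ) - ((π i : ℕ) : ℤ) + ((i : ℕ) : ℤ)).toNat := by
      zify
      rw [Finset.sum_congr rfl (fun i _ => Int.toNat_of_nonneg (h i))]
      rw [Finset.sum_add_distrib, Finset.sum_sub_distrib, Equiv.sum_comp π (fun i => (lam i : ℤ)),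
        Equiv.sum_comp π (fun i => ((i : ℕ) : ℤ))]
      ring
    rw [hs]
    refine IsHomogeneous.prod _ _ _ fun i _ => ?_
    rw [esymmZ, if_pos (h i)]
    exact esymm_homog _ _
  · push Not at h
    obtain ⟨i, hi⟩ := h
    rw [Finset.prod_eq_zero (Finset.mem_univ i)]
    · exact isHomogeneous_zero _ _ _
    · rw [esymmZ, if_neg (by omega)]

theorem schurProd_homog (p : ℕ) (t N : Fin p → ℕ) (lam : ∀ i, Fin (N i) → ℕ) :
    (schurProd p t N lam).IsHomogeneous (∑ i, ∑ l, lam i l) :=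
  IsHomogeneous.prod _ _ _ fun i _ => (schur_homog _ _ _).rename_isHomogeneous

end Homog

section Lim
open MvPolynomial Filter Topology

theorem rename_mono_xl {ι J : Type} [Fintype ι] (f : ι → J) (μ : ι →₀ ℕ) :
    rename f (monomial μ (1 : ℝ)) =
      xl ((Finset.univ : Finset ι).toList.map fun i => List.replicate (μ i) (f i)).flatten := by
  have h : ∀ l : List ι, xl (l.map fun i => List.replicate (μ i) (f i)).flatten =
      (l.map fun i => (X (f i) : MvPolynomial J ℝ) ^ μ i).prod := by
    intro l
    induction l with
    | nil => simp [xl]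
    | cons a l ih => simp [xl_append, xl_rep, ih]
  rw [h, Finset.prod_map_toList, monomial_eq, map_mul, rename_C, C_1, one_mul,
    Finsupp.prod_fintype _ _ (fun _ => pow_zero _), map_prod]
  simp

theorem flat_length {ι J : Type} [Fintype ι] (f : ι → J) (μ : ι →₀ ℕ) :
    ((Finset.univ : Finset ι).toList.map fun i => List.replicate (μ i) (f i)).flatten.length = μ.degree := by
  rw [List.length_flatten, List.map_map]
  rw [Finsupp.degree_eq_sum, ← Finset.sum_map_toList]
  congr 1
  simp [Function.comp_def]

theorem flat_map {ι J K : Type} (l : List ι) (f : ι → J) (g : J → K) (μ : ι →₀ ℕ) :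
    (l.map fun i => List.replicate (μ i) (f i)).flatten.map g =
      (l.map fun i => List.replicate (μ i) (g (f i))).flatten := by
  induction l with
  | nil => simp
  | cons a l ih => simp [ih]

theorem lim_poly {n : ℕ} {ι J : Type} [Fintype ι] (C : J → Set (En n))
    (ψ : ℕ → MvPolynomial J ℝ →ₗ[ℝ] ℝ)
    (hψ : ∀ l : List J, l.length = n → Tendsto (fun ν => ψ ν (xl l)) atTop (𝓝 (mixedVol n (l.map C))))
    (f : ι → J) (P : MvPolynomial ι ℝ) (d : ℕ) (hP : P.IsHomogeneous d) (L : List J)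
    (hL : d + L.length = n) :
    Tendsto (fun ν => ψ ν (rename f P * xl L)) atTop
      (𝓝 (polyMixedVol n P (fun i => C (f i)) (L.map C))) := by
  have h1 : ∀ ν, ψ ν (rename f P * xl L) = ∑ μ ∈ P.support, P.coeff μ *
      ψ ν (xl (((Finset.univ : Finset ι).toList.map fun i => List.replicate (μ i) (f i)).flatten ++ L)) := by
    intro ν
    conv_lhs => rw [P.as_sum, map_sum, Finset.sum_mul, map_sum]
    refine Finset.sum_congr rfl fun μ _ => ?_
    have e : monomial μ (coeff μ P) = coeff μ P • monomial μ (1 : ℝ) := by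
      rw [smul_monomial, smul_eq_mul, mul_one]
    rw [xl_append, ← rename_mono_xl, e, map_smul, smul_mul_assoc, map_smul, smul_eq_mul]
  simp only [h1]
  unfold polyMixedVol
  refine tendsto_finsetSum _ fun μ hμ => ?_
  have hd : μ.degree = d := by
    have := hP (mem_support_iff.1 hμ)
    rw [Finsupp.degree_eq_weight_one]; exact this
  have := hψ (((Finset.univ : Finset ι).toList.map fun i => List.replicate (μ i) (f i)).flatten ++ L)
    (by rw [List.length_append, flat_length, hd, hL])
  rw [List.map_append, flat_map] at this
  exact this.const_mul _

end Lim
end ConvexPaper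

namespace ConvexPaper

/-- rKT property for mixed volumes against Schur-type arguments
`Θ = (s_{λ^1}(E_1),…,s_{λ^p}(E_p))` filling `n−m` slots: for convex bodies
`B, A_1,…,A_m` and `1 ≤ k ≤ m`,
`V(B[m],Θ)·V(A_1,…,A_m,Θ) ≤ 2^{k(m−k)}·V(B[k],A_{k+1},…,A_m,Θ)·V(B[m−k],A_1,…,A_k,Θ)`. -/
theorem statement19 (n m k p : ℕ) (hm1 : 1 ≤ m) (hm : m ≤ n)
    (hk1 : 1 ≤ k) (hk : k ≤ m)
    (t : Fin p → ℕ) (K : ∀ i : Fin p, Fin (t i) → ConvexBody (En n))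
    (N : Fin p → ℕ) (lam : ∀ i, Fin (N i) → ℕ)
    (hanti : ∀ i, Antitone (lam i)) (hle : ∀ i j, lam i j ≤ t i)
    (hdeg : (∑ i, ∑ j, lam i j) = n - m)
    (B : ConvexBody (En n)) (A : Fin m → ConvexBody (En n)) :
    polyMixedVol n (schurProd p t N lam) (fun x => (K x.1 x.2 : Set (En n)))
        (List.replicate m (B : Set (En n))) *
      polyMixedVol n (schurProd p t N lam) (fun x => (K x.1 x.2 : Set (En n)))
        (List.ofFn fun i => (A i : Set (En n))) ≤
    2 ^ (k * (m - k)) *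
      (polyMixedVol n (schurProd p t N lam) (fun x => (K x.1 x.2 : Set (En n)))
          (List.replicate k (B : Set (En n)) ++
            List.ofFn fun i : Fin (m - k) => (A ⟨k + (i : ℕ), by omega⟩ : Set (En n))) *
       polyMixedVol n (schurProd p t N lam) (fun x => (K x.1 x.2 : Set (En n)))
          (List.replicate (m - k) (B : Set (En n)) ++
            List.ofFn fun i : Fin k => (A (Fin.castLE hk i) : Set (En n)))) := by
  classical
  set J := ((i : Fin p) × Fin (t i)) ⊕ Option (Fin m) with hJ
  let C : J → Set (En n) := Sum.elim (fun x => (K x.1 x.2 : Set (En n)))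
    (fun o => o.elim (B : Set (En n)) (fun i => (A i : Set (En n))))
  have hCall : ∀ j, ∃ b : ConvexBody (En n), C j = b := by
    rintro (x | _ | i)
    · exact ⟨K x.1 x.2, rfl⟩
    · exact ⟨B, rfl⟩
    · exact ⟨A i, rfl⟩
  have : Nonempty J := ⟨Sum.inr none⟩
  obtain ⟨ψ, hLC, hψ⟩ := exists_seq (n := n) (by omega) C
    (fun j => by obtain ⟨b, hb⟩ := hCall j; rw [hb]; exact b.isCompact)
    (fun j => by obtain ⟨b, hb⟩ := hCall j; rw [hb]; exact b.convex)
    (fun j => by obtain ⟨b, hb⟩ := hCall j; rw [hb]; exact b.nonempty)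
  let b : J := Sum.inr none
  let L : List J := List.ofFn fun i : Fin k => Sum.inr (some (Fin.castLE hk i))
  let L₂ : List J := List.ofFn fun i : Fin (m - k) => Sum.inr (some ⟨k + (i : ℕ), by omega⟩)
  have hLl : L.length = k := by simp [L]
  have hLl₂ : L₂.length = m - k := by simp [L₂]
  set P := MvPolynomial.rename (Sum.inl : _ → J) (schurProd p t N lam) with hPdef
  have lim := fun (M : List J) (hM : M.length = m) =>
    lim_poly C ψ hψ (Sum.inl : _ → J) (schurProd p t N lam) _ (schurProd_homog p t N lam) M
      (by rw [hdeg, hM]; omega)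
  have l1 := lim (List.replicate m b) (by simp)
  have l2 := lim (L ++ L₂) (by simp [hLl, hLl₂]; omega)
  have l3 := lim (List.replicate k b ++ L₂) (by simp [hLl₂]; omega)
  have l4 := lim (List.replicate (m - k) b ++ L) (by simp [hLl]; omega)
  have m1 : (List.replicate m b).map C = List.replicate m (B : Set (En n)) := by
    rw [List.map_replicate]; rfl
  have m2 : (L ++ L₂).map C = List.ofFn fun i => (A i : Set (En n)) := by
    refine List.ext_getElem (by simp [hLl, hLl₂]; omega) fun i h1 h2 => ?_
    rw [List.getElem_map, List.getElem_ofFn, List.getElem_append]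
    split_ifs with h
    · simp only [L, List.getElem_ofFn]; rfl
    · simp only [L₂, List.getElem_ofFn]
      rw [hLl] at h
      have : (⟨k + (i - L.length), by rw [hLl]; simp at h2; omega⟩ : Fin m) = ⟨i, by simpa using h2⟩ := by
        ext; simp only [hLl]; omega
      change (A ⟨k + (i - L.length), _⟩ : Set (En n)) = _
      rw [this]
  have m3 : (List.replicate k b ++ L₂).map C = List.replicate k (B : Set (En n)) ++
            List.ofFn fun i : Fin (m - k) => (A ⟨k + (i : ℕ), by omega⟩ : Set (En n)) := by
    rw [List.map_append, List.map_replicate, List.map_ofFn]; rfl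
  have m4 : (List.replicate (m - k) b ++ L).map C = List.replicate (m - k) (B : Set (En n)) ++
            List.ofFn fun i : Fin k => (A (Fin.castLE hk i) : Set (En n)) := by
    rw [List.map_append, List.map_replicate, List.map_ofFn]; rfl
  rw [m1] at l1
  rw [m2] at l2
  rw [m3] at l3
  rw [m4] at l4
  refine le_of_tendsto_of_tendsto' (l1.mul l2) ((l3.mul l4).const_mul (2 ^ (k * (m - k)))) fun ν => ?_
  have hPe : P = ∏ i ∈ (Finset.univ : Finset (Fin p)),
      MvPolynomial.rename (fun j => (Sum.inl ⟨i, j⟩ : J)) (schur (t i) (N i) (lam i)) := by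
    rw [hPdef, schurProd, map_prod]
    refine Finset.prod_congr rfl fun i _ => ?_
    rw [MvPolynomial.rename_rename]; rfl
  obtain ⟨ε, hε, hφ⟩ := LC_prod t N (fun i j => (Sum.inl ⟨i, j⟩ : J)) lam hanti hle Finset.univ
    (D := L.length + L₂.length) (ψ := ψ ν)
    (by rw [hdeg, hLl, hLl₂, show n - m + (k + (m - k)) = n by omega]; exact hLC ν)
  rw [← hPe] at hφ
  have key := LC.main_ineq b L₂ L hφ
  have hC : ∀ q, mulF (ψ ν) (MvPolynomial.C ε * P) q = ε * ψ ν (P * q) := by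
    intro q
    rw [mulF_apply, mul_assoc, ← MvPolynomial.smul_eq_C_mul, map_smul, smul_eq_mul]
  have hε2 : ε * ε = 1 := by rcases hε with h | h <;> rw [h] <;> norm_num
  simp only [hC, hLl, hLl₂] at key
  rw [show k + (m - k) = m by omega] at key
  simp only [xl_append, xl_rep]
  calc _ = ε * ε * (ψ ν (P * MvPolynomial.X b ^ m) * ψ ν (P * (xl L * xl L₂))) := by rw [hε2, one_mul]
    _ = _ := by ring
    _ ≤ _ := key
    _ = ε * ε * (2 ^ (k * (m - k)) * (ψ ν (P * (MvPolynomial.X b ^ k * xl L₂)) *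
          ψ ν (P * (MvPolynomial.X b ^ (m - k) * xl L)))) := by ring
    _ = _ := by rw [hε2, one_mul]

end ConvexPaper
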